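/- (Identifiability of Chow secants.) Let n ≥ 2, d ≥ 3, let Chow_{d,n} ⊆ S^d_n be the Zariski closure of the set of products ℓ₁ * ℓ₂ * ⋯ * ℓ_d of d homogeneous linear forms ℓᵢ ∈ S^1_n, and set N := d*(n−1)+1. For every m ≥ 1 with N * (m + 1 + N) ≤ choose (n+d−1) d, the variety Chow_{d,n} is m-identifiable. -/

import Mathlib

noncomputable section

open MvPolynomial

/-- The Zariski topology on a `ℂ`-vector space `M` (for finite-dimensional `M`,
identified with a coordinate space via a basis, this is the topology in which a set
is closed iff it is the common zero locus of a family of polynomial functions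
of the coordinates). -/
def ztV (M : Type*) [AddCommGroup M] [Module ℂ M] : TopologicalSpace M :=
  TopologicalSpace.generateFrom
    { U | ∃ (k : ℕ) (p : MvPolynomial (Fin k) ℂ) (L : Fin k → M →ₗ[ℂ] ℂ),
        U = { x | MvPolynomial.eval (fun i => L i x) p ≠ 0 } }

def zIsOpenV {M : Type*} [AddCommGroup M] [Module ℂ M] (S : Set M) : Prop :=
  @IsOpen _ (ztV M) S

def zClosureV {M : Type*} [AddCommGroup M] [Module ℂ M] (S : Set M) : Set M :=
  @closure _ (ztV M) S

/-- The topological Krull dimension of `S` (with the subspace Zariski topology):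
the supremum of lengths of chains of irreducible closed subsets. -/
def zDimV {M : Type*} [AddCommGroup M] [Module ℂ M] (S : Set M) : WithBot ℕ∞ :=
  @topologicalKrullDim ↥S (TopologicalSpace.induced Subtype.val (ztV M))

/-- The `m`-th secant variety: the Zariski closure of the set of sums of `m` points of `V`. -/
def secantV {M : Type*} [AddCommGroup M] [Module ℂ M] (m : ℕ) (V : Set M) : Set M :=
  zClosureV { p | ∃ x : Fin m → M, (∀ i, x i ∈ V) ∧ p = ∑ i, x i }

/-- `V` is `m`-identifiable: there is a dense open subset `O` of `σ_m V` such that every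
`p ∈ O` is a sum of `m` points of `V`, uniquely up to a permutation of the summands. -/
def IsIdentifiableV {M : Type*} [AddCommGroup M] [Module ℂ M] (m : ℕ) (V : Set M) : Prop :=
  ∃ O : Set M, O ⊆ secantV m V ∧
    (∃ U, zIsOpenV U ∧ O = U ∩ secantV m V) ∧
    secantV m V ⊆ zClosureV O ∧
    ∀ p ∈ O,
      (∃ x : Fin m → M, (∀ i, x i ∈ V) ∧ p = ∑ i, x i) ∧
      ∀ x y : Fin m → M, (∀ i, x i ∈ V) → (∀ i, y i ∈ V) →
        p = ∑ i, x i → p = ∑ i, y i →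
          ∃ e : Equiv.Perm (Fin m), ∀ i, y i = x (e i)

/-- The Chow variety: the Zariski closure in `S^d_n` of the set of products of `d`
homogeneous linear forms. -/
def ChowVariety (n d : ℕ) : Set ↥(homogeneousSubmodule (Fin n) ℂ d) :=
  zClosureV { f | ∃ ℓ : Fin d → MvPolynomial (Fin n) ℂ,
    (∀ i, ℓ i ∈ homogeneousSubmodule (Fin n) ℂ 1) ∧
    (f : MvPolynomial (Fin n) ℂ) = ∏ i, ℓ i }

/-! ### Linear algebra and field theory -/

/-- Linear independence of families of coordinate vectors is preserved by field extensions. -/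
theorem LinearIndependent.field_map {F K I κ : Type*} [Field F] [Field K] (φ : F →+* K)
    {v : I → κ → F} (hv : LinearIndependent F v) :
    LinearIndependent K (fun i k => φ (v i k)) := by
  let := φ.toAlgebra
  rw [linearIndependent_iff'] at hv ⊢
  intro s c hc i hi
  rw [← Module.forall_dual_apply_eq_zero_iff F (c i)]
  intro f
  refine hv s (fun i => f (c i)) ?_ i hi
  ext k
  have := congrArg f (congrFun hc k)
  simp only [Finset.sum_apply, Pi.smul_apply, smul_eq_mul, Pi.zero_apply, map_zero,
    map_sum] at this ⊢
  rw [← this]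
  refine Finset.sum_congr rfl fun i _ => ?_
  have : c i * φ (v i k) = v i k • c i := by rw [Algebra.smul_def, mul_comm]; rfl
  rw [this, map_smul, smul_eq_mul, mul_comm]

theorem LinearIndependent.of_field_map {F K I κ : Type*} [Field F] [Field K] (φ : F →+* K)
    {v : I → κ → F} (hv : LinearIndependent K (fun i k => φ (v i k))) :
    LinearIndependent F v := by
  rw [linearIndependent_iff'] at hv ⊢
  intro s c hc i hi
  refine φ.injective ?_
  rw [map_zero]
  refine hv s (fun i => φ (c i)) ?_ i hi
  ext k
  have := congrArg φ (congrFun hc k)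
  simpa using this

theorem AlgebraicIndependent.exists_fractionRing_hom {τ K : Type*} [Field K] [Algebra ℂ K]
    {z : τ → K} (hz : AlgebraicIndependent ℂ z) :
    ∃ φ : FractionRing (MvPolynomial τ ℂ) →+* K,
      ∀ p : MvPolynomial τ ℂ, φ (algebraMap _ _ p) = aeval z p := by
  refine ⟨IsFractionRing.lift (g := (aeval z : MvPolynomial τ ℂ →ₐ[ℂ] K).toRingHom) hz, ?_⟩
  intro p
  simp [IsFractionRing.lift_algebraMap]

/-- Linear independence of vectors with polynomial entries evaluated at an algebraically
independent family does not depend on that family. -/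
theorem LinearIndependent.aeval_transfer {τ I κ K₁ K₂ : Type*} [Field K₁] [Field K₂]
    [Algebra ℂ K₁] [Algebra ℂ K₂] {z₁ : τ → K₁} {z₂ : τ → K₂} (h₁ : AlgebraicIndependent ℂ z₁)
    (h₂ : AlgebraicIndependent ℂ z₂) (A : I → κ → MvPolynomial τ ℂ)
    (h : LinearIndependent K₁ (fun i k => aeval z₁ (A i k))) :
    LinearIndependent K₂ (fun i k => aeval z₂ (A i k)) := by
  let F := FractionRing (MvPolynomial τ ℂ)
  obtain ⟨φ₁, hφ₁⟩ := h₁.exists_fractionRing_hom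
  obtain ⟨φ₂, hφ₂⟩ := h₂.exists_fractionRing_hom
  have : LinearIndependent F (fun i k => algebraMap _ F (A i k)) := by
    apply LinearIndependent.of_field_map φ₁
    simp_rw [F, hφ₁]
    exact h
  have h3 := this.field_map φ₂
  simp_rw [F, hφ₂] at h3
  exact h3

theorem exists_section_of_formallySmooth {R A B : Type*} [CommRing R] [CommRing A] [CommRing B]
    [Algebra R A] [Algebra.FormallySmooth R A] (f : R →+* B) (g : B →+* A)
    (hg : Function.Surjective g) (hk : IsNilpotent (RingHom.ker g))
    (hfg : g.comp f = algebraMap R A) :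
    ∃ h : A →+* B, g.comp h = RingHom.id A ∧ h.comp (algebraMap R A) = f := by
  let := f.toAlgebra
  let g' : B →ₐ[R] A := { g with commutes' := fun r => RingHom.congr_fun hfg r }
  let h := Algebra.FormallySmooth.liftOfSurjective (AlgHom.id R A) g' hg hk
  refine ⟨h.toRingHom, ?_, ?_⟩
  · ext x
    exact Algebra.FormallySmooth.liftOfSurjective_apply (AlgHom.id R A) g' hg hk x
  · ext x
    exact h.commutes x

open scoped IntermediateField.algebraAdjoinAdjoin in
theorem exists_derivation_of_isTranscendenceBasis {K : Type*} [Field K] [Algebra ℂ K]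
    {s : Set K} (hs : IsTranscendenceBasis ℂ ((↑) : s → K)) (v : s → K) :
    ∃ D : Derivation ℂ K K, ∀ i : s, D i = v i := by
  let A₀ := Algebra.adjoin ℂ (Set.range ((↑) : s → K))
  let F := IntermediateField.adjoin ℂ (Set.range ((↑) : s → K))
  have : Algebra.FormallySmooth A₀ F := .of_isLocalization (nonZeroDivisors _)
  have : Algebra.IsAlgebraic F K := by
    have := hs.isAlgebraic_field
    exact this
  have : Algebra.FormallyEtale F K := Algebra.FormallyEtale.of_isSeparable _ K
  have hsm : Algebra.FormallySmooth A₀ K := .comp _ F _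
  let ev : MvPolynomial s ℂ →ₐ[ℂ] TrivSqZeroExt K K :=
    aeval (fun i : s => TrivSqZeroExt.inl (i : K) + TrivSqZeroExt.inr (v i))
  let f : A₀ →ₐ[ℂ] TrivSqZeroExt K K := ev.comp hs.1.aevalEquiv.symm.toAlgHom
  let g : TrivSqZeroExt K K →ₐ[ℂ] K := TrivSqZeroExt.fstHom ℂ K K
  have hgev : g.comp ev = aeval ((↑) : s → K) := by
    ext i; simp [g, ev]
  have hfg : g.toRingHom.comp f.toRingHom = algebraMap A₀ K := by
    ext x
    obtain ⟨p, rfl⟩ := hs.1.aevalEquiv.surjective x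
    have h1 := DFunLike.congr_fun hgev p
    have : f (hs.1.aevalEquiv p) = ev p := by simp [f]
    change g (f _) = _
    rw [this]
    change g (ev p) = _ at h1
    rw [h1]
    simp
  obtain ⟨h, h1, h2⟩ := exists_section_of_formallySmooth f.toRingHom g.toRingHom
    (fun x => ⟨TrivSqZeroExt.inl x, by simp [g]⟩) (by
      refine ⟨2, ?_⟩
      rw [pow_two, Ideal.zero_eq_bot, eq_bot_iff, Ideal.mul_le]
      intro a ha b hb
      rw [RingHom.mem_ker] at ha hb
      change a.fst = 0 at ha
      change b.fst = 0 at hb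
      rw [Ideal.mem_bot]
      ext <;> simp [ha, hb]) hfg
  have hfst : ∀ x, (h x).fst = x := fun x => RingHom.congr_fun h1 x
  have hA : ∀ x : A₀, h x = f x := fun x => RingHom.congr_fun h2 x
  have hc : ∀ c : ℂ, h (algebraMap ℂ K c) = TrivSqZeroExt.inl (algebraMap ℂ K c) := by
    intro c
    have := hA (algebraMap ℂ A₀ c)
    rw [AlgHom.commutes] at this
    exact this
  refine ⟨Derivation.mk' (R := ℂ) ⟨⟨fun x => (h x).snd, by simp⟩, ?_⟩ ?_, ?_⟩
  · intro c x
    simp [Algebra.smul_def, hc]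
  · intro a b
    simp [hfst, mul_comm]
  · intro i
    have h3 := hA (hs.1.aevalEquiv (X i))
    have h4 : f (hs.1.aevalEquiv (X i)) = ev (X i) := by simp [f]
    have h5 : ((hs.1.aevalEquiv (X i) : A₀) : K) = i := by simp
    rw [h4, h5] at h3
    change (h (i : K)).snd = _
    rw [h3]
    simp [ev]

/-- Derivations of a field over `ℂ` take arbitrary values on algebraically independent
families. -/
theorem AlgebraicIndependent.exists_derivation {K ι : Type*} [Field K] [Algebra ℂ K]
    {z : ι → K} (hz : AlgebraicIndependent ℂ z) (v : ι → K) :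
    ∃ D : Derivation ℂ K K, ∀ i, D (z i) = v i := by
  obtain ⟨s, hs, hb⟩ := exists_isTranscendenceBasis_superset
    (s := Set.range z) (R := ℂ) (A := K) (by exact hz.coe_range)
  have hinj : Function.Injective z := hz.injective
  obtain ⟨D, hD⟩ := exists_derivation_of_isTranscendenceBasis hb
    (Function.extend (fun i => (⟨z i, hs ⟨i, rfl⟩⟩ : s)) v 0)
  refine ⟨D, fun i => ?_⟩
  have := hD ⟨z i, hs ⟨i, rfl⟩⟩
  rw [Function.Injective.extend_apply] at this
  · exact this
  · intro a b hab
    exact hinj (congrArg Subtype.val hab)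

theorem Derivation.map_aeval_mvPolynomial {K ι : Type*} [Field K] [Algebra ℂ K] [Fintype ι]
    (D : Derivation ℂ K K) (w : ι → K) (g : MvPolynomial ι ℂ) :
    D (aeval w g) = ∑ i, aeval w (pderiv i g) * D (w i) := by
  induction g using MvPolynomial.induction_on with
  | C a => simp
  | add p q hp hq => simp [hp, hq, add_mul, Finset.sum_add_distrib]
  | mul_X p i hp =>
    classical
    simp only [map_mul, aeval_X, Derivation.leibniz, hp, pderiv_X, smul_eq_mul, map_add, add_mul,
      Finset.sum_add_distrib]
    have h1 : ∑ x, aeval w p * aeval w (Pi.single (M := fun _ => MvPolynomial ι ℂ) x 1 i) * D (w x)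
        = aeval w p * D (w i) := by
      rw [Finset.sum_eq_single i (by
        intro b _ hb
        simp [hb.symm]) (by simp)]
      simp
    rw [h1, Finset.mul_sum]
    simp [mul_assoc]

/-- If derivations take arbitrary values on a finite family, then the family is algebraically
independent. -/
theorem algebraicIndependent_of_derivations {K ι : Type*} [Field K] [Algebra ℂ K] [Finite ι]
    (w : ι → K) (hw : ∀ v : ι → K, ∃ D : Derivation ℂ K K, ∀ i, D (w i) = v i) :
    AlgebraicIndependent ℂ w := by
  classical
  cases nonempty_fintype ι
  rw [algebraicIndependent_iff]
  have key : ∀ (n : ℕ) (g : MvPolynomial ι ℂ), g.totalDegree ≤ n → aeval w g = 0 → g = 0 := by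
    intro n
    induction n with
    | zero =>
      intro g hg h0
      rw [Nat.le_zero, totalDegree_eq_zero_iff_eq_C] at hg
      rw [hg] at h0 ⊢
      simpa using h0
    | succ n ih =>
      intro g hg h0
      have hp : ∀ i, pderiv i g = 0 := by
        intro i
        apply ih
        · by_cases h : g.totalDegree = 0
          · rw [totalDegree_eq_zero_iff_eq_C] at h
            rw [h]; simp
          refine Finset.sup_le fun α hα => ?_
          rw [mem_support_iff, coeff_pderiv] at hα
          have h2 := le_totalDegree (mem_support_iff.mpr (left_ne_zero_of_mul hα))
          rw [Finsupp.sum_add_index' (by simp) (by simp), Finsupp.sum_single_index (by simp)] at h2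
          omega
        · obtain ⟨D, hD⟩ := hw (Pi.single i 1)
          have := D.map_aeval_mvPolynomial w g
          rw [h0, map_zero, Finset.sum_eq_single i (by
            intro b _ hb
            simp [hD, hb]) (by simp), hD] at this
          simpa using this.symm
      have : g = C (coeff 0 g) := by
        ext α
        rw [coeff_C]
        split_ifs with h
        · rw [← h]
        · obtain ⟨i, hi⟩ : ∃ i, α i ≠ 0 := by
            by_contra hcon
            push Not at hcon
            exact h (by ext i; simp [hcon i])
          have h1 := congrArg (coeff (α - Finsupp.single i 1)) (hp i)
          rw [coeff_pderiv, coeff_zero] at h1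
          have h2 : α - Finsupp.single i 1 + Finsupp.single i 1 = α :=
            tsub_add_cancel_of_le (by
              rw [Finsupp.single_le_iff]; omega)
          rw [h2] at h1
          rcases mul_eq_zero.mp h1 with h1 | h1
          · exact h1
          · exfalso
            norm_cast at h1
      rw [this] at h0 ⊢
      simpa using h0
  exact fun g hg => key _ g le_rfl hg

/-- A polynomial system over an algebraically closed field that is solvable in an extension
field is solvable. -/
theorem exists_common_zero_of_extension {k K ι : Type*} [Field k] [IsAlgClosed k] [Field K]
    [Finite ι] (φ : k →+* K) (S : Set (MvPolynomial ι k)) (x : ι → K)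
    (hx : ∀ p ∈ S, eval₂ φ x p = 0) : ∃ y : ι → k, ∀ p ∈ S, eval y p = 0 := by
  let I : Ideal (MvPolynomial ι k) := RingHom.ker (eval₂Hom φ x)
  have hI : I ≠ ⊤ := RingHom.ker_ne_top _
  obtain ⟨M, hM, hIM⟩ := Ideal.exists_le_maximal I hI
  obtain ⟨y, hy⟩ := eq_vanishingIdeal_singleton_of_isMaximal k hM
  refine ⟨y, fun p hp => ?_⟩
  have : p ∈ M := hIM (by simpa [I, RingHom.mem_ker] using hx p hp)
  rw [hy, mem_vanishingIdeal_singleton_iff] at this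
  simpa [aeval_eq_eval] using this

/-- The coefficientwise extension of a derivation to polynomials. -/
def Derivation.coeffwise {K σ : Type*} [Field K] [Algebra ℂ K] (D : Derivation ℂ K K) :
    MvPolynomial σ K →+ MvPolynomial σ K where
  toFun f := AddMonoidAlgebra.map (D : K →+ K) f
  map_zero' := by ext; simp
  map_add' f g := by ext; simp

section
variable {K σ : Type*} [Field K] [Algebra ℂ K] (D : Derivation ℂ K K)

@[simp] theorem Derivation.coeff_coeffwise (f : MvPolynomial σ K) (α : σ →₀ ℕ) :
    coeff α (D.coeffwise f) = D (coeff α f) := by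
  simp [Derivation.coeffwise]

theorem Derivation.coeffwise_mul (f g : MvPolynomial σ K) :
    D.coeffwise (f * g) = f * D.coeffwise g + D.coeffwise f * g := by
  classical
  ext α
  simp only [Derivation.coeff_coeffwise, coeff_mul, coeff_add, map_sum, Derivation.leibniz,
    smul_eq_mul, ← Finset.sum_add_distrib]
  refine Finset.sum_congr rfl fun x _ => ?_
  ring

@[simp] theorem Derivation.coeffwise_C (a : K) :
    D.coeffwise (C a : MvPolynomial σ K) = C (D a) := by
  classical
  ext α
  simp only [Derivation.coeff_coeffwise, coeff_C]
  split_ifs <;> simp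

@[simp] theorem Derivation.coeffwise_X (i : σ) :
    D.coeffwise (X i : MvPolynomial σ K) = 0 := by
  classical
  ext α
  simp only [Derivation.coeff_coeffwise, coeff_X, coeff_zero]
  split_ifs <;> simp

theorem Derivation.coeffwise_smul (a : K) (f : MvPolynomial σ K) :
    D.coeffwise (a • f) = a • D.coeffwise f + D a • f := by
  simp only [smul_eq_C_mul, Derivation.coeffwise_mul, Derivation.coeffwise_C]

theorem Derivation.coeffwise_prod {ι : Type*} [DecidableEq ι] (s : Finset ι)
    (f : ι → MvPolynomial σ K) :
    D.coeffwise (∏ i ∈ s, f i) = ∑ i ∈ s, D.coeffwise (f i) * ∏ j ∈ s.erase i, f j := by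
  induction s using Finset.induction_on with
  | empty =>
    have : (1 : MvPolynomial σ K) = C 1 := by simp
    simp only [Finset.prod_empty, Finset.sum_empty]
    rw [this, Derivation.coeffwise_C]
    simp
  | insert a s ha ih =>
    rw [Finset.prod_insert ha, Derivation.coeffwise_mul, ih, Finset.sum_insert ha,
      Finset.erase_insert ha, add_comm, Finset.mul_sum]
    congr 1
    refine Finset.sum_congr rfl fun i hi => ?_
    have : i ≠ a := fun h => ha (h ▸ hi)
    rw [Finset.erase_insert_of_ne this.symm, Finset.prod_insert (by simp [ha])]
    ring
end

/-! ### Symmetric families of subspaces -/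

section SymmetricFamily
variable {Ω P ι : Type*} [Field Ω] [AddCommGroup P] [Module Ω P] [DecidableEq ι]

theorem finrank_inf_sup_family (T : ι → Submodule Ω P) [∀ i, FiniteDimensional Ω (T i)] {N : ℕ}
    (hN : ∀ i, Module.finrank Ω (T i) = N) (y : ι) (S : Finset ι) :
    Module.finrank Ω ↥((insert y S).sup T) + Module.finrank Ω ↥(T y ⊓ S.sup T) =
      N + Module.finrank Ω ↥(S.sup T) := by
  rw [Finset.sup_insert, Submodule.finrank_sup_add_finrank_inf_eq, hN]

/-- If the intersections `T y ⊓ ⨆ S` do not grow when passing from `k` to `k + 1` summands,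
they lie in all the sums of `k` members. -/
theorem inf_sup_le_sup_of_finrank_eq (T : ι → Submodule Ω P) [∀ i, FiniteDimensional Ω (T i)]
    {k a : ℕ} (y : ι)
    (h₀ : ∀ S : Finset ι, S.card = k → y ∉ S → Module.finrank Ω ↥(T y ⊓ S.sup T) = a)
    (h₁ : ∀ S : Finset ι, S.card = k + 1 → y ∉ S → Module.finrank Ω ↥(T y ⊓ S.sup T) = a)
    (S' : Finset ι) (hS' : S'.card = k) :
    ∀ (n : ℕ) (S : Finset ι), S.card = k → y ∉ S → (S' \ S).card = n →
      T y ⊓ S.sup T ≤ S'.sup T := by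
  by_cases hy : y ∈ S'
  · intro _ S _ _ _
    exact inf_le_left.trans (Finset.le_sup hy)
  intro n
  induction n with
  | zero =>
    intro S hS _ h
    rw [Finset.card_eq_zero, Finset.sdiff_eq_empty_iff_subset] at h
    rw [Finset.eq_of_subset_of_card_le h (by omega)]
    exact inf_le_right
  | succ n ih =>
    intro S hS hyS h
    obtain ⟨a, ha⟩ : (S' \ S).Nonempty := by rw [← Finset.card_pos]; omega
    rw [Finset.mem_sdiff] at ha
    obtain ⟨b, hb⟩ : (S \ S').Nonempty := by
      rw [← Finset.card_pos]
      have h1 := Finset.card_sdiff_add_card_inter S S'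
      have h2 := Finset.card_sdiff_add_card_inter S' S
      rw [Finset.inter_comm] at h2
      omega
    rw [Finset.mem_sdiff] at hb
    have hya : y ≠ a := fun h => hy (h ▸ ha.1)
    have hle : ∀ S₁ : Finset ι, S₁.card = k → y ∉ S₁ → S₁ ⊆ insert a S →
        T y ⊓ S₁.sup T = T y ⊓ (insert a S).sup T := by
      intro S₁ hc hy₁ hsub
      apply Submodule.eq_of_le_of_finrank_eq
      · exact inf_le_inf_left _ (Finset.sup_mono hsub)
      · rw [h₀ S₁ hc hy₁, h₁ _ (by rw [Finset.card_insert_of_notMem ha.2, hS])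
          (by simp [hya, hyS])]
    have hc1 : (insert a (S.erase b)).card = k := by
      rw [Finset.card_insert_of_notMem (by simp [ha.2]), Finset.card_erase_of_mem hb.1]
      have := Finset.card_pos.mpr ⟨b, hb.1⟩
      omega
    have hy1 : y ∉ insert a (S.erase b) := by simp [hya, hyS]
    rw [hle S hS hyS (Finset.subset_insert _ _),
      ← hle _ hc1 hy1 (Finset.insert_subset_insert _ (Finset.erase_subset _ _))]
    refine ih _ hc1 hy1 ?_
    have : S' \ insert a (S.erase b) = (S' \ S).erase a := by
      ext x
      simp only [Finset.mem_sdiff, Finset.mem_insert, Finset.mem_erase, not_or, not_and, ne_eq]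
      constructor
      · rintro ⟨h1, h2, h3⟩
        refine ⟨h2, h1, fun hx => ?_⟩
        by_cases hxb : x = b
        · exact hb.2 (hxb ▸ h1)
        · exact h3 hxb hx
      · rintro ⟨h1, h2, h3⟩
        exact ⟨h2, h1, fun _ => h3⟩
    rw [this, Finset.card_erase_of_mem (by simp [ha]), h]
    rfl

variable [Infinite ι]

theorem two_mul_finrank_le_of_inf_ne_bot (T : ι → Submodule Ω P)
    [∀ i, FiniteDimensional Ω (T i)] (V : Submodule Ω P) {N : ℕ}
    (hN : ∀ i, Module.finrank Ω (T i) = N)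
    (hsym : ∀ S S' : Finset ι, S.card = S'.card →
      Module.finrank Ω ↥(S.sup T) = Module.finrank Ω ↥(S'.sup T))
    (hirr : ∀ k : ℕ, (⨅ S : {S : Finset ι // S.card = k}, (S : Finset ι).sup T) = ⊥ ∨
      V ≤ ⨅ S : {S : Finset ι // S.card = k}, (S : Finset ι).sup T) :
    ∀ (t : ℕ) (S : Finset ι) (y : ι), y ∉ S → 1 ≤ Module.finrank Ω ↥(T y ⊓ S.sup T) →
      N ≤ Module.finrank Ω ↥(T y ⊓ S.sup T) + t →
      2 * Module.finrank Ω V ≤ 2 * Module.finrank Ω ↥(S.sup T) + t * (t + 1) := by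
  have hsym' : ∀ (S S' : Finset ι) (y y' : ι), S.card = S'.card → y ∉ S → y' ∉ S' →
      Module.finrank Ω ↥(T y ⊓ S.sup T) = Module.finrank Ω ↥(T y' ⊓ S'.sup T) := by
    intro S S' y y' h hy hy'
    have h1 := finrank_inf_sup_family T hN y S
    have h2 := finrank_inf_sup_family T hN y' S'
    have h3 := hsym S S' h
    have h4 := hsym (insert y S) (insert y' S') (by
      rw [Finset.card_insert_of_notMem hy, Finset.card_insert_of_notMem hy', h])
    omega
  have hstep : ∀ (S : Finset ι) (y y' : ι), y ∉ insert y' S → y' ∉ S →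
      1 ≤ Module.finrank Ω ↥(T y ⊓ S.sup T) → ¬ V ≤ S.sup T →
      Module.finrank Ω ↥(T y ⊓ S.sup T) < Module.finrank Ω ↥(T y ⊓ (insert y' S).sup T) := by
    intro S y y' hy hy' h1 hV
    have hyS : y ∉ S := fun h => hy (Finset.mem_insert_of_mem h)
    have hle : T y ⊓ S.sup T ≤ T y ⊓ (insert y' S).sup T :=
      inf_le_inf_left _ (Finset.sup_mono (Finset.subset_insert _ _))
    refine lt_of_le_of_ne (Submodule.finrank_mono hle) fun heq => ?_
    have hall : T y ⊓ S.sup T ≤ ⨅ S' : {S' : Finset ι // S'.card = S.card},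
        (S' : Finset ι).sup T := by
      refine le_iInf fun S' => ?_
      refine inf_sup_le_sup_of_finrank_eq T (k := S.card) (a := Module.finrank Ω ↥(T y ⊓ S.sup T))
        y (fun S₁ h h' => hsym' _ _ _ _ h h' hyS) (fun S₁ h h' => ?_) S' S'.2 _ S rfl hyS rfl
      rw [heq]
      refine hsym' _ _ _ _ ?_ h' hy
      rw [h, Finset.card_insert_of_notMem hy']
    rcases hirr S.card with h | h
    · rw [h, le_bot_iff] at hall
      rw [hall, finrank_bot] at h1
      omega
    · exact hV (h.trans (iInf_le _ (⟨S, rfl⟩ : {S' : Finset ι // S'.card = S.card})))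
  intro t
  induction t with
  | zero =>
    intro S y hy h1 h2
    by_cases hV : V ≤ S.sup T
    · have := Submodule.finrank_mono hV
      omega
    exfalso
    obtain ⟨y', hy'⟩ := Infinite.exists_notMem_finset (insert y S)
    rw [Finset.mem_insert, not_or] at hy'
    have h3 := hstep S y y' (by simp [hy, Ne.symm hy'.1]) hy'.2 h1 hV
    have h4 : Module.finrank Ω ↥(T y ⊓ (insert y' S).sup T) ≤ Module.finrank Ω (T y) :=
      Submodule.finrank_mono inf_le_left
    rw [hN] at h4
    omega
  | succ t ih =>
    intro S y hy h1 h2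
    by_cases hV : V ≤ S.sup T
    · have := Submodule.finrank_mono hV
      nlinarith
    obtain ⟨y', hy'⟩ := Infinite.exists_notMem_finset (insert y S)
    rw [Finset.mem_insert, not_or] at hy'
    have hyn : y ∉ insert y' S := by simp [hy, Ne.symm hy'.1]
    have h3 := hstep S y y' hyn hy'.2 h1 hV
    have h4 := ih (insert y' S) y hyn (by omega) (by omega)
    have h5 := finrank_inf_sup_family T hN y' S
    have h6 := hsym' S S y' y rfl hy'.2 hy
    nlinarith

/-- A sufficiently small sum of members of a symmetric irreducible family is direct. -/
theorem finrank_sup_eq_of_irreducible (T : ι → Submodule Ω P)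
    [∀ i, FiniteDimensional Ω (T i)] (V : Submodule Ω P) {N : ℕ}
    (hN : ∀ i, Module.finrank Ω (T i) = N) (hN0 : 1 ≤ N)
    (hsym : ∀ S S' : Finset ι, S.card = S'.card →
      Module.finrank Ω ↥(S.sup T) = Module.finrank Ω ↥(S'.sup T))
    (hirr : ∀ k : ℕ, (⨅ S : {S : Finset ι // S.card = k}, (S : Finset ι).sup T) = ⊥ ∨
      V ≤ ⨅ S : {S : Finset ι // S.card = k}, (S : Finset ι).sup T)
    (S : Finset ι) (hS : 2 * N * S.card + N * N < 2 * Module.finrank Ω V + 3 * N) :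
    Module.finrank Ω ↥(S.sup T) = N * S.card := by
  induction S using Finset.induction_on with
  | empty => simp
  | insert y S hy ih =>
    rw [Finset.card_insert_of_notMem hy] at hS ⊢
    have h0 := ih (by nlinarith)
    have h1 := finrank_inf_sup_family T hN y S
    by_cases ha : Module.finrank Ω ↥(T y ⊓ S.sup T) = 0
    · rw [ha, h0] at h1
      rw [mul_add]; omega
    · exfalso
      obtain ⟨t, rfl⟩ : ∃ t, N = t + 1 := ⟨N - 1, by omega⟩
      have := two_mul_finrank_le_of_inf_ne_bot T V hN hsym hirr t S y hy (by omega) (by omega)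
      rw [h0] at this
      nlinarith

end SymmetricFamily

theorem sup_inf_sup_eq_of_finrank {Ω P ι : Type*} [Field Ω] [AddCommGroup P] [Module Ω P]
    [DecidableEq ι] (T : ι → Submodule Ω P) [∀ i, FiniteDimensional Ω (T i)] {N : ℕ}
    (S S' : Finset ι) (h : ∀ R ⊆ S ∪ S', Module.finrank Ω ↥(R.sup T) = N * R.card) :
    S.sup T ⊓ S'.sup T = (S ∩ S').sup T := by
  symm
  apply Submodule.eq_of_le_of_finrank_eq
  · exact le_inf (Finset.sup_mono Finset.inter_subset_left) (Finset.sup_mono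
      Finset.inter_subset_right)
  · have h1 := Submodule.finrank_sup_add_finrank_inf_eq (S.sup T) (S'.sup T)
    rw [← Finset.sup_union, h _ subset_rfl, h S Finset.subset_union_left,
      h S' Finset.subset_union_right] at h1
    rw [h _ (Finset.inter_subset_left.trans Finset.subset_union_left)]
    have h2 := Finset.card_union_add_card_inter S S'
    have h3 : N * (S ∪ S').card + N * (S ∩ S').card = N * S.card + N * S'.card := by
      rw [← mul_add, h2, mul_add]
    omega

theorem exists_perm_map_eq_of_card_eq {ι : Type*} [DecidableEq ι] (S : Finset ι) :
    ∀ S' : Finset ι, S.card = S'.card → ∃ σ : Equiv.Perm ι, S.map σ.toEmbedding = S' := by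
  induction S using Finset.induction_on with
  | empty =>
    intro S' h
    exact ⟨1, by rw [Finset.card_empty] at h; rw [Finset.card_eq_zero.mp h.symm]; rfl⟩
  | insert a S ha ih =>
    intro S' h
    rw [Finset.card_insert_of_notMem ha] at h
    obtain ⟨b, hb⟩ := Finset.card_pos.mp (by omega : 0 < S'.card)
    obtain ⟨σ, hσ⟩ := ih (S'.erase b) (by rw [Finset.card_erase_of_mem hb]; omega)
    refine ⟨σ.trans (Equiv.swap (σ a) b), ?_⟩
    have h1 : ∀ x ∈ S, Equiv.swap (σ a) b (σ x) = σ x := by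
      intro x hx
      have hx' : σ x ∈ S'.erase b := hσ ▸ Finset.mem_map_of_mem σ.toEmbedding hx
      refine Equiv.swap_apply_of_ne_of_ne ?_ (Finset.ne_of_mem_erase hx')
      intro h2
      exact ha (σ.injective h2 ▸ hx)
    have h2 : S.map (σ.trans (Equiv.swap (σ a) b)).toEmbedding = S'.erase b := by
      rw [← hσ]
      ext y
      simp only [Finset.mem_map, Equiv.coe_toEmbedding, Equiv.trans_apply]
      constructor
      · rintro ⟨x, hx, rfl⟩
        exact ⟨x, hx, (h1 x hx).symm⟩
      · rintro ⟨x, hx, rfl⟩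
        exact ⟨x, hx, h1 x hx⟩
    rw [Finset.map_insert, h2]
    simp [Finset.insert_erase hb]

theorem Finset.insert_union_insert_eq {ι : Type*} [DecidableEq ι] (y z : ι) (S : Finset ι) :
    insert y S ∪ insert z S = insert z (insert y S) := by
  ext x
  simp only [Finset.mem_union, Finset.mem_insert]
  tauto

theorem Finset.insert_inter_insert_eq {ι : Type*} [DecidableEq ι] {y z : ι} {S : Finset ι}
    (hy : y ∉ S) (hz : z ∉ S) (hyz : y ≠ z) : insert y S ∩ insert z S = S := by
  rw [Finset.insert_inter_of_notMem (by simp [hy, hyz]),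
    Finset.inter_eq_left.mpr (Finset.subset_insert _ _)]

/-- The vectors `v` such that all `II v u` lie in `W`. -/
def bilinKer {Ω E P : Type*} [Field Ω] [AddCommGroup E] [Module Ω E] [AddCommGroup P] [Module Ω P]
    (II : E →ₗ[Ω] E →ₗ[Ω] P) (W : Submodule Ω P) : Submodule Ω E where
  carrier := {v | ∀ u, II v u ∈ W}
  add_mem' ha hb u := by
    rw [map_add]
    exact W.add_mem (ha u) (hb u)
  zero_mem' u := by simp
  smul_mem' c v hv u := by
    rw [map_smul]
    exact W.smul_mem c (hv u)

section BilinKer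
variable {Ω E P ι : Type*} [Field Ω] [AddCommGroup E] [Module Ω E] [FiniteDimensional Ω E]
  [AddCommGroup P] [Module Ω P] [DecidableEq ι] [Infinite ι]

set_option maxHeartbeats 1000000 in
/-- Either no direction is annihilated by the second fundamental form modulo a small sum, or
there is a large isotropic subspace. -/
theorem bilinKer_eq_bot_or_exists_isotropic (II : E →ₗ[Ω] E →ₗ[Ω] P)
    (hII : ∀ u v, II u v = II v u) (W : Finset ι → Submodule Ω P)
    (k : ℕ)
    (hW : ∀ S S' : Finset ι, (S ∪ S').card ≤ k → W S ⊓ W S' = W (S ∩ S'))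
    (hWm : Monotone W)
    (Φ : Equiv.Perm ι → Submodule Ω E ≃o Submodule Ω E)
    (hΦ : ∀ σ S, Φ σ (bilinKer II (W S)) = bilinKer II (W (S.map σ.toEmbedding)))
    (hΦ' : ∀ σ A, Module.finrank Ω ↥(Φ σ A) = Module.finrank Ω A)
    (h₀ : bilinKer II (W ∅) = ⊥) (m c : ℕ) (hk : m + c ≤ k + 1) (hc : 1 ≤ c)
    (hE : Module.finrank Ω E < 2 * c + 1) :
    (∀ S : Finset ι, S.card + 1 ≤ m → bilinKer II (W S) = ⊥) ∨
    ∃ H : Submodule Ω E, c < Module.finrank Ω H ∧ ∀ u ∈ H, ∀ v ∈ H, II u v ∈ W ∅ := by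
  set B : Finset ι → Submodule Ω E := fun S => bilinKer II (W S) with hB
  have hBm : Monotone B := fun S S' h v hv u => hWm h (hv u)
  have hBi : ∀ S S' : Finset ι, (S ∪ S').card ≤ k → B S ⊓ B S' = B (S ∩ S') := by
    intro S S' h
    ext v
    rw [Submodule.mem_inf]
    constructor
    · rintro ⟨h1, h2⟩ u
      rw [← hW S S' h]
      exact ⟨h1 u, h2 u⟩
    · intro h1
      exact ⟨hBm Finset.inter_subset_left h1, hBm Finset.inter_subset_right h1⟩
  have hIIB : ∀ S S' : Finset ι, (S ∪ S').card ≤ k → ∀ v ∈ B S, ∀ v' ∈ B S',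
      II v v' ∈ W (S ∩ S') := by
    intro S S' h v hv v' hv'
    rw [← hW S S' h]
    exact ⟨hv v', by rw [hII]; exact hv' v⟩
  have hcard : ∀ S S' : Finset ι, S.card = S'.card →
      Module.finrank Ω (B S) = Module.finrank Ω (B S') := by
    intro S S' h
    obtain ⟨σ, hσ⟩ : ∃ σ : Equiv.Perm ι, S.map σ.toEmbedding = S' := by
      exact exists_perm_map_eq_of_card_eq S S' h
    rw [← hσ, ← hΦ', hΦ]
  by_contra hcon
  push Not at hcon
  obtain ⟨⟨S₁, hS₁, hS₁'⟩, hH⟩ := hcon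
  -- the minimal size with nonzero kernel
  have hex : ∃ r, ∃ S : Finset ι, S.card = r ∧ B S ≠ ⊥ := ⟨_, S₁, rfl, hS₁'⟩
  obtain ⟨r, ⟨S₂, hS₂, hS₂'⟩, hmin⟩ : ∃ r, (∃ S : Finset ι, S.card = r ∧ B S ≠ ⊥) ∧
      ∀ r' < r, ∀ S : Finset ι, S.card = r' → B S = ⊥ := by
    classical
    refine ⟨Nat.find hex, Nat.find_spec hex, fun r' hr' S hS => ?_⟩
    by_contra h
    exact Nat.find_min hex hr' ⟨S, hS, h⟩
  have hrm : r + 1 ≤ m := by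
    by_contra h
    exact hS₁' (hmin _ (by omega) S₁ rfl)
  have hr0 : r ≠ 0 := by
    rintro rfl
    rw [Finset.card_eq_zero] at hS₂
    exact hS₂' (hS₂ ▸ h₀)
  obtain ⟨q, rfl⟩ : ∃ q, r = q + 1 := ⟨r - 1, by omega⟩
  -- dimension as a convex function of the size
  have hset : ∀ j, ∃ S : Finset ι, S.card = j := fun j => Infinite.exists_subset_card_eq ι j
  obtain ⟨b, hb⟩ : ∃ b : ℕ → ℕ, ∀ S : Finset ι, Module.finrank Ω (B S) = b S.card := by
    choose f hf using hset
    exact ⟨fun j => Module.finrank Ω (B (f j)), fun S => hcard _ _ (hf _).symm⟩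
  have hconv : ∀ j, j + 2 ≤ k → 2 * b (j + 1) ≤ b (j + 2) + b j := by
    intro j hj
    obtain ⟨S, hS⟩ := hset j
    obtain ⟨y, hy⟩ := Infinite.exists_notMem_finset S
    obtain ⟨z, hz⟩ := Infinite.exists_notMem_finset (insert y S)
    have hzS : z ∉ S := fun h => hz (Finset.mem_insert_of_mem h)
    have hzy : y ≠ z := fun h => hz (h ▸ Finset.mem_insert_self _ _)
    have h1 := Submodule.finrank_sup_add_finrank_inf_eq (B (insert y S)) (B (insert z S))
    have hc2 : (insert z (insert y S)).card = j + 2 := by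
      rw [Finset.card_insert_of_notMem hz, Finset.card_insert_of_notMem hy, hS]
    have hun : insert y S ∪ insert z S = insert z (insert y S) :=
          Finset.insert_union_insert_eq _ _ _
    have hin : insert y S ∩ insert z S = S :=
          Finset.insert_inter_insert_eq hy hzS hzy
    rw [hBi _ _ (by rw [hun, hc2]; exact hj), hin, hb, hb, hb, hS,
      Finset.card_insert_of_notMem hy, Finset.card_insert_of_notMem hzS, hS] at h1
    have h2 : Module.finrank Ω ↥(B (insert y S) ⊔ B (insert z S)) ≤ b (j + 2) := by
      rw [← hc2, ← hb]
      exact Submodule.finrank_mono (sup_le (hBm (Finset.subset_insert _ _))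
        (hBm (Finset.insert_subset_insert _ (Finset.subset_insert _ _))))
    omega
  have hgrow : ∀ p δ, b p + δ ≤ b (p + 1) → ∀ i, p + i + 1 ≤ k →
      b (p + i) + δ ≤ b (p + i + 1) ∧ b p + (i + 1) * δ ≤ b (p + i + 1) := by
    intro p δ h0 i
    induction i with
    | zero => intro _; simpa using h0
    | succ i ih =>
      intro hi
      have h1 := ih (by omega)
      have h2 := hconv (p + i) (by omega)
      have h3 : b (p + (i + 1)) + δ ≤ b (p + (i + 1) + 1) := by
        rw [← add_assoc]
        change b (p + i + 1) + δ ≤ b (p + i + 2)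
        omega
      refine ⟨h3, ?_⟩
      have e1 : p + (i + 1) = p + i + 1 := by ring
      rw [e1] at h3 ⊢
      nlinarith
  have hbE : ∀ j, b j ≤ Module.finrank Ω E := by
    intro j
    obtain ⟨S, hS⟩ := hset j
    rw [← hS, ← hb]
    exact Submodule.finrank_le _
  have hbq : b q = 0 := by
    obtain ⟨S, hS⟩ := hset q
    rw [← hS, ← hb, hmin q (by omega) S hS, finrank_bot]
  have hb1 : 1 ≤ b (q + 1) := by
    rw [← hS₂, ← hb]
    rw [Nat.one_le_iff_ne_zero]
    intro h
    exact hS₂' (Submodule.finrank_eq_zero.mp h)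
  have hb1' : b (q + 1) = 1 := by
    by_contra hne
    have h1 := (hgrow q 2 (by omega) (k - q - 1) (by omega)).2
    have h2 := hbE (q + (k - q - 1) + 1)
    have : c + 1 ≤ k - q - 1 + 1 := by omega
    nlinarith
  have hb2 : b (q + 2) = 2 := by
    have h0 := hconv q (by omega)
    by_contra hne
    have h1 := (hgrow (q + 1) 2 (by rw [hb1']; change 3 ≤ b (q + 2); omega) (k - q - 2)
      (by omega)).2
    have h2 := hbE (q + 1 + (k - q - 2) + 1)
    have : c ≤ k - q - 2 + 1 := by omega
    nlinarith
  -- the isotropic subspace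
  let H : Finset ι → Submodule Ω E := fun S' => ⨆ y : {y // y ∉ S'}, B (insert (y : ι) S')
  have hpair : ∀ (S : Finset ι) (z y : ι), S.card = q → z ∉ S → y ∉ S → y ≠ z →
      B (insert y (insert z S)) = B (insert z S) ⊔ B (insert y S) := by
    intro S z y hS hz hy hyz
    have hc1 : (insert y (insert z S)).card = q + 2 := by
      rw [Finset.card_insert_of_notMem (by simp [hyz, hy]), Finset.card_insert_of_notMem hz, hS]
    symm
    apply Submodule.eq_of_le_of_finrank_eq
    · exact sup_le (hBm (Finset.subset_insert _ _))
        (hBm (Finset.insert_subset_insert _ (Finset.subset_insert _ _)))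
    · have h1 := Submodule.finrank_sup_add_finrank_inf_eq (B (insert z S)) (B (insert y S))
      have hun : insert z S ∪ insert y S = insert y (insert z S) :=
          Finset.insert_union_insert_eq _ _ _
      have hin : insert z S ∩ insert y S = S :=
          Finset.insert_inter_insert_eq hz hy hyz.symm
      rw [hBi _ _ (by rw [hun, hc1]; omega), hin, hb, hb, hb, hS,
        Finset.card_insert_of_notMem hy, Finset.card_insert_of_notMem hz, hS, hbq, hb1'] at h1
      rw [hb, hc1, hb2]
      omega
  have hHle : ∀ (S : Finset ι) (y : ι), y ∉ S → B (insert y S) ≤ H S := fun S y hy =>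
    le_iSup (fun y : {y // y ∉ S} => B (insert (y : ι) S)) ⟨y, hy⟩
  have hexch : ∀ (S₀ : Finset ι) (z z' : ι), S₀.card + 1 = q → z ∉ S₀ → z' ∉ S₀ →
      H (insert z S₀) ≤ H (insert z' S₀) := by
    intro S₀ z z' hS₀ hz hz'
    by_cases hzz : z = z'
    · rw [hzz]
    refine iSup_le fun y => ?_
    obtain ⟨y, hy⟩ := y
    simp only [Finset.mem_insert, not_or] at hy
    by_cases hyz' : y = z'
    · subst hyz'
      rw [Finset.insert_comm]
      exact hHle _ _ (by simp [hzz, hz])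
    · have hzn : z ∉ insert z' S₀ := by simp [hzz, hz]
      have hyn : y ∉ insert z' S₀ := by simp [hyz', hy.2]
      have h1 : B (insert y (insert z S₀)) ≤ B (insert y (insert z (insert z' S₀))) :=
        hBm (Finset.insert_subset_insert _ (Finset.insert_subset_insert _
          (Finset.subset_insert _ _)))
      refine h1.trans ?_
      rw [hpair (insert z' S₀) z y (by rw [Finset.card_insert_of_notMem hz', hS₀]) hzn hyn hy.1]
      exact sup_le (hHle _ _ hzn) (hHle _ _ hyn)
  have hHconst : ∀ (n : ℕ) (S S' : Finset ι), S.card = q → S'.card = q → (S' \ S).card = n →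
      H S ≤ H S' := by
    intro n
    induction n with
    | zero =>
      intro S S' hS hS' h
      rw [Finset.card_eq_zero, Finset.sdiff_eq_empty_iff_subset] at h
      rw [Finset.eq_of_subset_of_card_le h (by omega)]
    | succ n ih =>
      intro S S' hS hS' h
      obtain ⟨a, ha⟩ : (S' \ S).Nonempty := by rw [← Finset.card_pos]; omega
      rw [Finset.mem_sdiff] at ha
      obtain ⟨x, hx⟩ : (S \ S').Nonempty := by
        rw [← Finset.card_pos]
        have h1 := Finset.card_sdiff_add_card_inter S S'
        have h2 := Finset.card_sdiff_add_card_inter S' S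
        rw [Finset.inter_comm] at h2
        omega
      rw [Finset.mem_sdiff] at hx
      have hpos := Finset.card_pos.mpr ⟨x, hx.1⟩
      have h1 := hexch (S.erase x) x a (by rw [Finset.card_erase_of_mem hx.1]; omega)
        (by simp) (by simp [ha.2])
      rw [Finset.insert_erase hx.1] at h1
      refine h1.trans (ih _ _ ?_ hS' ?_)
      · rw [Finset.card_insert_of_notMem (by simp [ha.2]), Finset.card_erase_of_mem hx.1]
        omega
      · have : S' \ insert a (S.erase x) = (S' \ S).erase a := by
          ext w
          simp only [Finset.mem_sdiff, Finset.mem_insert, Finset.mem_erase, not_or, not_and, ne_eq]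
          constructor
          · rintro ⟨h1, h2, h3⟩
            refine ⟨h2, h1, fun hw => ?_⟩
            by_cases hxb : w = x
            · exact hx.2 (hxb ▸ h1)
            · exact h3 hxb hw
          · rintro ⟨h1, h2, h3⟩
            exact ⟨h2, h1, fun _ => h3⟩
        rw [this, Finset.card_erase_of_mem (by simp [ha]), h]
        rfl
  have hskip : ∀ (S : Finset ι) (y : ι), S.card = q → y ∉ S →
      H S ≤ ⨆ w : {w // w ∉ insert y S}, B (insert (w : ι) S) := by
    intro S y hS hy
    obtain ⟨F, hF⟩ : ∃ F : Finset {y // y ∉ S}, H S = ⨆ w ∈ F, B (insert (w : ι) S) := by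
      have hfg : (H S).FG := IsNoetherian.noetherian _
      exact (CompleteLattice.IsCompactElement.exists_finset_of_le_iSup _
        ((Submodule.fg_iff_compact _).mp hfg) _ le_rfl) |>.imp
        fun F hF => le_antisymm hF (iSup₂_le fun w _ => hHle _ _ w.2)
    obtain ⟨y₁, hy₁⟩ := Infinite.exists_notMem_finset (insert y (S ∪ F.image Subtype.val))
    simp only [Finset.mem_insert, Finset.mem_union, not_or, Finset.mem_image, Subtype.exists,
      exists_and_right, exists_eq_right, not_exists] at hy₁
    let σ : Equiv.Perm ι := Equiv.swap y y₁
    have hσS : S.map σ.toEmbedding = S := by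
      ext x
      simp only [Finset.mem_map_equiv, σ, Equiv.symm_swap]
      by_cases hx : x = y
      · subst hx; simp [hy, hy₁.2.1]
      by_cases hx1 : x = y₁
      · subst hx1; simp [hy, hy₁.2.1]
      rw [Equiv.swap_apply_of_ne_of_ne hx hx1]
    have hσi : ∀ w, (insert w S).map σ.toEmbedding = insert (σ w) S := by
      intro w
      rw [Finset.map_insert, hσS]; rfl
    have hσn : ∀ w, w ∉ S → σ w ∉ S := by
      intro w hw h
      rw [← hσS, Finset.mem_map] at h
      obtain ⟨x, hx, hx'⟩ := h
      exact hw (σ.injective hx' ▸ hx)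
    have hσH : H S ≤ Φ σ (H S) := by
      refine iSup_le fun w => ?_
      have h1 : B (insert (σ w) S) ≤ H S := hHle _ _ (hσn _ w.2)
      have h2 := (Φ σ).monotone h1
      rw [hΦ, hσi] at h2
      simpa [σ, hB] using h2
    refine hσH.trans ?_
    rw [hF]
    simp only [OrderIso.map_iSup]
    refine iSup₂_le fun w hw => ?_
    rw [hΦ, hσi]
    refine le_iSup_of_le ⟨σ w, ?_⟩ le_rfl
    rw [Finset.mem_insert, not_or]
    refine ⟨?_, hσn _ w.2⟩
    intro h
    have : (w : ι) = y₁ := by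
      apply σ.injective; rw [h]; simp [σ]
    exact hy₁.2.2 (this ▸ w.2) (by simpa [← this] using hw)
  have hiso : ∀ S : Finset ι, S.card = q → ∀ u ∈ H S, ∀ v ∈ H S, II u v ∈ W S := by
    intro S hS u hu v hv
    have h1 : ∀ y : {y // y ∉ S}, ∀ u ∈ B (insert (y : ι) S), II u v ∈ W S := by
      rintro ⟨y, hy⟩ u hu
      have hv' := hskip S y hS hy hv
      have h2 : (⨆ w : {w // w ∉ insert y S}, B (insert (w : ι) S)) ≤ (W S).comap (II u) := by
        refine iSup_le fun w v hv => ?_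
        obtain ⟨w, hw⟩ := w
        simp only [Finset.mem_insert, not_or] at hw
        have hun : insert y S ∪ insert w S = insert w (insert y S) :=
          Finset.insert_union_insert_eq _ _ _
        have hin : insert y S ∩ insert w S = S :=
          Finset.insert_inter_insert_eq hy hw.2 (Ne.symm hw.1)
        have h3 := hIIB (insert y S) (insert w S) (by
          rw [hun, Finset.card_insert_of_notMem (by simp [hw]), Finset.card_insert_of_notMem hy]
          omega) u hu v hv
        rwa [hin] at h3
      exact h2 hv'
    have h2 : H S ≤ (W S).comap (II.flip v) := iSup_le fun y u hu => h1 y u hu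
    exact h2 hu
  obtain ⟨S₀, hS₀⟩ := hset q
  have hall : ∀ u ∈ H S₀, ∀ v ∈ H S₀, ∀ j ≤ q, ∀ S : Finset ι, S.card + j = q → II u v ∈ W S := by
    intro u hu v hv j
    induction j with
    | zero =>
      intro _ S hS
      exact hiso S hS u (hHconst _ _ _ hS₀ hS rfl hu) v (hHconst _ _ _ hS₀ hS rfl hv)
    | succ j ih =>
      intro hj S hS
      obtain ⟨y, hy⟩ := Infinite.exists_notMem_finset S
      obtain ⟨z, hz⟩ := Infinite.exists_notMem_finset (insert y S)
      have hzS : z ∉ S := fun h => hz (Finset.mem_insert_of_mem h)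
      have hzy : y ≠ z := fun h => hz (h ▸ Finset.mem_insert_self _ _)
      have hun : insert y S ∪ insert z S = insert z (insert y S) :=
          Finset.insert_union_insert_eq _ _ _
      have hin : insert y S ∩ insert z S = S :=
          Finset.insert_inter_insert_eq hy hzS hzy
      rw [← hin, ← hW]
      · exact ⟨ih (by omega) _ (by rw [Finset.card_insert_of_notMem hy]; omega),
          ih (by omega) _ (by rw [Finset.card_insert_of_notMem hzS]; omega)⟩
      · rw [hun, Finset.card_insert_of_notMem hz, Finset.card_insert_of_notMem hy]
        omega
  refine absurd (hH (H S₀) ?_) ?_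
  · have key : ∀ t, q + t ≤ k → ∃ R : Finset ι, Disjoint R S₀ ∧ R.card = t ∧
        t ≤ Module.finrank Ω ↥(R.sup fun y => B (insert y S₀)) := by
      intro t
      induction t with
      | zero => intro _; exact ⟨∅, by simp, rfl, by simp⟩
      | succ t ih =>
        intro ht
        obtain ⟨R, hR, hRt, hRd⟩ := ih (by omega)
        obtain ⟨y, hy⟩ := Infinite.exists_notMem_finset (R ∪ S₀)
        simp only [Finset.mem_union, not_or] at hy
        refine ⟨insert y R, by simp [hR, hy.2], by rw [Finset.card_insert_of_notMem hy.1, hRt], ?_⟩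
        rw [Finset.sup_insert]
        have h1 := Submodule.finrank_sup_add_finrank_inf_eq (B (insert y S₀))
          (R.sup fun y => B (insert y S₀))
        have h2 : B (insert y S₀) ⊓ (R.sup fun y => B (insert y S₀)) = ⊥ := by
          rw [eq_bot_iff]
          have h3 : (R.sup fun y => B (insert y S₀)) ≤ B (R ∪ S₀) :=
            Finset.sup_le fun w hw => hBm (Finset.insert_subset (Finset.mem_union_left _ hw)
              Finset.subset_union_right)
          refine (inf_le_inf_left _ h3).trans ?_
          have hun : insert y S₀ ∪ (R ∪ S₀) = insert y (R ∪ S₀) := by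
            ext x; simp only [Finset.mem_union, Finset.mem_insert]; tauto
          have hin : insert y S₀ ∩ (R ∪ S₀) = S₀ := by
            ext x
            simp only [Finset.mem_inter, Finset.mem_insert, Finset.mem_union]
            constructor
            · rintro ⟨rfl | h, h' | h'⟩
              · exact absurd h' hy.1
              · exact h'
              · exact h
              · exact h
            · exact fun h => ⟨Or.inr h, Or.inr h⟩
          rw [hBi _ _ (by
            rw [hun, Finset.card_insert_of_notMem (by simp [hy]), Finset.card_union_of_disjoint hR]
            omega), hin, hmin q (by omega) S₀ hS₀]
        rw [h2, finrank_bot, hb, Finset.card_insert_of_notMem hy.2, hS₀, hb1'] at h1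
        omega
    obtain ⟨R, hR, hRt, hRd⟩ := key (k - q) (by omega)
    have h4 : (R.sup fun y => B (insert y S₀)) ≤ H S₀ :=
      Finset.sup_le fun w hw => hHle _ _ (Finset.disjoint_left.mp hR hw)
    have h5 := Submodule.finrank_mono h4
    omega
  · push Not
    exact fun u hu v hv => hall u hu v hv q le_rfl ∅ (by simp)
end BilinKer

/-! ### Products of linear forms -/

/-- The linear form with given coefficients. -/
def linForm {R : Type*} [CommRing R] {n : ℕ} : (Fin n → R) →ₗ[R] MvPolynomial (Fin n) R where
  toFun c := ∑ a, c a • X a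
  map_add' c c' := by simp [add_smul, Finset.sum_add_distrib]
  map_smul' r c := by simp [mul_smul, Finset.smul_sum]

theorem linForm_apply {R : Type*} [CommRing R] {n : ℕ} (c : Fin n → R) :
    linForm c = ∑ a, c a • (X a : MvPolynomial (Fin n) R) := rfl

/-- The standard index type of the affine chart of the Chow variety. -/
abbrev ChartIdx (d s : ℕ) : Type := Option (Fin d × Fin s)

section Chart
variable {R : Type*} [CommRing R] {d s : ℕ}

/-- The linear forms of a point of the chart. -/
def chartVec (z : ChartIdx d s → R) (i : Fin d) : Fin (s + 1) → R :=
  Fin.cons 1 fun a => z (some (i, a))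

/-- The product of linear forms parametrized by a point of the chart. -/
def chartForm (z : ChartIdx d s → R) : MvPolynomial (Fin (s + 1)) R :=
  z none • ∏ i, linForm (chartVec z i)

/-- The partial derivatives of `chartForm`. -/
def chartTangent (z : ChartIdx d s → R) : ChartIdx d s → MvPolynomial (Fin (s + 1)) R
  | none => ∏ i, linForm (chartVec z i)
  | some (i, a) => z none • (X a.succ * ∏ k ∈ Finset.univ.erase i, linForm (chartVec z k))

/-- A direction in the chart, as a tuple of linear forms without the first variable. -/
def dirVec (v : Fin d × Fin s → R) (i : Fin d) : Fin (s + 1) → R :=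
  Fin.cons 0 fun a => v (i, a)

theorem dirVec_add (v w : Fin d × Fin s → R) (i : Fin d) :
    dirVec (v + w) i = dirVec v i + dirVec w i := by
  ext a
  refine Fin.cases ?_ (fun a => ?_) a <;> simp [dirVec]

theorem dirVec_smul (c : R) (v : Fin d × Fin s → R) (i : Fin d) :
    dirVec (c • v) i = c • dirVec v i := by
  ext a
  refine Fin.cases ?_ (fun a => ?_) a <;> simp [dirVec]

/-- The tangent map of the multiplication map at a tuple of linear forms. -/
def mulTangent {n : ℕ} (ℓ : Fin d → Fin n → R) :
    (Fin d → Fin n → R) →ₗ[R] MvPolynomial (Fin n) R where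
  toFun g := ∑ i, linForm (g i) * ∏ k ∈ Finset.univ.erase i, linForm (ℓ k)
  map_add' g g' := by simp [add_mul, Finset.sum_add_distrib]
  map_smul' r g := by simp [Finset.smul_sum]

theorem mulTangent_apply {n : ℕ} (ℓ g : Fin d → Fin n → R) :
    mulTangent ℓ g = ∑ i, linForm (g i) * ∏ k ∈ Finset.univ.erase i, linForm (ℓ k) := rfl

/-- The second derivative of the multiplication map. -/
def mulHessian (ℓ : Fin d → Fin (s + 1) → R) :
    (Fin d × Fin s → R) →ₗ[R] (Fin d × Fin s → R) →ₗ[R] MvPolynomial (Fin (s + 1)) R :=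
  LinearMap.mk₂ R (fun v u => ∑ i, ∑ j ∈ Finset.univ.erase i,
      linForm (dirVec v i) * linForm (dirVec u j) *
        ∏ k ∈ (Finset.univ.erase i).erase j, linForm (ℓ k))
    (by intro v v' u; simp [dirVec_add, add_mul, Finset.sum_add_distrib])
    (by
      intro c v u
      simp only [dirVec_smul, map_smul, smul_mul_assoc, Finset.smul_sum])
    (by intro v u u'; simp [dirVec_add, add_mul, mul_add, Finset.sum_add_distrib])
    (by
      intro c v u
      simp only [dirVec_smul, map_smul, smul_mul_assoc, mul_smul_comm, Finset.smul_sum])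

theorem mulHessian_apply (ℓ : Fin d → Fin (s + 1) → R) (v u : Fin d × Fin s → R) :
    mulHessian ℓ v u = ∑ i, ∑ j ∈ Finset.univ.erase i,
      linForm (dirVec v i) * linForm (dirVec u j) *
        ∏ k ∈ (Finset.univ.erase i).erase j, linForm (ℓ k) := rfl

theorem mulHessian_comm (ℓ : Fin d → Fin (s + 1) → R) (v u : Fin d × Fin s → R) :
    mulHessian ℓ v u = mulHessian ℓ u v := by
  have h : ∀ v u : Fin d × Fin s → R, mulHessian ℓ v u = ∑ i, ∑ j, if j ≠ i then
      linForm (dirVec v i) * linForm (dirVec u j) *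
        ∏ k ∈ (Finset.univ.erase i).erase j, linForm (ℓ k) else 0 := by
    intro v u
    rw [mulHessian_apply]
    refine Finset.sum_congr rfl fun i _ => ?_
    rw [← Finset.sum_filter]
    refine Finset.sum_congr ?_ fun _ _ => rfl
    ext j; simp
  rw [h, h, Finset.sum_comm]
  refine Finset.sum_congr rfl fun i _ => Finset.sum_congr rfl fun j _ => ?_
  by_cases hij : i = j
  · simp [hij]
  · rw [if_pos hij, if_pos (Ne.symm hij), Finset.erase_right_comm]
    ring

section Naturality
variable {R' : Type*} [CommRing R'] (φ : R →+* R')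

theorem map_linForm {n : ℕ} (c : Fin n → R) :
    MvPolynomial.map φ (linForm c) = linForm (fun a => φ (c a)) := by
  simp [linForm_apply, smul_eq_C_mul]

theorem map_chartVec (z : ChartIdx d s → R) (i : Fin d) :
    (fun a => φ (chartVec z i a)) = chartVec (fun x => φ (z x)) i := by
  ext a
  refine Fin.cases ?_ (fun a => ?_) a <;> simp [chartVec]

theorem map_dirVec (v : Fin d × Fin s → R) (i : Fin d) :
    (fun a => φ (dirVec v i a)) = dirVec (fun x => φ (v x)) i := by
  ext a
  refine Fin.cases ?_ (fun a => ?_) a <;> simp [dirVec]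

theorem map_chartForm (z : ChartIdx d s → R) :
    MvPolynomial.map φ (chartForm z) = chartForm (fun x => φ (z x)) := by
  simp [chartForm, smul_eq_C_mul, map_linForm, map_chartVec]

theorem map_chartTangent (z : ChartIdx d s → R) (l : ChartIdx d s) :
    MvPolynomial.map φ (chartTangent z l) = chartTangent (fun x => φ (z x)) l := by
  rcases l with _ | ⟨i, a⟩
  · simp [chartTangent, map_linForm, map_chartVec]
  · simp [chartTangent, smul_eq_C_mul, map_linForm, map_chartVec]

theorem map_mulHessian (ℓ : Fin d → Fin (s + 1) → R) (v u : Fin d × Fin s → R) :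
    MvPolynomial.map φ (mulHessian ℓ v u) =
      mulHessian (fun i a => φ (ℓ i a)) (fun x => φ (v x)) (fun x => φ (u x)) := by
  simp [mulHessian_apply, map_linForm, map_dirVec]

end Naturality

theorem linForm_isHomogeneous {n : ℕ} (c : Fin n → R) : (linForm c).IsHomogeneous 1 := by
  rw [linForm_apply]
  refine IsHomogeneous.sum _ _ _ fun a _ => ?_
  rw [smul_eq_C_mul]
  simpa using (isHomogeneous_C (Fin n) (c a)).mul (isHomogeneous_X R a)

theorem exists_linForm_of_isHomogeneous {n : ℕ} {f : MvPolynomial (Fin n) R}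
    (hf : f.IsHomogeneous 1) : ∃ c, f = linForm c := by
  refine ⟨fun a => coeff (Finsupp.single a 1) f, ?_⟩
  classical
  ext α
  rw [linForm_apply, coeff_sum]
  simp only [coeff_smul, smul_eq_mul, coeff_X]
  by_cases hα : ∃ a, α = Finsupp.single a 1
  · obtain ⟨a, rfl⟩ := hα
    rw [Finset.sum_eq_single a]
    · simp
    · intro b _ hb
      rw [if_neg, mul_zero]
      intro h
      exact hb (Finsupp.single_left_injective one_ne_zero h)
    · simp
  · push Not at hα
    rw [Finset.sum_eq_zero (fun b _ => by rw [if_neg (Ne.symm (hα b)), mul_zero])]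
    by_contra hne
    have h1 := hf hne
    have h2 : α ∈ {α : Fin n →₀ ℕ | α.degree = 1} := by
      rw [Set.mem_ofPred_eq, Finsupp.degree_eq_weight_one]
      exact h1
    rw [← Finsupp.range_single_one] at h2
    obtain ⟨a, ha⟩ := h2
    exact hα a ha.symm

theorem eval_linForm {n : ℕ} (c q : Fin n → R) : eval q (linForm c) = ∑ a, c a * q a := by
  simp [linForm_apply, smul_eq_C_mul]

theorem prod_linForm_isHomogeneous {n : ℕ} (S : Finset (Fin d)) (ℓ : Fin d → Fin n → R) :
    (∏ i ∈ S, linForm (ℓ i)).IsHomogeneous S.card := by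
  simpa using IsHomogeneous.prod S _ (fun _ => 1) fun i _ => linForm_isHomogeneous (ℓ i)

end Chart

/-! ### Linear forms in general position -/

section GeneralPosition
variable {Ω : Type*} [Field Ω] {n d s : ℕ}

/-- No linear form lies in the span of two others. -/
def TripleIndependent (ℓ : Fin d → Fin n → Ω) : Prop :=
  ∀ i j k, k ≠ i → k ≠ j → ℓ k ∉ Submodule.span Ω {ℓ i, ℓ j}

theorem exists_vanishing_and_nonvanishing [Infinite Ω] {τ : Type*} [Finite τ]
    (A : Set (Fin n → Ω)) (f : τ → Fin n → Ω) (hf : ∀ t, f t ∉ Submodule.span Ω A) :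
    ∃ q : Fin n → Ω, (∀ a ∈ A, eval q (linForm a) = 0) ∧ ∀ t, eval q (linForm (f t)) ≠ 0 := by
  have key := Module.Dual.exists_forall_mem_ne_zero_of_forall_exists
    (Submodule.span Ω A).dualAnnihilator (fun t => Module.Dual.eval Ω (Fin n → Ω) (f t)) (by
      intro t
      obtain ⟨φ, h1, h2⟩ := Submodule.exists_le_ker_of_notMem (hf t)
      refine ⟨φ, ?_, h1⟩
      rw [Submodule.mem_dualAnnihilator]
      exact fun w hw => h2 hw)
  obtain ⟨φ, h1, h2⟩ := key
  have h3 : ∀ c : Fin n → Ω, eval (fun a => φ (Pi.single a 1)) (linForm c) = φ c := by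
    intro c
    rw [eval_linForm, LinearMap.pi_apply_eq_sum_univ φ c]
    refine Finset.sum_congr rfl fun a _ => ?_
    rw [smul_eq_mul]
    congr 2
    ext b
    simp [Pi.single_apply, eq_comm]
  refine ⟨fun a => φ (Pi.single a 1), fun a ha => ?_, fun t => ?_⟩
  · rw [h3]
    exact (Submodule.mem_dualAnnihilator φ).1 h1 a (Submodule.subset_span ha)
  · rw [h3]
    exact h2 t

theorem linForm_injective : Function.Injective (linForm (R := Ω) (n := n)) := by
  rw [← LinearMap.ker_eq_bot, LinearMap.ker_eq_bot']
  intro c hc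
  ext a
  have := congrArg (eval (Pi.single a 1)) hc
  simpa [eval_linForm, Pi.single_apply] using this

theorem linForm_chartVec_ne_zero (z : ChartIdx d s → Ω) (i : Fin d) :
    linForm (chartVec z i) ≠ 0 := by
  intro h
  have := linForm_injective (h.trans (map_zero _).symm)
  have := congrFun this 0
  simp [chartVec] at this

theorem sum_smul_chartTangent (z : ChartIdx d s → Ω) (c : ChartIdx d s → Ω) :
    ∑ l, c l • chartTangent z l = c none • ∏ i, linForm (chartVec z i) +
      z none • mulTangent (chartVec z) (dirVec fun x => c (some x)) := by
  rw [Fintype.sum_option, mulTangent_apply, Fintype.sum_prod_type, Finset.smul_sum]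
  congr 1
  refine Finset.sum_congr rfl fun i _ => ?_
  simp only [chartTangent, linForm_apply, Fin.sum_univ_succ, dirVec, Fin.cons_zero, Fin.cons_succ,
    zero_smul, zero_add, Finset.sum_mul, Finset.smul_sum]
  refine Finset.sum_congr rfl fun a _ => ?_
  rw [smul_mul_assoc, smul_comm]

theorem mulTangent_update_self (ℓ : Fin d → Fin n → Ω) (a : Fin d → Ω) :
    mulTangent ℓ (fun i => a i • ℓ i) = (∑ i, a i) • ∏ i, linForm (ℓ i) := by
  rw [mulTangent_apply, Finset.sum_smul]
  refine Finset.sum_congr rfl fun i _ => ?_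
  rw [map_smul, smul_mul_assoc,
    Finset.mul_prod_erase _ (fun k => linForm (ℓ k)) (Finset.mem_univ i)]

theorem span_chartTangent [NeZero d] (z : ChartIdx d s → Ω) (hz : z none ≠ 0) :
    Submodule.span Ω (Set.range (chartTangent z)) = LinearMap.range (mulTangent (chartVec z)) := by
  ext f
  rw [Submodule.mem_span_range_iff_exists_fun]
  constructor
  · rintro ⟨c, rfl⟩
    rw [sum_smul_chartTangent]
    refine Submodule.add_mem _ ⟨fun i => (Pi.single 0 (c none) : Fin d → Ω) i • chartVec z i, ?_⟩
      (Submodule.smul_mem _ _ ⟨_, rfl⟩)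
    rw [mulTangent_update_self]
    simp
  · rintro ⟨g, rfl⟩
    refine ⟨fun l => l.elim (∑ i, g i 0) fun x => (z none)⁻¹ *
      (g x.1 x.2.succ - g x.1 0 * chartVec z x.1 x.2.succ), ?_⟩
    rw [sum_smul_chartTangent]
    simp only [Option.elim_none, Option.elim_some]
    rw [← mulTangent_update_self, ← map_smul, ← map_add]
    congr 1
    ext i a
    refine Fin.cases ?_ (fun a => ?_) a
    · simp [dirVec, chartVec]
    · simp [dirVec, mul_inv_cancel_left₀ hz]

theorem eval_mulTangent_of_vanish (ℓ g : Fin d → Fin n → Ω) (q : Fin n → Ω) (i : Fin d)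
    (hi : eval q (linForm (ℓ i)) = 0) :
    eval q (mulTangent ℓ g) = eval q (linForm (g i)) *
      ∏ k ∈ Finset.univ.erase i, eval q (linForm (ℓ k)) := by
  rw [mulTangent_apply, map_sum, Finset.sum_eq_single i]
  · simp
  · intro j _ hj
    rw [map_mul, map_prod, Finset.prod_eq_zero (i := i) (by simp [hj.symm]) hi, mul_zero]
  · simp

theorem eval_mulTangent_of_vanish_pair (ℓ g : Fin d → Fin n → Ω) (q : Fin n → Ω) (i j : Fin d)
    (hij : i ≠ j) (hi : eval q (linForm (ℓ i)) = 0) (hj : eval q (linForm (ℓ j)) = 0) :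
    eval q (mulTangent ℓ g) = 0 := by
  rw [eval_mulTangent_of_vanish ℓ g q i hi, Finset.prod_eq_zero (i := j) (by simp [hij.symm]) hj,
    mul_zero]

theorem eval_mulHessian_of_vanish_pair (ℓ : Fin d → Fin (s + 1) → Ω) (v u : Fin d × Fin s → Ω)
    (q : Fin (s + 1) → Ω) (i j : Fin d)
    (hij : i ≠ j) (hi : eval q (linForm (ℓ i)) = 0) (hj : eval q (linForm (ℓ j)) = 0) :
    eval q (mulHessian ℓ v u) =
      (eval q (linForm (dirVec v i)) * eval q (linForm (dirVec u j)) +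
        eval q (linForm (dirVec v j)) * eval q (linForm (dirVec u i))) *
      ∏ k ∈ (Finset.univ.erase i).erase j, eval q (linForm (ℓ k)) := by
  have hz : ∀ i' j' : Fin d, (i ≠ i' ∧ i ≠ j') ∨ (j ≠ i' ∧ j ≠ j') →
      ∏ k ∈ (Finset.univ.erase i').erase j', eval q (linForm (ℓ k)) = 0 := by
    rintro i' j' (h | h)
    · exact Finset.prod_eq_zero (i := i) (by simp [h]) hi
    · exact Finset.prod_eq_zero (i := j) (by simp [h]) hj
  rw [mulHessian_apply, map_sum, Finset.sum_eq_add i j hij]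
  · rw [map_sum, map_sum, Finset.sum_eq_single j, Finset.sum_eq_single i, Finset.erase_right_comm]
    · simp only [map_mul, map_prod]
      ring
    · intro b hb hbi
      rw [map_mul, map_prod, hz j b (Or.inl ⟨hij, hbi.symm⟩), mul_zero]
    · simp [hij]
    · intro b hb hbi
      rw [map_mul, map_prod, hz i b (Or.inr ⟨hij.symm, hbi.symm⟩), mul_zero]
    · simp [hij.symm]
  · rintro c - ⟨hci, hcj⟩
    rw [map_sum]
    refine Finset.sum_eq_zero fun b hb => ?_
    rw [map_mul, map_prod, hz c b, mul_zero]
    by_cases h : i = b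
    · right; exact ⟨hcj.symm, fun h' => hij (h.trans h'.symm)⟩
    · left; exact ⟨hci.symm, h⟩
  · simp
  · simp

theorem dirVec_eq_zero_of_mem_span {z : ChartIdx d s → Ω} {v : Fin d × Fin s → Ω} {i i' : Fin d}
    (h : dirVec v i ∈ Submodule.span Ω {chartVec z i'}) : dirVec v i = 0 := by
  obtain ⟨c, hc⟩ := Submodule.mem_span_singleton.1 h
  have h0 := congrFun hc 0
  simp only [chartVec, dirVec, Pi.smul_apply, Fin.cons_zero, smul_eq_mul, mul_one] at h0
  rw [← hc, h0, zero_smul]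

theorem linearIndependent_chartTangent [Infinite Ω] (z : ChartIdx d s → Ω) (hz : z none ≠ 0)
    (hℓ : TripleIndependent (chartVec z)) : LinearIndependent Ω (chartTangent z) := by
  rw [Fintype.linearIndependent_iff]
  intro c hc
  rw [sum_smul_chartTangent] at hc
  have hdir : ∀ i, dirVec (fun x => c (some x)) i = 0 := by
    intro i
    by_contra hne
    obtain ⟨q, hq1, hq2⟩ := exists_vanishing_and_nonvanishing {chartVec z i}
      (fun k : Fin d => if k = i then dirVec (fun x => c (some x)) i else chartVec z k) (by
        intro k
        by_cases hk : k = i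
        · rw [if_pos hk]
          exact fun h => hne (dirVec_eq_zero_of_mem_span h)
        · rw [if_neg hk]
          simpa using hℓ i i k hk hk)
    have hi := hq1 _ rfl
    have h := congrArg (eval q) hc
    rw [map_add, smul_eval, smul_eval, eval_mulTangent_of_vanish _ _ q i hi, map_prod,
      Finset.prod_eq_zero (Finset.mem_univ i) hi, mul_zero, zero_add, map_zero] at h
    have h1 := hq2 i
    rw [if_pos rfl] at h1
    refine mul_ne_zero hz (mul_ne_zero h1 (Finset.prod_ne_zero_iff.2 fun k hk => ?_)) h
    have h2 := hq2 k
    rwa [if_neg (Finset.ne_of_mem_erase hk)] at h2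
  have h0 : mulTangent (chartVec z) (dirVec fun x => c (some x)) = 0 := by
    rw [mulTangent_apply]
    exact Finset.sum_eq_zero fun i _ => by rw [hdir, map_zero, zero_mul]
  rw [h0, smul_zero, add_zero, smul_eq_zero] at hc
  rintro (_ | ⟨i, a⟩)
  · exact hc.resolve_right (Finset.prod_ne_zero_iff.2 fun i _ => linForm_chartVec_ne_zero z i)
  · simpa [dirVec] using congrFun (hdir i) a.succ

theorem eval_eq_zero_of_mem_span_chartTangent [NeZero d] (z : ChartIdx d s → Ω) (hz : z none ≠ 0)
    {f : MvPolynomial (Fin (s + 1)) Ω} (hf : f ∈ Submodule.span Ω (Set.range (chartTangent z)))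
    (q : Fin (s + 1) → Ω) (i j : Fin d) (hij : i ≠ j)
    (hi : eval q (linForm (chartVec z i)) = 0) (hj : eval q (linForm (chartVec z j)) = 0) :
    eval q f = 0 := by
  rw [span_chartTangent z hz] at hf
  obtain ⟨g, rfl⟩ := hf
  exact eval_mulTangent_of_vanish_pair _ _ q i j hij hi hj

end GeneralPosition

section Hessian
variable {Ω : Type*} [Field Ω] {n d s : ℕ}

theorem exists_third (hd : 3 ≤ d) (i j : Fin d) : ∃ k, k ≠ i ∧ k ≠ j := by
  have h : ({i, j} : Finset (Fin d)).card < (Finset.univ : Finset (Fin d)).card := by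
    rw [Finset.card_univ, Fintype.card_fin]
    exact lt_of_le_of_lt Finset.card_le_two hd
  obtain ⟨k, -, hk⟩ := Finset.exists_mem_notMem_of_card_lt_card h
  simp only [Finset.mem_insert, Finset.mem_singleton, not_or] at hk
  exact ⟨k, hk⟩

theorem mulHessian_kernel_trivial [Infinite Ω] (hd : 3 ≤ d) (z : ChartIdx d s → Ω)
    (hz : z none ≠ 0) (hℓ : TripleIndependent (chartVec z)) (v : Fin d × Fin s → Ω)
    (hv : ∀ u, mulHessian (chartVec z) v u ∈ Submodule.span Ω (Set.range (chartTangent z))) :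
    v = 0 := by
  have : NeZero d := ⟨by omega⟩
  have hmem : ∀ i j, i ≠ j → dirVec v i ∈ Submodule.span Ω {chartVec z i, chartVec z j} := by
    intro i j hij
    by_contra hne
    obtain ⟨q, hq1, hq2⟩ := exists_vanishing_and_nonvanishing {chartVec z i, chartVec z j}
      (fun k : Fin d => if k = i ∨ k = j then dirVec v i else chartVec z k) (by
        intro k
        by_cases hk : k = i ∨ k = j
        · rwa [if_pos hk]
        · rw [if_neg hk]
          push Not at hk
          exact hℓ i j k hk.1 hk.2)
    have hi := hq1 (chartVec z i) (by simp)
    have hj := hq1 (chartVec z j) (by simp)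
    have hvi := hq2 i
    rw [if_pos (Or.inl rfl)] at hvi
    have hk : ∀ k, k ≠ i → k ≠ j → eval q (linForm (chartVec z k)) ≠ 0 := by
      intro k h1 h2
      simpa [h1, h2] using hq2 k
    obtain ⟨a, ha⟩ : ∃ a : Fin s, q a.succ ≠ 0 := by
      by_contra hall
      push Not at hall
      obtain ⟨k, h1, h2⟩ := exists_third hd i j
      apply hk k h1 h2
      rw [eval_linForm, Fin.sum_univ_succ] at hi ⊢
      simpa [chartVec, hall] using hi
    have h := eval_eq_zero_of_mem_span_chartTangent z hz (hv (Pi.single (j, a) 1)) q i j hij hi hj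
    rw [eval_mulHessian_of_vanish_pair _ _ _ q i j hij hi hj] at h
    have hu1 : eval q (linForm (dirVec (Pi.single (j, a) (1 : Ω)) j)) = q a.succ := by
      rw [eval_linForm, Fin.sum_univ_succ]
      simp [dirVec, Pi.single_apply]
    have hu2 : eval q (linForm (dirVec (Pi.single (j, a) (1 : Ω)) i)) = 0 := by
      rw [eval_linForm, Fin.sum_univ_succ]
      simp [dirVec, hij]
    rw [hu1, hu2, mul_zero, add_zero] at h
    refine mul_ne_zero (mul_ne_zero hvi ha) (Finset.prod_ne_zero_iff.2 fun k hk' => ?_) h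
    simp only [Finset.mem_erase, Finset.mem_univ, and_true] at hk'
    exact hk k hk'.2 hk'.1
  have hzero : ∀ i, dirVec v i = 0 := by
    intro i
    obtain ⟨j, hji, -⟩ := exists_third hd i i
    obtain ⟨k, hki, hkj⟩ := exists_third hd i j
    obtain ⟨a, b, hab⟩ := Submodule.mem_span_pair.1 (hmem i j hji.symm)
    obtain ⟨a', b', hab'⟩ := Submodule.mem_span_pair.1 (hmem i k hki.symm)
    by_cases hb : b' = 0
    · apply dirVec_eq_zero_of_mem_span (z := z) (i' := i)
      rw [← hab', hb, zero_smul, add_zero]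
      exact Submodule.smul_mem _ _ (Submodule.mem_span_singleton_self _)
    · exfalso
      apply hℓ i j k hki hkj
      rw [Submodule.mem_span_pair]
      refine ⟨b'⁻¹ * (a - a'), b'⁻¹ * b, ?_⟩
      have : b' • chartVec z k = (a - a') • chartVec z i + b • chartVec z j := by
        have := hab.trans hab'.symm
        rw [sub_smul]
        linear_combination (exp := 1) -this
      rw [mul_smul, mul_smul, ← smul_add, ← this, smul_smul, inv_mul_cancel₀ hb, one_smul]
  ext ⟨i, a⟩
  simpa [dirVec] using congrFun (hzero i) a.succ

theorem dirVec_mem_span_sub {z : ChartIdx d s → Ω} {v : Fin d × Fin s → Ω} {k i j : Fin d}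
    (h : dirVec v k ∈ Submodule.span Ω {chartVec z i, chartVec z j}) :
    (fun a => v (k, a)) ∈ Submodule.span Ω {fun a => z (some (i, a)) - z (some (j, a))} := by
  obtain ⟨a, b, hab⟩ := Submodule.mem_span_pair.1 h
  have h0 : a + b = 0 := by simpa [chartVec, dirVec] using congrFun hab 0
  rw [Submodule.mem_span_singleton]
  refine ⟨a, ?_⟩
  ext x
  have h1 := congrFun hab x.succ
  simp only [chartVec, dirVec, Pi.add_apply, Pi.smul_apply, Fin.cons_succ, smul_eq_mul] at h1 ⊢
  linear_combination h1 - h0 * z (some (j, x))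

theorem finrank_isotropic_le [CharZero Ω] (hd : 1 ≤ d) (z : ChartIdx d s → Ω)
    (hz : z none ≠ 0) (hℓ : TripleIndependent (chartVec z)) (H : Submodule Ω (Fin d × Fin s → Ω))
    (hH : ∀ v ∈ H, mulHessian (chartVec z) v v ∈ Submodule.span Ω (Set.range (chartTangent z))) :
    Module.finrank Ω H ≤ s + (d - 1) := by
  have : NeZero d := ⟨by omega⟩
  let pr : Fin d → (Fin d × Fin s → Ω) →ₗ[Ω] (Fin s → Ω) := fun i =>
    LinearMap.funLeft Ω Ω fun a => (i, a)
  have hone : ∀ i j, i ≠ j →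
      Module.finrank Ω (H.map (pr i)) ≤ 1 ∨ Module.finrank Ω (H.map (pr j)) ≤ 1 := by
    intro i j hij
    let D : Submodule Ω (Fin s → Ω) := Submodule.span Ω {fun a => z (some (i, a)) - z (some (j, a))}
    have hD : Module.finrank Ω D ≤ 1 := (finrank_span_le_card _).trans (by simp)
    have hcov : ∀ v ∈ H, v ∈ D.comap (pr i) ∨ v ∈ D.comap (pr j) := by
      intro v hv
      by_contra hcon
      push Not at hcon
      obtain ⟨h1, h2⟩ := hcon
      obtain ⟨q, hq1, hq2⟩ := exists_vanishing_and_nonvanishing {chartVec z i, chartVec z j}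
        (fun k : Fin d => if k = i ∨ k = j then dirVec v k else chartVec z k) (by
          intro k
          by_cases hk : k = i ∨ k = j
          · rw [if_pos hk]
            intro hmem
            rcases hk with rfl | rfl
            · exact h1 (dirVec_mem_span_sub hmem)
            · exact h2 (dirVec_mem_span_sub hmem)
          · rw [if_neg hk]
            push Not at hk
            exact hℓ i j k hk.1 hk.2)
      have hi := hq1 (chartVec z i) (by simp)
      have hj := hq1 (chartVec z j) (by simp)
      have hvi := hq2 i
      rw [if_pos (Or.inl rfl)] at hvi
      have hvj := hq2 j
      rw [if_pos (Or.inr rfl)] at hvj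
      have h := eval_eq_zero_of_mem_span_chartTangent z hz (hH v hv) q i j hij hi hj
      rw [eval_mulHessian_of_vanish_pair _ _ _ q i j hij hi hj] at h
      refine mul_ne_zero ?_ (Finset.prod_ne_zero_iff.2 fun k hk' => ?_) h
      · rw [mul_comm (eval q (linForm (dirVec v j))), ← two_mul]
        exact mul_ne_zero two_ne_zero (mul_ne_zero hvi hvj)
      · simp only [Finset.mem_erase, Finset.mem_univ, and_true] at hk'
        have := hq2 k
        rwa [if_neg (by tauto)] at this
    have : H ≤ D.comap (pr i) ∨ H ≤ D.comap (pr j) := by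
      by_contra hcon
      push Not at hcon
      obtain ⟨⟨x, hx, hx'⟩, ⟨y, hy, hy'⟩⟩ :=
        And.intro (SetLike.not_le_iff_exists.1 hcon.1) (SetLike.not_le_iff_exists.1 hcon.2)
      have hxj := (hcov x hx).resolve_left hx'
      have hyi := (hcov y hy).resolve_right hy'
      rcases hcov (x + y) (H.add_mem hx hy) with h | h
      · exact hx' (by simpa using Submodule.sub_mem _ h hyi)
      · exact hy' (by simpa using Submodule.sub_mem _ h hxj)
    exact this.imp (fun h => (Submodule.finrank_mono (Submodule.map_le_iff_le_comap.2 h)).trans hD)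
      (fun h => (Submodule.finrank_mono (Submodule.map_le_iff_le_comap.2 h)).trans hD)
  obtain ⟨i₀, hi₀⟩ : ∃ i₀, ∀ i, i ≠ i₀ → Module.finrank Ω (H.map (pr i)) ≤ 1 := by
    by_cases hex : ∃ i₀, ¬ Module.finrank Ω (H.map (pr i₀)) ≤ 1
    · obtain ⟨i₀, hi₀⟩ := hex
      exact ⟨i₀, fun i hi => (hone i i₀ hi).resolve_right hi₀⟩
    · push Not at hex
      exact ⟨0, fun i _ => hex i⟩
  let Φ : H →ₗ[Ω] ((i : Fin d) → H.map (pr i)) := LinearMap.pi fun i =>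
    (pr i).restrict fun x hx => Submodule.mem_map_of_mem hx
  have hinj : Function.Injective Φ := by
    rw [← LinearMap.ker_eq_bot, LinearMap.ker_eq_bot']
    intro v hv
    ext ⟨i, a⟩
    exact congrFun (congrArg Subtype.val (congrFun hv i)) a
  calc Module.finrank Ω H ≤ Module.finrank Ω ((i : Fin d) → H.map (pr i)) :=
        LinearMap.finrank_le_finrank_of_injective hinj
    _ = ∑ i, Module.finrank Ω (H.map (pr i)) := Module.finrank_pi_fintype Ω
    _ = Module.finrank Ω (H.map (pr i₀)) +
        ∑ i ∈ Finset.univ.erase i₀, Module.finrank Ω (H.map (pr i)) :=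
        (Finset.add_sum_erase _ _ (Finset.mem_univ i₀)).symm
    _ ≤ s + (d - 1) := by
        refine add_le_add ((Submodule.finrank_le _).trans (by simp)) ?_
        refine (Finset.sum_le_card_nsmul _ _ 1 fun i hi =>
          hi₀ i (Finset.ne_of_mem_erase hi)).trans ?_
        simp

theorem tripleIndependent_chartVec [Algebra ℂ Ω] (hs : 2 ≤ s) (z : ChartIdx d s → Ω)
    (hz : AlgebraicIndependent ℂ z) : TripleIndependent (chartVec z) := by
  obtain ⟨s, rfl⟩ : ∃ t, s = t + 2 := ⟨s - 2, by omega⟩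
  intro i j k hki hkj hmem
  obtain ⟨a, b, hab⟩ := Submodule.mem_span_pair.1 hmem
  have e0 : a + b = 1 := by simpa [chartVec] using congrFun hab 0
  have e : ∀ x, a * z (some (i, x)) + b * z (some (j, x)) = z (some (k, x)) := fun x => by
    simpa [chartVec] using congrFun hab x.succ
  by_cases hij : i = j
  · subst hij
    have h := e 0
    rw [← add_mul, e0, one_mul] at h
    have := hz.injective h
    simp only [Option.some.injEq, Prod.mk.injEq, and_true] at this
    exact hki this.symm
  · let p : MvPolynomial (ChartIdx d (s + 2)) ℂ :=
      (X (some (j, 0)) - X (some (i, 0))) * (X (some (k, 1)) - X (some (i, 1))) -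
        (X (some (j, 1)) - X (some (i, 1))) * (X (some (k, 0)) - X (some (i, 0)))
    have hp : aeval z p = 0 := by
      simp only [p, map_sub, map_mul, aeval_X]
      rw [← e 0, ← e 1]
      have : a = 1 - b := by rw [← e0]; ring
      rw [this]
      ring
    have hp0 : p = 0 := hz (by rw [hp, map_zero])
    have := congrArg (eval fun l : ChartIdx d (s + 2) =>
      if l = some (j, 0) ∨ l = some (k, 1) then (1 : ℂ) else 0) hp0
    simp [p, hij, hkj, Ne.symm hkj, Ne.symm hki] at this

end Hessian

/-! ### Semilinear automorphisms acting on subspaces -/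

section Twist
variable {Ω M : Type*} [Field Ω] [AddCommGroup M] [Module Ω M]

/-- The image of a subspace under a semilinear automorphism. -/
def twist (τ : Ω ≃+* Ω) (e : M ≃+ M) (h : ∀ r m, e (r • m) = τ r • e m) :
    Submodule Ω M ≃o Submodule Ω M where
  toFun W :=
    { carrier := {x | e.symm x ∈ W}
      add_mem' := by
        intro a b ha hb
        simpa using W.add_mem ha hb
      zero_mem' := by simp
      smul_mem' := by
        intro c x hx
        have : e.symm (c • x) = τ.symm c • e.symm x := by
          apply e.injective
          rw [h]; simp
        simpa [this] using W.smul_mem (τ.symm c) hx }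
  invFun W :=
    { carrier := {x | e x ∈ W}
      add_mem' := by
        intro a b ha hb
        simpa using W.add_mem ha hb
      zero_mem' := by simp
      smul_mem' := by
        intro c x hx
        simpa [h] using W.smul_mem (τ c) hx }
  left_inv W := by ext x; simp
  right_inv W := by ext x; simp
  map_rel_iff' := by
    intro W W'
    constructor
    · intro hle x hx
      have := @hle (e x) (by simpa using hx)
      simpa using this
    · intro hle x hx
      exact hle hx

theorem mem_twist (τ : Ω ≃+* Ω) (e : M ≃+ M) (h : ∀ r m, e (r • m) = τ r • e m)
    (W : Submodule Ω M) (x : M) : x ∈ twist τ e h W ↔ e.symm x ∈ W := Iff.rfl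

theorem apply_mem_twist (τ : Ω ≃+* Ω) (e : M ≃+ M) (h : ∀ r m, e (r • m) = τ r • e m)
    (W : Submodule Ω M) (x : M) : e x ∈ twist τ e h W ↔ x ∈ W := by
  rw [mem_twist, AddEquiv.symm_apply_apply]

theorem twist_span (τ : Ω ≃+* Ω) (e : M ≃+ M) (h : ∀ r m, e (r • m) = τ r • e m) (S : Set M) :
    twist τ e h (Submodule.span Ω S) = Submodule.span Ω (e '' S) := by
  apply le_antisymm
  · rw [← OrderIso.le_symm_apply, Submodule.span_le]
    intro x hx
    exact Submodule.subset_span (Set.mem_image_of_mem e hx)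
  · rw [Submodule.span_le]
    rintro _ ⟨x, hx, rfl⟩
    exact (apply_mem_twist τ e h _ x).2 (Submodule.subset_span hx)

theorem finrank_twist (τ : Ω ≃+* Ω) (e : M ≃+ M) (h : ∀ r m, e (r • m) = τ r • e m)
    (W : Submodule Ω M) : Module.finrank Ω (twist τ e h W) = Module.finrank Ω W := by
  let j : W ≃+ twist τ e h W :=
    { toFun := fun x => ⟨e x, (apply_mem_twist τ e h W x).2 x.2⟩
      invFun := fun x => ⟨e.symm x, x.2⟩
      left_inv := fun x => by simp
      right_inv := fun x => by simp
      map_add' := fun x y => by ext; simp }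
  have := rank_eq_of_equiv_equiv (τ : Ω → Ω) j τ.bijective fun r m => by ext; simp [j, h]
  simp only [Module.finrank, this]

end Twist

section Leibniz
variable {A : Type*} [CommRing A]

theorem leibniz_prod {ι : Type*} [DecidableEq ι] (δ : A →+ A)
    (hδ : ∀ f g, δ (f * g) = f * δ g + δ f * g) (s : Finset ι) (f : ι → A) :
    δ (∏ i ∈ s, f i) = ∑ i ∈ s, δ (f i) * ∏ j ∈ s.erase i, f j := by
  induction s using Finset.induction_on with
  | empty =>
    have := hδ 1 1
    simpa using this
  | insert a s ha ih =>
    rw [Finset.prod_insert ha, hδ, ih, Finset.sum_insert ha,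
      Finset.erase_insert ha, add_comm, Finset.mul_sum]
    congr 1
    refine Finset.sum_congr rfl fun i hi => ?_
    have : i ≠ a := fun h => ha (h ▸ hi)
    rw [Finset.erase_insert_of_ne this.symm, Finset.prod_insert (by simp [ha])]
    ring

end Leibniz

section Irreducible
variable {Ω : Type*} [Field Ω] [CharZero Ω] {n : ℕ}

theorem X_mul_pderiv_ne_zero_measure {d : ℕ} {f : MvPolynomial (Fin (n + 1)) Ω}
    (hf : f.IsHomogeneous d) {a : Fin (n + 1)} (ha : a ≠ 0) (hne : X 0 * pderiv a f ≠ 0) :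
    (X 0 * pderiv a f).support.sup (fun α => d - α 0) < f.support.sup (fun α => d - α 0) := by
  have key : ∀ γ ∈ (X 0 * pderiv a f).support, d - γ 0 < f.support.sup (fun α => d - α 0) := by
    intro γ hγ
    rw [mem_support_iff, coeff_X_mul'] at hγ
    split_ifs at hγ with h0
    · rw [coeff_pderiv] at hγ
      set β := γ - Finsupp.single 0 1 + Finsupp.single a 1 with hβ
      have hβs : β ∈ f.support := mem_support_iff.2 (left_ne_zero_of_mul hγ)
      have hdeg : β.degree = d := by
        rw [Finsupp.degree_eq_weight_one]; exact hf (mem_support_iff.1 hβs)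
      have h0' : 1 ≤ γ 0 := by
        have := Finsupp.mem_support_iff.1 h0
        omega
      have hβ0 : β 0 + 1 = γ 0 := by
        simp [hβ, ha]
        omega
      have hlt : β 0 < d := by
        have : β 0 + β a ≤ β.degree := by
          rw [Finsupp.degree_eq_sum]
          calc β 0 + β a = ∑ i ∈ {0, a}, β i := by rw [Finset.sum_pair ha.symm]
            _ ≤ _ := Finset.sum_le_sum_of_subset (Finset.subset_univ _)
        have h1 : 1 ≤ β a := by simp [hβ]
        omega
      have := Finset.le_sup (f := fun α : Fin (n + 1) →₀ ℕ => d - α 0) hβs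
      omega
    · exact absurd rfl hγ
  obtain ⟨γ, hγ⟩ := Finset.nonempty_of_ne_empty (mt support_eq_empty.1 hne)
  rw [Finset.sup_lt_iff (lt_of_le_of_lt bot_le (key γ hγ))]
  exact key

theorem homogeneousSubmodule_le_of_stable (d : ℕ)
    (Q : Submodule Ω (MvPolynomial (Fin (n + 1)) Ω))
    (hQ : Q ≤ homogeneousSubmodule (Fin (n + 1)) Ω d) (hne : Q ≠ ⊥)
    (hst : ∀ a b, ∀ f ∈ Q, X b * pderiv a f ∈ Q) :
    homogeneousSubmodule (Fin (n + 1)) Ω d ≤ Q := by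
  obtain ⟨f₀, hf₀, hf₀'⟩ := Submodule.exists_mem_ne_zero_of_ne_bot hne
  obtain ⟨f, ⟨hfQ, hfne⟩, hmin⟩ := (measure fun f : MvPolynomial (Fin (n + 1)) Ω =>
    f.support.sup (fun α => d - α 0)).wf.has_min {f | f ∈ Q ∧ f ≠ 0} ⟨f₀, hf₀, hf₀'⟩
  have hhom : f.IsHomogeneous d := hQ hfQ
  have hder : ∀ a, a ≠ 0 → pderiv a f = 0 := by
    intro a ha
    by_contra hcon
    have h1 : X 0 * pderiv a f ≠ 0 := mul_ne_zero (X_ne_zero 0) hcon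
    exact hmin _ ⟨hst a 0 f hfQ, h1⟩ (X_mul_pderiv_ne_zero_measure hhom ha h1)
  have hsupp : ∀ α ∈ f.support, α = Finsupp.single 0 d := by
    intro α hα
    have h0 : ∀ a, a ≠ 0 → α a = 0 := by
      intro a ha
      by_contra hαa
      have := congrArg (coeff (α - Finsupp.single a 1)) (hder a ha)
      rw [coeff_pderiv, tsub_add_cancel_of_le (by simpa using Nat.one_le_iff_ne_zero.2 hαa),
        coeff_zero] at this
      refine mul_ne_zero (mem_support_iff.1 hα) ?_ this
      exact Nat.cast_add_one_ne_zero _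
    have hdeg : α.degree = d := by
      rw [Finsupp.degree_eq_weight_one]; exact hhom (mem_support_iff.1 hα)
    rw [Finsupp.degree_eq_sum, Finset.sum_eq_single 0 (fun b _ hb => h0 b hb) (by simp)] at hdeg
    ext b
    by_cases hb : b = 0
    · subst hb; simp [hdeg]
    · rw [h0 b hb, Finsupp.single_apply, if_neg (Ne.symm hb)]
  have hmono0 : monomial (Finsupp.single 0 d) (1 : Ω) ∈ Q := by
    obtain ⟨α, hα⟩ := Finset.nonempty_of_ne_empty (mt support_eq_empty.1 hfne)
    have hα' := hsupp α hα
    subst hα'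
    have hf : f = coeff (Finsupp.single 0 d) f • monomial (Finsupp.single 0 d) (1 : Ω) := by
      rw [smul_monomial, smul_eq_mul, mul_one]
      conv_lhs => rw [as_sum f]
      rw [Finset.sum_eq_single (Finsupp.single 0 d)]
      · intro b hb hb'
        exact absurd (hsupp b hb) hb'
      · intro h; exact absurd hα h
    rw [hf] at hfQ
    exact (Submodule.smul_mem_iff _ (mem_support_iff.1 hα)).1 hfQ
  have hmono : ∀ k, ∀ α : Fin (n + 1) →₀ ℕ, α.degree = d → d - α 0 = k →
      monomial α (1 : Ω) ∈ Q := by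
    intro k
    induction k with
    | zero =>
      intro α hα hk
      have h0 : ∀ b, b ≠ 0 → α b = 0 := by
        intro b hb
        have : α 0 + α b ≤ α.degree := by
          rw [Finsupp.degree_eq_sum]
          calc α 0 + α b = ∑ i ∈ {0, b}, α i := by rw [Finset.sum_pair hb.symm]
            _ ≤ _ := Finset.sum_le_sum_of_subset (Finset.subset_univ _)
        omega
      rw [Finsupp.degree_eq_sum, Finset.sum_eq_single 0 (fun b _ hb => h0 b hb) (by simp)] at hα
      convert hmono0
      ext b
      by_cases hb : b = 0
      · subst hb; simp [hα]
      · rw [h0 b hb, Finsupp.single_apply, if_neg (Ne.symm hb)]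
    | succ k ih =>
      intro α hα hk
      obtain ⟨b, hb, hαb⟩ : ∃ b, b ≠ 0 ∧ α b ≠ 0 := by
        by_contra hcon
        push Not at hcon
        rw [Finsupp.degree_eq_sum, Finset.sum_eq_single 0 (fun b _ hb => hcon b hb) (by simp)] at hα
        omega
      have hle : Finsupp.single b 1 ≤ α := by simpa using Nat.one_le_iff_ne_zero.2 hαb
      have hβ := ih (α - Finsupp.single b 1 + Finsupp.single 0 1) (by
        have : α.degree = (α - Finsupp.single b 1 + Finsupp.single b 1).degree := by
          rw [tsub_add_cancel_of_le hle]
        rw [map_add, Finsupp.degree_single] at this ⊢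
        omega) (by
        simp [hb]
        omega)
      have h := hst 0 b _ hβ
      rw [pderiv_monomial, add_tsub_cancel_right, X, monomial_mul, one_mul, one_mul,
        add_tsub_cancel_of_le hle] at h
      have hc :
          (((α - Finsupp.single b 1 + Finsupp.single 0 1 : Fin (n + 1) →₀ ℕ) 0 : ℕ) : Ω) ≠ 0 := by
        simp [hb]
        exact Nat.cast_add_one_ne_zero _
      rw [← mul_one (((_ : ℕ) : Ω)), ← smul_eq_mul, ← smul_monomial] at h
      exact (Submodule.smul_mem_iff _ hc).1 h
  intro g hg
  rw [as_sum g]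
  refine Submodule.sum_mem _ fun α hα => ?_
  rw [← mul_one (coeff α g), ← smul_eq_mul, ← smul_monomial]
  refine Submodule.smul_mem _ _ (hmono _ α ?_ rfl)
  rw [Finsupp.degree_eq_weight_one]
  exact hg (mem_support_iff.1 hα)

end Irreducible

/-! ### The tangent spaces at generic points -/

section Preserve
variable {Ω : Type*} [Field Ω] {n d s : ℕ}

theorem linForm_mul_prod_mem_range (ℓ : Fin d → Fin n → Ω) (i : Fin d) (c : Fin n → Ω) :
    linForm c * ∏ k ∈ Finset.univ.erase i, linForm (ℓ k) ∈ LinearMap.range (mulTangent ℓ) := by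
  refine ⟨Pi.single i c, ?_⟩
  rw [mulTangent_apply, Finset.sum_eq_single i]
  · simp
  · intro j _ hj
    simp [hj]
  · simp

theorem leibniz_preserves_range (ℓ : Fin d → Fin n → Ω)
    (δ : MvPolynomial (Fin n) Ω →+ MvPolynomial (Fin n) Ω)
    (hδ : ∀ f g, δ (f * g) = f * δ g + δ f * g)
    (hlin : ∀ c, ∃ c', δ (linForm c) = linForm c')
    (hℓ : ∀ i, ∃ e : Ω, δ (linForm (ℓ i)) = e • linForm (ℓ i)) :
    ∀ f ∈ LinearMap.range (mulTangent ℓ), δ f ∈ LinearMap.range (mulTangent ℓ) := by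
  rintro _ ⟨g, rfl⟩
  rw [mulTangent_apply, map_sum]
  refine Submodule.sum_mem _ fun i _ => ?_
  choose e he using hℓ
  obtain ⟨c', hc'⟩ := hlin (g i)
  rw [hδ, leibniz_prod δ hδ, hc']
  refine Submodule.add_mem _ ?_ (linForm_mul_prod_mem_range ℓ i c')
  have : ∑ k ∈ Finset.univ.erase i, δ (linForm (ℓ k)) *
      ∏ j ∈ (Finset.univ.erase i).erase k, linForm (ℓ j) =
      (∑ k ∈ Finset.univ.erase i, e k) • ∏ j ∈ Finset.univ.erase i, linForm (ℓ j) := by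
    rw [Finset.sum_smul]
    refine Finset.sum_congr rfl fun k hk => ?_
    rw [he, smul_mul_assoc, Finset.mul_prod_erase _ (fun j => linForm (ℓ j)) hk]
  rw [this, mul_smul_comm]
  exact Submodule.smul_mem _ _ (linForm_mul_prod_mem_range ℓ i (g i))

theorem X_mul_pderiv_linForm (a b : Fin n) (c : Fin n → Ω) :
    X b * pderiv a (linForm c) = linForm (Pi.single b (c a)) := by
  simp only [linForm_apply, map_sum, Derivation.map_smul, pderiv_X, Pi.single_apply]
  rw [Finset.sum_eq_single a (by simp +contextual) (by simp),
    Finset.sum_eq_single b (by simp +contextual) (by simp)]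
  simp

theorem Derivation.coeffwise_linForm [Algebra ℂ Ω] (D : Derivation ℂ Ω Ω) (c : Fin n → Ω) :
    D.coeffwise (linForm c) = linForm fun a => D (c a) := by
  simp [linForm_apply, Derivation.coeffwise_smul]

theorem mem_finset_sup_of_preserves {P ι : Type*} [AddCommGroup P] [Module Ω P] [DecidableEq ι]
    (T : ι → Submodule Ω P) (δ : P →+ P) (S : Finset ι) (h : ∀ j ∈ S, ∀ f ∈ T j, δ f ∈ T j) :
    ∀ f ∈ S.sup T, δ f ∈ S.sup T := by
  induction S using Finset.induction_on with
  | empty =>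
    intro f hf
    rw [Finset.sup_empty, Submodule.mem_bot] at hf
    simp [hf]
  | insert a S ha ih =>
    intro f hf
    rw [Finset.sup_insert] at hf ⊢
    obtain ⟨x, hx, y, hy, rfl⟩ := Submodule.mem_sup.1 hf
    rw [map_add]
    exact Submodule.add_mem_sup (h a (by simp) x hx)
      (ih (fun j hj => h j (by simp [hj])) y hy)

/-- The affine tangent space of the Chow variety at a point of the chart. -/
def chartTangentSpace (z : ChartIdx d s → Ω) : Submodule Ω (MvPolynomial (Fin (s + 1)) Ω) :=
  Submodule.span Ω (Set.range (chartTangent z))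

instance (z : ChartIdx d s → Ω) : FiniteDimensional Ω (chartTangentSpace z) :=
  FiniteDimensional.span_of_finite Ω (Set.finite_range _)

theorem chartTangentSpace_le (z : ChartIdx d s → Ω) :
    chartTangentSpace z ≤ homogeneousSubmodule (Fin (s + 1)) Ω d := by
  rw [chartTangentSpace, Submodule.span_le]
  rintro _ ⟨_ | ⟨i, a⟩, rfl⟩
  · have h := prod_linForm_isHomogeneous Finset.univ (chartVec z)
    rw [Finset.card_univ, Fintype.card_fin] at h
    exact h
  · refine Submodule.smul_mem _ _ ?_
    have h := (isHomogeneous_X Ω a.succ).mul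
      (prod_linForm_isHomogeneous (Finset.univ.erase i) (chartVec z))
    have hd : 1 + (Finset.univ.erase i).card = d := by
      have := i.pos
      rw [Finset.card_erase_of_mem (Finset.mem_univ i), Finset.card_univ, Fintype.card_fin]
      omega
    rwa [hd] at h

end Preserve

section Symmetric
variable {Ω : Type*} [Field Ω] [Algebra ℂ Ω] {d s : ℕ} {ι : Type*}

/-- Independent generic points permuted freely by field automorphisms. -/
structure IsSymmetricGeneric (z : ι → ChartIdx d s → Ω) : Prop where
  algebraicIndependent : AlgebraicIndependent ℂ fun x : ι × ChartIdx d s => z x.1 x.2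
  exists_ringEquiv : ∀ σ : Equiv.Perm ι, ∃ τ : Ω ≃+* Ω, ∀ j l, τ (z j l) = z (σ j) l

theorem exists_isSymmetricGeneric (ι : Type) (d s : ℕ) :
    ∃ z : ι → ChartIdx d s → FractionRing (MvPolynomial (ι × ChartIdx d s) ℂ),
      IsSymmetricGeneric z := by
  refine ⟨fun j l => algebraMap (MvPolynomial (ι × ChartIdx d s) ℂ) _ (X (j, l)), ?_,
    fun σ => ?_⟩
  · have := (algebraicIndependent_X (ι × ChartIdx d s) ℂ).map'
      (f := IsScalarTower.toAlgHom ℂ (MvPolynomial (ι × ChartIdx d s) ℂ)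
        (FractionRing (MvPolynomial (ι × ChartIdx d s) ℂ)))
      (IsFractionRing.injective _ _)
    exact this
  · refine ⟨IsFractionRing.ringEquivOfRingEquiv
      (renameEquiv ℂ (σ.prodCongr (Equiv.refl (ChartIdx d s)))).toRingEquiv, fun j l => ?_⟩
    rw [IsFractionRing.ringEquivOfRingEquiv_algebraMap]
    simp

variable {z : ι → ChartIdx d s → Ω}

/-- The action of a field automorphism on the coefficients of polynomials. -/
def polyTwist (τ : Ω ≃+* Ω) : Submodule Ω (MvPolynomial (Fin (s + 1)) Ω) ≃o
    Submodule Ω (MvPolynomial (Fin (s + 1)) Ω) :=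
  twist τ (MvPolynomial.mapEquiv (Fin (s + 1)) τ).toAddEquiv fun r f => by
    simp [smul_eq_C_mul]

theorem polyTwist_chartTangentSpace (τ : Ω ≃+* Ω) (w : ChartIdx d s → Ω) :
    polyTwist τ (chartTangentSpace w) = chartTangentSpace fun l => τ (w l) := by
  rw [polyTwist, chartTangentSpace, twist_span, ← Set.range_comp, chartTangentSpace]
  congr 2
  ext1 l
  exact map_chartTangent (τ : Ω →+* Ω) w l

theorem polyTwist_finset_sup {τ : Ω ≃+* Ω} {σ : Equiv.Perm ι}
    (h : ∀ j l, τ (z j l) = z (σ j) l) (S : Finset ι) :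
    polyTwist τ (S.sup fun j => chartTangentSpace (z j)) =
      (S.map σ.toEmbedding).sup fun j => chartTangentSpace (z j) := by
  rw [map_finset_sup, Finset.sup_map]
  congr 1
  ext1 j
  simp only [Function.comp_apply, polyTwist_chartTangentSpace, h]
  rfl

variable [DecidableEq ι]

theorem IsSymmetricGeneric.finrank_eq (hz : IsSymmetricGeneric z) (S S' : Finset ι)
    (h : S.card = S'.card) :
    Module.finrank Ω ↥(S.sup fun j => chartTangentSpace (z j)) =
      Module.finrank Ω ↥(S'.sup fun j => chartTangentSpace (z j)) := by
  obtain ⟨σ, rfl⟩ := exists_perm_map_eq_of_card_eq S S' h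
  obtain ⟨τ, hτ⟩ := hz.exists_ringEquiv σ
  rw [← polyTwist_finset_sup hτ]
  exact (finrank_twist _ _ _ _).symm

theorem IsSymmetricGeneric.algebraicIndependent_apply (hz : IsSymmetricGeneric z) (j : ι) :
    AlgebraicIndependent ℂ (z j) :=
  hz.algebraicIndependent.comp (fun l => (j, l)) fun _ _ h => (Prod.mk.inj h).2

theorem IsSymmetricGeneric.apply_none_ne_zero (hz : IsSymmetricGeneric z) (j : ι) :
    z j none ≠ 0 :=
  (hz.algebraicIndependent_apply j).ne_zero none

/-- The derivation `X b * ∂/∂ a`, minus a coefficientwise derivation. -/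
def shearSub (D : Derivation ℂ Ω Ω) (a b : Fin (s + 1)) :
    MvPolynomial (Fin (s + 1)) Ω →+ MvPolynomial (Fin (s + 1)) Ω :=
  (AddMonoidHom.mulLeft (X b)).comp (pderiv a).toLinearMap.toAddMonoidHom - D.coeffwise

theorem shearSub_apply (D : Derivation ℂ Ω Ω) (a b : Fin (s + 1))
    (f : MvPolynomial (Fin (s + 1)) Ω) :
    shearSub D a b f = X b * pderiv a f - D.coeffwise f := rfl

theorem shearSub_mul (D : Derivation ℂ Ω Ω) (a b : Fin (s + 1))
    (f g : MvPolynomial (Fin (s + 1)) Ω) :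
    shearSub D a b (f * g) = f * shearSub D a b g + shearSub D a b f * g := by
  simp only [shearSub_apply, Derivation.leibniz, Derivation.coeffwise_mul, smul_eq_mul]
  ring

theorem shearSub_linForm (D : Derivation ℂ Ω Ω) (a b : Fin (s + 1)) (c : Fin (s + 1) → Ω) :
    shearSub D a b (linForm c) = linForm (Pi.single b (c a) - fun x => D (c x)) := by
  rw [shearSub_apply, X_mul_pderiv_linForm, Derivation.coeffwise_linForm, map_sub]

theorem exists_finset_inf_eq_iInf {P I : Type*} [AddCommGroup P] [Module Ω P] [Nonempty I]
    [DecidableEq I] (L : I → Submodule Ω P) [∀ i, FiniteDimensional Ω (L i)] :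
    ∃ F : Finset I, F.Nonempty ∧ F.inf L = ⨅ i, L i := by
  obtain ⟨F, hF, hmin⟩ := (measure fun F : Finset I => Module.finrank Ω ↥(F.inf L)).wf.has_min
    {F | F.Nonempty} ⟨{Classical.arbitrary I}, Finset.singleton_nonempty _⟩
  refine ⟨F, hF, le_antisymm (le_iInf fun i => ?_) (Finset.le_inf fun i _ => iInf_le L i)⟩
  obtain ⟨i₀, hi₀⟩ := hF
  have hle : (insert i F).inf L ≤ F.inf L := Finset.inf_mono (Finset.subset_insert i F)
  have : FiniteDimensional Ω ↥(F.inf L) :=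
    Submodule.finiteDimensional_of_le (Finset.inf_le hi₀)
  have heq : (insert i F).inf L = F.inf L :=
    Submodule.eq_of_le_of_finrank_le hle
      (not_lt.1 fun h => hmin (insert i F) (Finset.insert_nonempty i F) h)
  rw [← heq]
  exact Finset.inf_le (Finset.mem_insert_self i F)

theorem IsSymmetricGeneric.iInf_eq_bot_or_le [Infinite ι] [NeZero d] (hz : IsSymmetricGeneric z)
    (k : ℕ) :
    (⨅ S : {S : Finset ι // S.card = k}, (S : Finset ι).sup fun j => chartTangentSpace (z j)) = ⊥ ∨
      homogeneousSubmodule (Fin (s + 1)) Ω d ≤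
        ⨅ S : {S : Finset ι // S.card = k}, (S : Finset ι).sup fun j => chartTangentSpace (z j) := by
  have : CharZero Ω := charZero_of_injective_algebraMap (algebraMap ℂ Ω).injective
  set T : ι → Submodule Ω (MvPolynomial (Fin (s + 1)) Ω) := fun j => chartTangentSpace (z j) with hT
  have : ∀ j, FiniteDimensional Ω (T j) := fun j => by rw [hT]; infer_instance
  set L : {S : Finset ι // S.card = k} → Submodule Ω (MvPolynomial (Fin (s + 1)) Ω) :=
    fun S => (S : Finset ι).sup T with hL
  have : Nonempty {S : Finset ι // S.card = k} := by
    obtain ⟨S, hS⟩ := Infinite.exists_subset_card_eq ι k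
    exact ⟨⟨S, hS⟩⟩
  have : ∀ S, FiniteDimensional Ω (L S) := fun S => by rw [hL]; infer_instance
  obtain ⟨F, ⟨S₀, hS₀⟩, hF⟩ := exists_finset_inf_eq_iInf L
  set Q := ⨅ S, L S with hQ
  have hQfd : FiniteDimensional Ω Q := Submodule.finiteDimensional_of_le (iInf_le L S₀)
  by_cases hQ0 : Q = ⊥
  · exact Or.inl hQ0
  right
  have hTd : ∀ j, T j = LinearMap.range (mulTangent (chartVec (z j))) := fun j =>
    span_chartTangent (z j) (hz.apply_none_ne_zero j)
  let U : Finset ι := F.biUnion fun S => (S : Finset ι)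
  obtain ⟨U', hU', hdisj⟩ : ∃ U' : Finset ι, U.card = U'.card ∧ Disjoint U U' := by
    obtain ⟨t, ht, hc⟩ := Infinite.exists_superset_card_eq U (U.card + U.card) (by omega)
    refine ⟨t \ U, ?_, Finset.disjoint_sdiff⟩
    rw [Finset.card_sdiff_of_subset ht]
    omega
  obtain ⟨σ, hσ⟩ := exists_perm_map_eq_of_card_eq U U' hU'
  obtain ⟨τ, hτ⟩ := hz.exists_ringEquiv σ
  have hQ' : Q = F.inf fun S => ((S : Finset ι).map σ.toEmbedding).sup T := by
    have h1 : polyTwist τ Q = F.inf fun S => ((S : Finset ι).map σ.toEmbedding).sup T := by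
      rw [← hF, map_finset_inf]
      congr 1
      ext1 S
      exact polyTwist_finset_sup hτ _
    have : FiniteDimensional Ω ↥(polyTwist τ Q) := by
      rw [h1]
      exact Submodule.finiteDimensional_of_le (Finset.inf_le hS₀)
    rw [← h1]
    refine Submodule.eq_of_le_of_finrank_eq ?_ (finrank_twist _ _ _ _).symm
    rw [h1]
    refine Finset.le_inf fun S _ => ?_
    exact iInf_le L ⟨(S : Finset ι).map σ.toEmbedding, by rw [Finset.card_map]; exact S.2⟩
  refine homogeneousSubmodule_le_of_stable d Q ?_ hQ0 ?_
  · refine (iInf_le L S₀).trans (Finset.sup_le fun j _ => chartTangentSpace_le _)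
  intro a b f hf
  obtain ⟨D, hD⟩ := hz.algebraicIndependent.exists_derivation fun x : ι × ChartIdx d s =>
    if x.1 ∈ U then (match x.2 with
      | none => 0
      | some (i, t) => (Pi.single b (chartVec (z x.1) i a) : Fin (s + 1) → Ω) t.succ -
        (Pi.single b (chartVec (z x.1) i a) : Fin (s + 1) → Ω) 0 * chartVec (z x.1) i t.succ)
    else 0
  have hDU : ∀ j ∈ U, ∀ f ∈ T j, shearSub D a b f ∈ T j := by
    intro j hj
    rw [hTd]
    refine leibniz_preserves_range _ _ (shearSub_mul D a b)
      (fun c => ⟨_, shearSub_linForm D a b c⟩) fun i => ?_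
    refine ⟨(Pi.single b (chartVec (z j) i a) : Fin (s + 1) → Ω) 0, ?_⟩
    rw [shearSub_linForm, ← map_smul]
    congr 1
    ext x
    refine Fin.cases ?_ (fun t => ?_) x
    · simp [chartVec]
    · have := hD (j, some (i, t))
      simp only [hj, if_true] at this
      simp only [Pi.sub_apply, Pi.smul_apply, smul_eq_mul]
      rw [show chartVec (z j) i t.succ = z j (some (i, t)) by simp [chartVec], this]
      simp [chartVec]
  have hDU' : ∀ j ∈ U', ∀ f ∈ T j, D.coeffwise f ∈ T j := by
    intro j hj
    have hjU : j ∉ U := fun h => Finset.disjoint_left.1 hdisj h hj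
    rw [hTd]
    refine leibniz_preserves_range _ _ D.coeffwise_mul
      (fun c => ⟨_, D.coeffwise_linForm c⟩) fun i => ⟨0, ?_⟩
    rw [zero_smul, D.coeffwise_linForm, ← map_zero linForm]
    congr 1
    ext x
    refine Fin.cases ?_ (fun t => ?_) x
    · simp [chartVec]
    · have := hD (j, some (i, t))
      simp only [hjU, if_false] at this
      simpa [chartVec] using this
  have h1 : D.coeffwise f ∈ Q := by
    rw [hQ', Submodule.mem_finsetInf] at hf ⊢
    intro S hS
    refine mem_finset_sup_of_preserves T _ _ (fun j hj => hDU' j ?_) f (hf S hS)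
    rw [← hσ]
    exact Finset.map_subset_map.2 (Finset.subset_biUnion_of_mem
      (fun S : {S : Finset ι // S.card = k} => (S : Finset ι)) hS) hj
  have h2 : shearSub D a b f ∈ Q := by
    rw [← hF, Submodule.mem_finsetInf] at hf ⊢
    intro S hS
    exact mem_finset_sup_of_preserves T _ _ (fun j hj => hDU j
      (Finset.subset_biUnion_of_mem (fun S : {S : Finset ι // S.card = k} => (S : Finset ι)) hS hj)) f
      (hf S hS)
  have := Q.add_mem h2 h1
  rwa [shearSub_apply, sub_add_cancel] at this

end Symmetric

theorem choose_le_finrank_homogeneousSubmodule (Ω : Type*) [Field Ω] (n d : ℕ) :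
    Nat.choose (n + d - 1) d ≤ Module.finrank Ω (homogeneousSubmodule (Fin n) Ω d) := by
  have : FiniteDimensional Ω (homogeneousSubmodule (Fin n) Ω d) :=
    Module.Finite.iff_fg.2 (homogeneousSubmodule_fg (Fin n) Ω d)
  have hmem : ∀ α : ↥(Finset.finsuppAntidiag (Finset.univ : Finset (Fin n)) d),
      monomial (α : Fin n →₀ ℕ) (1 : Ω) ∈ homogeneousSubmodule (Fin n) Ω d := by
    intro α
    refine isHomogeneous_monomial _ ?_
    have := (Finset.mem_finsuppAntidiag.1 α.2).1
    rwa [Finsupp.degree_eq_sum]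
  have hli : LinearIndependent Ω
      fun α : ↥(Finset.finsuppAntidiag (Finset.univ : Finset (Fin n)) d) =>
        (⟨monomial (α : Fin n →₀ ℕ) (1 : Ω), hmem α⟩ : homogeneousSubmodule (Fin n) Ω d) := by
    apply LinearIndependent.of_comp (Submodule.subtype _)
    have := (basisMonomials (Fin n) Ω).linearIndependent.comp
      (fun α : ↥(Finset.finsuppAntidiag (Finset.univ : Finset (Fin n)) d) => (α : Fin n →₀ ℕ))
      Subtype.val_injective
    simpa [Function.comp_def] using this
  have h := hli.fintype_card_le_finrank
  rwa [Fintype.card_coe, Finset.card_finsuppAntidiag_nat_eq_choose, Finset.card_univ,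
    Fintype.card_fin] at h

section Main
variable {Ω : Type*} [Field Ω] [Algebra ℂ Ω] {d s : ℕ}

theorem finrank_chartTangentSpace [CharZero Ω] (hs : 2 ≤ s) (z : ChartIdx d s → Ω)
    (hz : AlgebraicIndependent ℂ z) : Module.finrank Ω (chartTangentSpace z) = d * s + 1 := by
  rw [chartTangentSpace, finrank_span_eq_card (linearIndependent_chartTangent z (hz.ne_zero none)
    (tripleIndependent_chartVec hs z hz))]
  simp

theorem IsSymmetricGeneric.finrank_sup {ι : Type*} [DecidableEq ι] [Infinite ι]
    {z : ι → ChartIdx d s → Ω} (hz : IsSymmetricGeneric z) (hs : 2 ≤ s) (hd : 3 ≤ d) {m : ℕ}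
    (hm : (d * s + 1) * (m + 1 + (d * s + 1)) ≤ Nat.choose (s + d) d)
    (S : Finset ι) (hS : S.card ≤ m + 2 + (d * s + 1) / 2) :
    Module.finrank Ω ↥(S.sup fun j => chartTangentSpace (z j)) = (d * s + 1) * S.card := by
  have : CharZero Ω := charZero_of_injective_algebraMap (algebraMap ℂ Ω).injective
  have : NeZero d := ⟨by omega⟩
  refine finrank_sup_eq_of_irreducible _ (homogeneousSubmodule (Fin (s + 1)) Ω d)
    (fun i => finrank_chartTangentSpace hs _ (hz.algebraicIndependent_apply i)) (by omega)
    hz.finrank_eq hz.iInf_eq_bot_or_le S ?_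
  have h := choose_le_finrank_homogeneousSubmodule Ω (s + 1) d
  rw [show s + 1 + d - 1 = s + d by omega] at h
  have h1 := hm.trans h
  set N := d * s + 1 with hN
  have h2 : N * (2 * S.card) ≤ N * (2 * m + 4 + N) := Nat.mul_le_mul_left N (by omega)
  have h3 : 0 < N := by omega
  nlinarith

/-- The field automorphism acting on coordinate vectors. -/
def dirTwist (τ : Ω ≃+* Ω) : Submodule Ω (Fin d × Fin s → Ω) ≃o Submodule Ω (Fin d × Fin s → Ω) :=
  twist τ (AddEquiv.piCongrRight fun _ => τ.toAddEquiv) fun r f => by ext; simp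

theorem dirTwist_bilinKer (τ : Ω ≃+* Ω) (w : ChartIdx d s → Ω) (hw : ∀ l, τ (w l) = w l)
    (W : Submodule Ω (MvPolynomial (Fin (s + 1)) Ω)) :
    dirTwist τ (bilinKer (mulHessian (chartVec w)) W) =
      bilinKer (mulHessian (chartVec w)) (polyTwist τ W) := by
  ext v
  have key : ∀ u v : Fin d × Fin s → Ω, mulHessian (chartVec w) v u ∈ W ↔
      mulHessian (chartVec w) (fun x => τ (v x)) (fun x => τ (u x)) ∈ polyTwist τ W := by
    intro u v
    rw [← apply_mem_twist τ (MvPolynomial.mapEquiv (Fin (s + 1)) τ).toAddEquiv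
      (fun r f => by simp [smul_eq_C_mul]) W]
    have h := map_mulHessian (τ : Ω →+* Ω) (chartVec w) v u
    have h2 : (fun i a => (τ : Ω →+* Ω) (chartVec w i a)) = chartVec w := by
      ext1 i
      rw [map_chartVec (τ : Ω →+* Ω)]
      simp [hw]
    rw [h2] at h
    exact iff_of_eq (congrArg (· ∈ polyTwist τ W) h)
  constructor
  · intro hv u
    have := (key (fun x => τ.symm (u x)) _).1 (hv fun x => τ.symm (u x))
    simpa using this
  · intro hv u
    rw [key]
    simpa using hv fun x => τ (u x)

theorem IsSymmetricGeneric.bilinKer_eq_bot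
    {z : Option ℕ → ChartIdx d s → Ω} (hz : IsSymmetricGeneric z) (hs : 2 ≤ s) (hd : 3 ≤ d) {m : ℕ}
    (hm : (d * s + 1) * (m + 1 + (d * s + 1)) ≤ Nat.choose (s + d) d)
    (S : Finset ℕ) (hS : S.card + 1 ≤ m) :
    bilinKer (mulHessian (chartVec (z none)))
      (S.insertNone.sup fun j => chartTangentSpace (z j)) = ⊥ := by
  have : CharZero Ω := charZero_of_injective_algebraMap (algebraMap ℂ Ω).injective
  have hGP := tripleIndependent_chartVec hs _ (hz.algebraicIndependent_apply none)
  have hW0 : (Finset.insertNone (∅ : Finset ℕ)).sup (fun j => chartTangentSpace (z j)) =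
      chartTangentSpace (z none) := by
    rw [show Finset.insertNone (∅ : Finset ℕ) = {none} by
      ext o; cases o <;> simp]
    simp
  choose τ hτ using fun σ : Equiv.Perm ℕ => hz.exists_ringEquiv (Equiv.optionCongr σ)
  have hmap : ∀ (σ : Equiv.Perm ℕ) (S : Finset ℕ),
      (S.insertNone).map (Equiv.optionCongr σ).toEmbedding =
        (S.map σ.toEmbedding).insertNone := by
    intro σ S
    ext o
    rw [Finset.mem_map_equiv, ← Equiv.optionCongr_symm]
    cases o <;> simp [Finset.mem_map_equiv, -Equiv.optionCongr_symm]
  have key := bilinKer_eq_bot_or_exists_isotropic (mulHessian (chartVec (z none)))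
    (mulHessian_comm _) (fun S : Finset ℕ => S.insertNone.sup fun j => chartTangentSpace (z j))
    (m + 1 + (d * s + 1) / 2) (by
      intro S S' h
      have hu : S.insertNone ∪ S'.insertNone = (S ∪ S').insertNone := by
        ext o; cases o <;> simp
      have hi : S.insertNone ∩ S'.insertNone = (S ∩ S').insertNone := by
        ext o; cases o <;> simp
      rw [← hi]
      refine sup_inf_sup_eq_of_finrank (N := d * s + 1) _ _ _ fun R hR => ?_
      refine hz.finrank_sup hs hd hm R ((Finset.card_le_card hR).trans ?_)
      rw [hu, Finset.card_insertNone]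
      omega)
    (fun S S' h => Finset.sup_mono (Finset.insertNone.monotone h))
    (fun σ => dirTwist (τ σ)) (by
      intro σ S
      rw [dirTwist_bilinKer _ _ (fun l => by rw [hτ]; simp), polyTwist_finset_sup (hτ σ), hmap])
    (fun σ A => finrank_twist _ _ _ _) (by
      rw [hW0, eq_bot_iff]
      intro v hv
      exact mulHessian_kernel_trivial hd _ (hz.apply_none_ne_zero none) hGP v hv)
    m (2 + (d * s + 1) / 2) (by omega) (by omega) (by simp; omega)
  rcases key with key | ⟨H, h1, h2⟩
  · exact key S hS
  · exfalso
    have h3 := finrank_isotropic_le (by omega) _ (hz.apply_none_ne_zero none) hGP H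
      (fun v hv => by
        have := h2 v hv v hv
        rwa [hW0] at this)
    have h4 : 2 * s + 2 * d ≤ d * s + 4 := by
      obtain ⟨s, rfl⟩ := Nat.exists_eq_add_of_le hs
      obtain ⟨d, rfl⟩ := Nat.exists_eq_add_of_le hd
      nlinarith
    omega

end Main

/-! ### Nondegeneracy at arbitrary independent points -/

section Coeff
variable {K : Type*} [Field K] {σ I E : Type*}

/-- The coefficients of a polynomial, as a linear map to functions. -/
def coeffFun : MvPolynomial σ K →ₗ[K] ((σ →₀ ℕ) → K) := LinearMap.pi fun α => lcoeff K α

theorem coeffFun_injective : Function.Injective (coeffFun (K := K) (σ := σ)) := by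
  intro f g h
  ext α
  exact congrFun h α

theorem linearIndependent_coeff_iff (f : I → MvPolynomial σ K) :
    LinearIndependent K (fun i α => coeff α (f i)) ↔ LinearIndependent K f :=
  LinearMap.linearIndependent_iff_of_injOn coeffFun coeffFun_injective.injOn

open Classical in
/-- The matrix expressing the nondegeneracy of a bilinear map modulo a subspace. -/
def hessFamily {R : Type*} [CommRing R] (H : E → E → MvPolynomial σ R) (t : I → MvPolynomial σ R) :
    E ⊕ (E × I) → E × (σ →₀ ℕ) → R
  | Sum.inl x, (y, α) => coeff α (H x y)
  | Sum.inr (x, i), (y, α) => if y = x then coeff α (t i) else 0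

theorem map_hessFamily {R R' : Type*} [CommRing R] [CommRing R'] (φ : R →+* R')
    (H : E → E → MvPolynomial σ R) (t : I → MvPolynomial σ R) (i : E ⊕ (E × I))
    (k : E × (σ →₀ ℕ)) :
    φ (hessFamily H t i k) =
      hessFamily (fun x y => MvPolynomial.map φ (H x y)) (fun i => MvPolynomial.map φ (t i)) i k := by
  rcases i with x | ⟨x, i⟩
  · simp [hessFamily, coeff_map]
  · simp only [hessFamily, coeff_map]
    split_ifs <;> simp

variable [Fintype E] [DecidableEq E] [Fintype I]

theorem sum_hessFamily (II : (E → K) →ₗ[K] (E → K) →ₗ[K] MvPolynomial σ K)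
    (t : I → MvPolynomial σ K) (c : E ⊕ (E × I) → K) (y : E) (α : σ →₀ ℕ) :
    (∑ i, c i • hessFamily (fun x y => II (Pi.single x 1) (Pi.single y 1)) t i) (y, α) =
      coeff α (II (fun x => c (Sum.inl x)) (Pi.single y 1) + ∑ i, c (Sum.inr (y, i)) • t i) := by
  have h1 : II (fun x => c (Sum.inl x)) (Pi.single y 1) =
      ∑ x, c (Sum.inl x) • II (Pi.single x 1) (Pi.single y 1) := by
    conv_lhs => rw [pi_eq_sum_univ' (fun x => c (Sum.inl x))]
    rw [map_sum, LinearMap.sum_apply]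
    refine Finset.sum_congr rfl fun x _ => ?_
    rw [map_smul, LinearMap.smul_apply]
  rw [h1, Fintype.sum_sum_type, Fintype.sum_prod_type]
  simp only [Pi.add_apply, Finset.sum_apply, Pi.smul_apply, hessFamily, coeff_add, coeff_sum,
    coeff_smul, smul_eq_mul, mul_ite, mul_zero]
  congr 1
  rw [Finset.sum_eq_single y]
  · simp
  · intro b _ hb
    simp [hb.symm]
  · simp

theorem linearIndependent_hessFamily_iff (II : (E → K) →ₗ[K] (E → K) →ₗ[K] MvPolynomial σ K)
    (t : I → MvPolynomial σ K) (ht : LinearIndependent K t) :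
    LinearIndependent K (hessFamily (fun x y => II (Pi.single x 1) (Pi.single y 1)) t) ↔
      bilinKer II (Submodule.span K (Set.range t)) = ⊥ := by
  rw [Fintype.linearIndependent_iff]
  constructor
  · intro h
    rw [eq_bot_iff]
    intro v hv
    choose c hc using fun y : E => (Submodule.mem_span_range_iff_exists_fun K).1
      (hv (Pi.single y 1))
    have := h (Sum.elim v fun x => - c x.1 x.2) (by
      ext ⟨y, α⟩
      rw [sum_hessFamily]
      simp only [Sum.elim_inl, Sum.elim_inr, neg_smul, Finset.sum_neg_distrib, hc]
      rw [show (fun x => v x) = v from rfl, add_neg_cancel]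
      simp)
    rw [Submodule.mem_bot]
    ext x
    exact this (Sum.inl x)
  · intro h c hc
    have h1 : ∀ y, II (fun x => c (Sum.inl x)) (Pi.single y 1) +
        ∑ i, c (Sum.inr (y, i)) • t i = 0 := by
      intro y
      ext α
      rw [← sum_hessFamily, hc]
      simp
    have h2 : (fun x => c (Sum.inl x)) ∈ bilinKer II (Submodule.span K (Set.range t)) := by
      intro u
      rw [pi_eq_sum_univ' u, map_sum]
      refine Submodule.sum_mem _ fun y _ => ?_
      rw [map_smul]
      refine Submodule.smul_mem _ _ ?_
      rw [eq_neg_of_add_eq_zero_left (h1 y)]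
      refine Submodule.neg_mem _ (Submodule.sum_mem _ fun i _ => Submodule.smul_mem _ _
        (Submodule.subset_span ⟨i, rfl⟩))
    rw [h, Submodule.mem_bot] at h2
    rintro (x | ⟨y, i⟩)
    · exact congrFun h2 x
    · have h3 := h1 y
      rw [h2, map_zero, LinearMap.zero_apply, zero_add] at h3
      exact Fintype.linearIndependent_iff.1 ht _ h3 i

end Coeff

section Transfer
variable {d s m : ℕ} {K : Type*} [Field K] [Algebra ℂ K]

theorem span_tangents_eq {ι : Type*} (S : Finset ι) (z : ι → ChartIdx d s → K)
    (e : Fin m ↪ ι) (he : S = Finset.univ.map e) :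
    Submodule.span K (Set.range fun x : Fin m × ChartIdx d s => chartTangent (z (e x.1)) x.2) =
      S.sup fun j => chartTangentSpace (z j) := by
  subst he
  rw [Finset.sup_map]
  apply le_antisymm
  · rw [Submodule.span_le]
    rintro _ ⟨⟨j, l⟩, rfl⟩
    exact Finset.le_sup (f := (fun j => chartTangentSpace (z j)) ∘ e) (Finset.mem_univ j)
      (Submodule.subset_span ⟨l, rfl⟩)
  · refine Finset.sup_le fun j _ => ?_
    refine Submodule.span_mono ?_
    rintro _ ⟨l, rfl⟩
    exact ⟨(j, l), rfl⟩

theorem aeval_coeff_chartTangent (w : Fin m → ChartIdx d s → K) :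
    (fun (x : Fin m × ChartIdx d s) (α : Fin (s + 1) →₀ ℕ) =>
      aeval (fun x : Fin m × ChartIdx d s => w x.1 x.2)
        (coeff α (chartTangent (fun l => (X (x.1, l) : MvPolynomial (Fin m × ChartIdx d s) ℂ))
          x.2))) =
    fun x α => coeff α (chartTangent (w x.1) x.2) := by
  ext x α
  have h := map_chartTangent (aeval fun x : Fin m × ChartIdx d s => w x.1 x.2 :
    MvPolynomial (Fin m × ChartIdx d s) ℂ →ₐ[ℂ] K).toRingHom (fun l => X (x.1, l)) x.2
  have h2 := congrArg (coeff α) h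
  rw [coeff_map] at h2
  simpa using h2

theorem map_single_one {R R' E : Type*} [CommRing R] [CommRing R'] [DecidableEq E] (φ : R →+* R')
    (x : E) : (fun y => φ ((Pi.single x 1 : E → R) y)) = Pi.single x 1 := by
  ext y
  by_cases h : y = x <;> simp [h]

theorem aeval_hessFamily_mulHessian (w : Fin m → ChartIdx d s → K) (j : Fin m) :
    (fun (i : (Fin d × Fin s) ⊕ ((Fin d × Fin s) × (Fin m × ChartIdx d s)))
        (k : (Fin d × Fin s) × (Fin (s + 1) →₀ ℕ)) =>
      aeval (fun x : Fin m × ChartIdx d s => w x.1 x.2)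
        (hessFamily (fun x y => mulHessian (chartVec fun l =>
          (X (j, l) : MvPolynomial (Fin m × ChartIdx d s) ℂ)) (Pi.single x 1) (Pi.single y 1))
          (fun x : Fin m × ChartIdx d s => chartTangent (fun l =>
            (X (x.1, l) : MvPolynomial (Fin m × ChartIdx d s) ℂ)) x.2) i k)) =
    hessFamily (fun x y => mulHessian (chartVec (w j)) (Pi.single x 1) (Pi.single y 1))
      fun x : Fin m × ChartIdx d s => chartTangent (w x.1) x.2 := by
  ext i k
  set φ := (aeval fun x : Fin m × ChartIdx d s => w x.1 x.2 :
    MvPolynomial (Fin m × ChartIdx d s) ℂ →ₐ[ℂ] K).toRingHom with hφ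
  have hX : ∀ x, φ (X x) = w x.1 x.2 := fun x => by simp [hφ]
  refine (map_hessFamily φ _ _ i k).trans ?_
  congr 1
  · ext1 x
    ext1 y
    rw [map_mulHessian, map_single_one, map_single_one]
    congr 3
    ext1 i
    rw [map_chartVec]
    simp only [hX]
  · ext1 x
    rw [map_chartTangent]
    simp only [hX]

theorem linearIndependent_tangents (hs : 2 ≤ s) (hd : 3 ≤ d)
    (hm : (d * s + 1) * (m + 1 + (d * s + 1)) ≤ Nat.choose (s + d) d)
    (w : Fin m → ChartIdx d s → K)
    (hw : AlgebraicIndependent ℂ fun x : Fin m × ChartIdx d s => w x.1 x.2) :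
    LinearIndependent K fun x : Fin m × ChartIdx d s => chartTangent (w x.1) x.2 := by
  obtain ⟨z, hz⟩ := exists_isSymmetricGeneric (Option ℕ) d s
  let e : Fin m ↪ Option ℕ := ⟨fun j => some j, fun a b h => Fin.ext (Option.some.inj h)⟩
  have hli : LinearIndependent (FractionRing (MvPolynomial (Option ℕ × ChartIdx d s) ℂ))
      fun x : Fin m × ChartIdx d s => chartTangent (z (e x.1)) x.2 := by
    rw [linearIndependent_iff_card_eq_finrank_span, Set.finrank, span_tangents_eq _ z e rfl,
      hz.finrank_sup hs hd hm _ (by simp; omega)]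
    simp [mul_comm]
  have hz' : AlgebraicIndependent ℂ fun x : Fin m × ChartIdx d s => z (e x.1) x.2 :=
    hz.algebraicIndependent.comp (fun x : Fin m × ChartIdx d s => (e x.1, x.2)) fun a b h => by
      obtain ⟨h1, h2⟩ := Prod.mk.inj h
      exact Prod.ext (e.injective h1) h2
  have := LinearIndependent.aeval_transfer hz' hw (fun (x : Fin m × ChartIdx d s) α => coeff α
    (chartTangent (fun l => (X (x.1, l) : MvPolynomial (Fin m × ChartIdx d s) ℂ)) x.2)) (by
      rw [aeval_coeff_chartTangent (fun j => z (e j)), linearIndependent_coeff_iff]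
      exact hli)
  rwa [aeval_coeff_chartTangent, linearIndependent_coeff_iff] at this

theorem bilinKer_tangents_transfer {L : Type*} [Field L] [Algebra ℂ L] (hs : 2 ≤ s) (hd : 3 ≤ d)
    (hm : (d * s + 1) * (m + 1 + (d * s + 1)) ≤ Nat.choose (s + d) d)
    (v : Fin m → ChartIdx d s → L)
    (hv : AlgebraicIndependent ℂ fun x : Fin m × ChartIdx d s => v x.1 x.2)
    (w : Fin m → ChartIdx d s → K)
    (hw : AlgebraicIndependent ℂ fun x : Fin m × ChartIdx d s => w x.1 x.2) (j : Fin m)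
    (h : bilinKer (mulHessian (chartVec (v j)))
      (Submodule.span L (Set.range fun x : Fin m × ChartIdx d s => chartTangent (v x.1) x.2)) =
        ⊥) :
    bilinKer (mulHessian (chartVec (w j)))
      (Submodule.span K (Set.range fun x : Fin m × ChartIdx d s => chartTangent (w x.1) x.2)) =
        ⊥ := by
  rw [← linearIndependent_hessFamily_iff _ _ (linearIndependent_tangents hs hd hm _ hv),
    ← aeval_hessFamily_mulHessian v] at h
  have h' := LinearIndependent.aeval_transfer hv hw _ h
  rwa [aeval_hessFamily_mulHessian,
    linearIndependent_hessFamily_iff _ _ (linearIndependent_tangents hs hd hm _ hw)] at h'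

theorem bilinKer_tangents_eq_bot (hs : 2 ≤ s) (hd : 3 ≤ d)
    (hm : (d * s + 1) * (m + 1 + (d * s + 1)) ≤ Nat.choose (s + d) d)
    (w : Fin m → ChartIdx d s → K)
    (hw : AlgebraicIndependent ℂ fun x : Fin m × ChartIdx d s => w x.1 x.2) (j : Fin m) :
    bilinKer (mulHessian (chartVec (w j)))
      (Submodule.span K (Set.range fun x : Fin m × ChartIdx d s => chartTangent (w x.1) x.2)) =
        ⊥ := by
  obtain ⟨z, hz⟩ := exists_isSymmetricGeneric (Option ℕ) d s
  let e : Fin m ↪ Option ℕ := ⟨fun i => if i = j then none else some i, fun a b h => by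
    by_cases ha : a = j <;> by_cases hb : b = j
    · rw [ha, hb]
    · simp [ha, hb] at h
    · simp [ha, hb] at h
    · simpa [ha, hb, Fin.ext_iff] using h⟩
  have hej : e j = none := if_pos rfl
  have hz' : AlgebraicIndependent ℂ fun x : Fin m × ChartIdx d s => z (e x.1) x.2 :=
    hz.algebraicIndependent.comp (fun x : Fin m × ChartIdx d s => (e x.1, x.2)) fun a b h => by
      obtain ⟨h1, h2⟩ := Prod.mk.inj h
      exact Prod.ext (e.injective h1) h2
  have hS : (Finset.eraseNone (Finset.univ.map e)).insertNone = Finset.univ.map e := by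
    rw [Finset.insertNone_eraseNone]
    exact Finset.insert_eq_of_mem (Finset.mem_map.2 ⟨j, Finset.mem_univ j, hej⟩)
  have hker := hz.bilinKer_eq_bot hs hd hm (Finset.eraseNone (Finset.univ.map e)) (by
    have := congrArg Finset.card hS
    rw [Finset.card_insertNone, Finset.card_map, Finset.card_univ, Fintype.card_fin] at this
    omega)
  rw [hS, ← span_tangents_eq _ z e rfl, ← hej] at hker
  exact bilinKer_tangents_transfer hs hd hm (fun i => z (e i)) hz' w hw j hker

end Transfer

/-! ### Derivations of products of linear forms -/

section DerivProd
variable {K : Type*} [Field K] [Algebra ℂ K] {n d s m : ℕ} (D : Derivation ℂ K K)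

theorem Derivation.coeffwise_prod_linForm (ℓ : Fin d → Fin n → K) :
    D.coeffwise (∏ i, linForm (ℓ i)) = mulTangent ℓ fun i a => D (ℓ i a) := by
  rw [D.coeffwise_prod, mulTangent_apply]
  simp only [D.coeffwise_linForm]

theorem Derivation.apply_chartVec (w : ChartIdx d s → K) (i : Fin d) :
    (fun a => D (chartVec w i a)) = dirVec (fun x => D (w (some x))) i := by
  ext a
  refine Fin.cases ?_ (fun a => ?_) a <;> simp [chartVec, dirVec]

theorem Derivation.coeffwise_chartForm (w : ChartIdx d s → K) :
    D.coeffwise (chartForm w) = ∑ l, D (w l) • chartTangent w l := by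
  rw [sum_smul_chartTangent, chartForm, D.coeffwise_smul, D.coeffwise_prod_linForm]
  rw [add_comm (D (w none) • _),
    show (fun i a => D (chartVec w i a)) = dirVec fun x => D (w (some x)) from
    funext fun i => D.apply_chartVec w i]

theorem Derivation.coeffwise_mulTangent_dirVec (w : ChartIdx d s → K) (v : Fin d × Fin s → K) :
    D.coeffwise (mulTangent (chartVec w) (dirVec v)) =
      mulTangent (chartVec w) (fun i a => D (dirVec v i a)) +
        mulHessian (chartVec w) v fun x => D (w (some x)) := by
  rw [mulTangent_apply, mulTangent_apply, mulHessian_apply, map_sum, ← Finset.sum_add_distrib]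
  refine Finset.sum_congr rfl fun i _ => ?_
  rw [D.coeffwise_mul, add_comm (linForm (dirVec v i) * _), D.coeffwise_linForm, D.coeffwise_prod,
    Finset.mul_sum]
  congr 1
  refine Finset.sum_congr rfl fun j _ => ?_
  rw [D.coeffwise_linForm, D.apply_chartVec, mul_assoc]

theorem exists_chartForm_of_ne_zero (ℓ : Fin d → Fin (s + 1) → K) (h0 : ∀ i, ℓ i 0 ≠ 0) :
    ∃ w : ChartIdx d s → K, w none ≠ 0 ∧ ∏ i, linForm (ℓ i) = chartForm w := by
  refine ⟨fun l => l.elim (∏ i, ℓ i 0) fun x => ℓ x.1 x.2.succ / ℓ x.1 0, ?_, ?_⟩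
  · exact Finset.prod_ne_zero_iff.2 fun i _ => h0 i
  · rw [chartForm]
    have : ∀ i, linForm (ℓ i) = ℓ i 0 • linForm (chartVec (fun l : ChartIdx d s =>
        l.elim (∏ i, ℓ i 0) fun x => ℓ x.1 x.2.succ / ℓ x.1 0) i) := by
      intro i
      rw [← map_smul]
      congr 1
      ext a
      refine Fin.cases ?_ (fun a => ?_) a
      · simp [chartVec]
      · simp [chartVec, mul_div_cancel₀ _ (h0 i)]
    simp_rw [this, Finset.prod_smul]
    rfl

theorem exists_chartForm_or_small_span (ℓ : Fin d → Fin (s + 1) → K) :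
    (∃ w : ChartIdx d s → K, w none ≠ 0 ∧ ∏ i, linForm (ℓ i) = chartForm w) ∨
    ∃ W : Submodule K (MvPolynomial (Fin (s + 1)) K), FiniteDimensional K W ∧
      Module.finrank K W ≤ d * s ∧
      ∀ D : Derivation ℂ K K, D.coeffwise (∏ i, linForm (ℓ i)) ∈ W := by
  classical
  by_cases h0 : ∀ i, ℓ i 0 ≠ 0
  · exact Or.inl (exists_chartForm_of_ne_zero ℓ h0)
  right
  push Not at h0
  obtain ⟨j, hj⟩ := h0
  by_cases hz : ∃ i, ℓ i = 0
  · obtain ⟨i, hi⟩ := hz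
    refine ⟨⊥, inferInstance, by simp, fun D => ?_⟩
    rw [Finset.prod_eq_zero (Finset.mem_univ i) (by rw [hi, map_zero]), map_zero]
    exact Submodule.zero_mem _
  push Not at hz
  choose p hp using fun i => Function.ne_iff.1 (hz i)
  have hpj : p j ≠ 0 := fun h => hp j (by rw [h, hj]; rfl)
  set u : Fin d → Fin (s + 1) → K := fun i => (ℓ i (p i))⁻¹ • ℓ i with hu
  have hup : ∀ i, u i (p i) = 1 := fun i => inv_mul_cancel₀ (hp i)
  have huj : u j 0 = 0 := by simp [hu, hj]
  have hprod : ∏ i, linForm (ℓ i) = (∏ i, ℓ i (p i)) • ∏ i, linForm (u i) := by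
    rw [← Finset.prod_smul]
    refine Finset.prod_congr rfl fun i _ => ?_
    rw [← map_smul, hu]
    simp only [smul_inv_smul₀ (hp i)]
  let F : Finset (Fin d × Fin (s + 1)) :=
    (Finset.univ \ Finset.univ.image fun i => (i, p i)).erase (j, 0)
  have hF : F.card + 1 = d * s := by
    rw [Finset.card_erase_add_one, Finset.card_sdiff_of_subset (Finset.subset_univ _),
      Finset.card_image_of_injective _ (fun a b h => (Prod.mk.inj h).1)]
    · simp [mul_add]
    · simp only [Finset.mem_sdiff, Finset.mem_univ, Finset.mem_image, true_and, not_exists]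
      intro i hi
      obtain ⟨rfl, h⟩ := Prod.mk.inj hi
      exact hpj h
  let g : Option F → MvPolynomial (Fin (s + 1)) K := fun o => o.elim (∏ i, linForm (u i))
    fun x => mulTangent u (Pi.single x.1.1 (Pi.single x.1.2 1))
  refine ⟨Submodule.span K (Set.range g), FiniteDimensional.span_of_finite K (Set.finite_range g),
    ?_, fun D => ?_⟩
  · refine (finrank_range_le_card g).trans ?_
    simp [hF]
  · rw [hprod, D.coeffwise_smul, D.coeffwise_prod_linForm]
    refine Submodule.add_mem _ (Submodule.smul_mem _ _ ?_)
      (Submodule.smul_mem _ _ (Submodule.subset_span ⟨none, rfl⟩))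
    have h1 : (fun i a => D (u i a)) = ∑ x : Fin d × Fin (s + 1),
        D (u x.1 x.2) • (Pi.single x.1 (Pi.single x.2 1) : Fin d → Fin (s + 1) → K) := by
      ext i a
      rw [Fintype.sum_prod_type, Finset.sum_apply, Finset.sum_apply,
        Finset.sum_eq_single i _ (by simp)]
      · rw [Finset.sum_apply, Finset.sum_apply, Finset.sum_eq_single a _ (by simp)]
        · simp
        · intro b _ hb
          simp [hb.symm]
      · intro b _ hb
        simp [Finset.sum_apply, hb.symm]
    rw [h1, map_sum]
    refine Submodule.sum_mem _ fun x _ => ?_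
    rw [map_smul]
    by_cases hx : x ∈ F
    · exact Submodule.smul_mem _ _ (Submodule.subset_span ⟨some ⟨x, hx⟩, rfl⟩)
    · have : D (u x.1 x.2) = 0 := by
        simp only [F, Finset.mem_erase, Finset.mem_sdiff, Finset.mem_univ, Finset.mem_image,
          true_and, not_and, not_not] at hx
        by_cases hx0 : x = (j, 0)
        · rw [hx0, huj, map_zero]
        · obtain ⟨i, rfl⟩ := hx hx0
          simp only [hup, Derivation.map_one_eq_zero]
      rw [this, zero_smul]
      exact Submodule.zero_mem _

end DerivProd

/-! ### Uniqueness of the decomposition of a generic sum -/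

section Generic
variable {K : Type*} [Field K] [Algebra ℂ K] {d s m : ℕ}

/-- The sum of the tangent spaces at several points. -/
def tangentSum (w : Fin m → ChartIdx d s → K) : Submodule K (MvPolynomial (Fin (s + 1)) K) :=
  Submodule.span K (Set.range fun x : Fin m × ChartIdx d s => chartTangent (w x.1) x.2)

instance (w : Fin m → ChartIdx d s → K) : FiniteDimensional K (tangentSum w) :=
  FiniteDimensional.span_of_finite K (Set.finite_range _)

theorem chartTangent_mem_tangentSum (w : Fin m → ChartIdx d s → K) (j : Fin m)
    (l : ChartIdx d s) : chartTangent (w j) l ∈ tangentSum w :=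
  Submodule.subset_span ⟨(j, l), rfl⟩

theorem chartTangentSpace_le_tangentSum (w : Fin m → ChartIdx d s → K) (j : Fin m) :
    chartTangentSpace (w j) ≤ tangentSum w := by
  refine Submodule.span_le.2 ?_
  rintro _ ⟨l, rfl⟩
  exact chartTangent_mem_tangentSum w j l

theorem card_chartIdx (d s : ℕ) : Fintype.card (ChartIdx d s) = d * s + 1 := by
  simp [ChartIdx]

theorem finrank_tangentSum_le (w : Fin m → ChartIdx d s → K) :
    Module.finrank K (tangentSum w) ≤ m * (d * s + 1) := by
  refine (finrank_range_le_card _).trans ?_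
  rw [Fintype.card_prod, card_chartIdx, Fintype.card_fin]

theorem Derivation.coeffwise_sum_chartForm (D : Derivation ℂ K K) (w : Fin m → ChartIdx d s → K) :
    D.coeffwise (∑ j, chartForm (w j)) =
      ∑ x : Fin m × ChartIdx d s, D (w x.1 x.2) • chartTangent (w x.1) x.2 := by
  rw [map_sum, Fintype.sum_prod_type]
  exact Finset.sum_congr rfl fun j _ => D.coeffwise_chartForm (w j)

theorem exists_derivation_of_mem_tangentSum (z : Fin m → ChartIdx d s → K)
    (hz : AlgebraicIndependent ℂ fun x : Fin m × ChartIdx d s => z x.1 x.2)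
    {f : MvPolynomial (Fin (s + 1)) K} (hf : f ∈ tangentSum z) :
    ∃ D : Derivation ℂ K K, D.coeffwise (∑ j, chartForm (z j)) = f := by
  obtain ⟨c, rfl⟩ := (Submodule.mem_span_range_iff_exists_fun K).1 hf
  obtain ⟨D, hD⟩ := hz.exists_derivation c
  refine ⟨D, ?_⟩
  rw [D.coeffwise_sum_chartForm]
  exact Finset.sum_congr rfl fun x _ => by rw [hD x]

theorem finrank_tangentSum (hs : 2 ≤ s) (hd : 3 ≤ d)
    (hm : (d * s + 1) * (m + 1 + (d * s + 1)) ≤ Nat.choose (s + d) d)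
    (z : Fin m → ChartIdx d s → K)
    (hz : AlgebraicIndependent ℂ fun x : Fin m × ChartIdx d s => z x.1 x.2) :
    Module.finrank K (tangentSum z) = m * (d * s + 1) := by
  rw [tangentSum, finrank_span_eq_card (linearIndependent_tangents hs hd hm z hz),
    Fintype.card_prod, card_chartIdx, Fintype.card_fin]

theorem finrank_finset_sup_le {P ι : Type*} [AddCommGroup P] [Module K P] [DecidableEq ι]
    (W : ι → Submodule K P) [∀ i, FiniteDimensional K (W i)] (S : Finset ι) :
    Module.finrank K ↥(S.sup W) ≤ ∑ i ∈ S, Module.finrank K (W i) := by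
  induction S using Finset.induction_on with
  | empty => simp
  | insert i S hi ih =>
    rw [Finset.sup_insert, Finset.sum_insert hi]
    exact (Submodule.finrank_add_le_finrank_add_finrank _ _).trans (by omega)

/-- Every decomposition of a generic sum lies in the chart. -/
theorem exists_chartForm_of_sum_eq (hs : 2 ≤ s) (hd : 3 ≤ d)
    (hm : (d * s + 1) * (m + 1 + (d * s + 1)) ≤ Nat.choose (s + d) d)
    (z : Fin m → ChartIdx d s → K)
    (hz : AlgebraicIndependent ℂ fun x : Fin m × ChartIdx d s => z x.1 x.2)
    (ℓ : Fin m → Fin d → Fin (s + 1) → K)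
    (h : ∑ j, ∏ i, linForm (ℓ j i) = ∑ j, chartForm (z j)) :
    ∃ w : Fin m → ChartIdx d s → K, ∀ j, w j none ≠ 0 ∧ ∏ i, linForm (ℓ j i) = chartForm (w j) := by
  classical
  have key : ∀ j, ∃ W : Submodule K (MvPolynomial (Fin (s + 1)) K), FiniteDimensional K W ∧
      Module.finrank K W ≤ d * s + 1 ∧
      ((¬ ∃ w : ChartIdx d s → K, w none ≠ 0 ∧ ∏ i, linForm (ℓ j i) = chartForm w) →
        Module.finrank K W ≤ d * s) ∧
      ∀ D : Derivation ℂ K K, D.coeffwise (∏ i, linForm (ℓ j i)) ∈ W := by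
    intro j
    rcases exists_chartForm_or_small_span (ℓ j) with hw | ⟨W, h1, h2, h3⟩
    · obtain ⟨w, -, hw2⟩ := id hw
      refine ⟨chartTangentSpace w, inferInstance, ?_, fun h => absurd hw h, fun D => ?_⟩
      · exact (finrank_range_le_card _).trans (card_chartIdx d s).le
      · rw [hw2, D.coeffwise_chartForm]
        exact Submodule.sum_mem _ fun l _ => Submodule.smul_mem _ _ (Submodule.subset_span ⟨l, rfl⟩)
    · exact ⟨W, h1, h2.trans (Nat.le_succ _), fun _ => h2, h3⟩
  choose W hfin hle hlt hD using key
  suffices ∀ j, ∃ w : ChartIdx d s → K, w none ≠ 0 ∧ ∏ i, linForm (ℓ j i) = chartForm w by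
    choose w hw using this
    exact ⟨w, hw⟩
  by_contra! hcon
  obtain ⟨j, hj⟩ := hcon
  have hsub : tangentSum z ≤ Finset.univ.sup W := by
    intro f hf
    obtain ⟨D, rfl⟩ := exists_derivation_of_mem_tangentSum z hz hf
    rw [← h, map_sum]
    exact Submodule.sum_mem _ fun i _ => Finset.le_sup (f := W) (Finset.mem_univ i) (hD i D)
  have h1 := (Submodule.finrank_mono hsub).trans (finrank_finset_sup_le W Finset.univ)
  rw [finrank_tangentSum hs hd hm z hz] at h1
  have h2 : ∑ i, Module.finrank K (W i) < ∑ _i : Fin m, (d * s + 1) :=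
    Finset.sum_lt_sum (fun i _ => hle i)
      ⟨j, Finset.mem_univ j, Nat.lt_succ_of_le (hlt j fun ⟨w, hw⟩ => hj w hw.1 hw.2)⟩
  simp only [Finset.sum_const, Finset.card_univ, Fintype.card_fin, smul_eq_mul] at h2
  omega

theorem tangentSum_eq_of_sum_eq (hs : 2 ≤ s) (hd : 3 ≤ d)
    (hm : (d * s + 1) * (m + 1 + (d * s + 1)) ≤ Nat.choose (s + d) d)
    (z w : Fin m → ChartIdx d s → K)
    (hz : AlgebraicIndependent ℂ fun x : Fin m × ChartIdx d s => z x.1 x.2)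
    (h : ∑ j, chartForm (w j) = ∑ j, chartForm (z j)) :
    tangentSum w = tangentSum z ∧
      AlgebraicIndependent ℂ fun x : Fin m × ChartIdx d s => w x.1 x.2 := by
  have hle : tangentSum z ≤ tangentSum w := by
    intro f hf
    obtain ⟨D, rfl⟩ := exists_derivation_of_mem_tangentSum z hz hf
    rw [← h, D.coeffwise_sum_chartForm]
    exact Submodule.sum_mem _ fun x _ => Submodule.smul_mem _ _
      (chartTangent_mem_tangentSum w x.1 x.2)
  have hrank := finrank_tangentSum hs hd hm z hz
  have heq : tangentSum z = tangentSum w :=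
    Submodule.eq_of_le_of_finrank_le hle (hrank ▸ finrank_tangentSum_le w)
  have hli : LinearIndependent K
      fun x : Fin m × ChartIdx d s => chartTangent (w x.1) x.2 := by
    rw [linearIndependent_iff_card_eq_finrank_span, Set.finrank]
    change _ = Module.finrank K (tangentSum w)
    rw [← heq, hrank, Fintype.card_prod, card_chartIdx, Fintype.card_fin]
  refine ⟨heq.symm, algebraicIndependent_of_derivations _ fun v => ?_⟩
  have hf : ∑ x : Fin m × ChartIdx d s, v x • chartTangent (w x.1) x.2 ∈ tangentSum z := by
    rw [heq]
    exact Submodule.sum_mem _ fun x _ => Submodule.smul_mem _ _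
      (chartTangent_mem_tangentSum w x.1 x.2)
  obtain ⟨D, hD⟩ := exists_derivation_of_mem_tangentSum z hz hf
  refine ⟨D, fun x => ?_⟩
  rw [← h, D.coeffwise_sum_chartForm, ← sub_eq_zero, ← Finset.sum_sub_distrib] at hD
  simp only [← sub_smul] at hD
  exact sub_eq_zero.1 (Fintype.linearIndependent_iff.1 hli _ hD x)

/-- A derivation which preserves the sum of the tangent spaces fixes the linear factors. -/
theorem derivation_apply_eq_zero_of_preserves (hs : 2 ≤ s) (hd : 3 ≤ d)
    (hm : (d * s + 1) * (m + 1 + (d * s + 1)) ≤ Nat.choose (s + d) d)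
    (w : Fin m → ChartIdx d s → K)
    (hw : AlgebraicIndependent ℂ fun x : Fin m × ChartIdx d s => w x.1 x.2)
    (D : Derivation ℂ K K) (hD : ∀ f ∈ tangentSum w, D.coeffwise f ∈ tangentSum w)
    (j : Fin m) (x : Fin d × Fin s) : D (w j (some x)) = 0 := by
  have : NeZero d := ⟨by omega⟩
  have hne : w j none ≠ 0 := hw.ne_zero (j, none)
  have hrange : ∀ g, mulTangent (chartVec (w j)) g ∈ tangentSum w := fun g => by
    apply chartTangentSpace_le_tangentSum w j
    rw [chartTangentSpace, span_chartTangent _ hne]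
    exact ⟨g, rfl⟩
  have hker : (fun x => D (w j (some x))) ∈ bilinKer (mulHessian (chartVec (w j)))
      (tangentSum w) := by
    intro v
    have h1 := hD _ (hrange (dirVec v))
    rw [D.coeffwise_mulTangent_dirVec, Submodule.add_mem_iff_right _ (hrange _),
      mulHessian_comm] at h1
    exact h1
  rw [tangentSum, bilinKer_tangents_eq_bot hs hd hm w hw j, Submodule.mem_bot] at hker
  exact congrFun hker x

end Generic

section GenericUniqueness
variable {K : Type*} [Field K] [Algebra ℂ K] {d s m : ℕ}

theorem linearIndependent_chartForm (hs : 2 ≤ s) (hd : 3 ≤ d)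
    (hm : (d * s + 1) * (m + 1 + (d * s + 1)) ≤ Nat.choose (s + d) d)
    (z : Fin m → ChartIdx d s → K)
    (hz : AlgebraicIndependent ℂ fun x : Fin m × ChartIdx d s => z x.1 x.2) :
    LinearIndependent K fun j => chartForm (z j) := by
  have h := (linearIndependent_tangents hs hd hm z hz).comp (fun j : Fin m => (j, none))
    fun a b h => (Prod.mk.inj h).1
  exact h.units_smul fun j => Units.mk0 (z j none) (hz.ne_zero (j, none))

/-- The derivation scaling one summand preserves the sum of the tangent spaces. -/
theorem exists_derivation_scaling [NeZero d] (z : Fin m → ChartIdx d s → K)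
    (hz : AlgebraicIndependent ℂ fun x : Fin m × ChartIdx d s => z x.1 x.2) (k : Fin m) :
    ∃ D : Derivation ℂ K K, (∀ f ∈ tangentSum z, D.coeffwise f ∈ tangentSum z) ∧
      D.coeffwise (∑ j, chartForm (z j)) = chartForm (z k) := by
  classical
  obtain ⟨D, hD⟩ := hz.exists_derivation fun x => if x = (k, none) then z k none else 0
  have hDz : ∀ j x, D (z j (some x)) = 0 := fun j x => by
    rw [hD (j, some x), if_neg (by simp)]
  refine ⟨D, fun f hf => ?_, ?_⟩
  · have hsup : tangentSum z = Finset.univ.sup fun j => chartTangentSpace (z j) :=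
      span_tangents_eq _ z (Function.Embedding.refl _) (by simp)
    rw [hsup] at hf ⊢
    refine mem_finset_sup_of_preserves _ D.coeffwise _ (fun j _ f hf => ?_) f hf
    have hne : z j none ≠ 0 := hz.ne_zero (j, none)
    rw [chartTangentSpace, span_chartTangent _ hne] at hf ⊢
    refine leibniz_preserves_range _ _ D.coeffwise_mul (fun c => ⟨_, D.coeffwise_linForm c⟩)
      (fun i => ⟨0, ?_⟩) f hf
    rw [D.coeffwise_linForm, D.apply_chartVec, zero_smul]
    simp only [hDz]
    rw [show dirVec (fun _ : Fin d × Fin s => (0 : K)) i = 0 by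
      ext a; refine Fin.cases ?_ (fun a => ?_) a <;> simp [dirVec], map_zero]
  · rw [D.coeffwise_sum_chartForm, Finset.sum_eq_single (k, none) _ (by simp)]
    · rw [hD, if_pos rfl]
      rfl
    · intro x _ hx
      rw [hD, if_neg hx, zero_smul]

theorem Derivation.coeffwise_chartForm_of_apply_eq_zero (D : Derivation ℂ K K)
    (w : ChartIdx d s → K) (hne : w none ≠ 0) (h : ∀ x, D (w (some x)) = 0) :
    D.coeffwise (chartForm w) = (D (w none) / w none) • chartForm w := by
  rw [D.coeffwise_chartForm, Fintype.sum_option, chartForm, smul_smul, div_mul_cancel₀ _ hne]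
  simp only [h, zero_smul, Finset.sum_const_zero, add_zero]
  rfl

theorem chartForm_mem_span_of_sum_eq (hs : 2 ≤ s) (hd : 3 ≤ d)
    (hm : (d * s + 1) * (m + 1 + (d * s + 1)) ≤ Nat.choose (s + d) d)
    (z w : Fin m → ChartIdx d s → K)
    (hz : AlgebraicIndependent ℂ fun x : Fin m × ChartIdx d s => z x.1 x.2)
    (h : ∑ j, chartForm (w j) = ∑ j, chartForm (z j)) (k : Fin m) :
    chartForm (z k) ∈ Submodule.span K (Set.range fun j => chartForm (w j)) := by
  have : NeZero d := ⟨by omega⟩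
  obtain ⟨heq, hw⟩ := tangentSum_eq_of_sum_eq hs hd hm z w hz h
  obtain ⟨D, hD, hD'⟩ := exists_derivation_scaling z hz k
  rw [← heq] at hD
  rw [← hD', ← h, map_sum]
  refine Submodule.sum_mem _ fun j _ => ?_
  rw [D.coeffwise_chartForm_of_apply_eq_zero (w j) (hw.ne_zero (j, none))
    (derivation_apply_eq_zero_of_preserves hs hd hm w hw D hD j)]
  exact Submodule.smul_mem _ _ (Submodule.subset_span ⟨j, rfl⟩)

/-- A product of linear forms in the span of the generic summands is proportional to one of
them. -/
theorem eq_of_coefficients_ne_zero (hs : 2 ≤ s) (hd : 3 ≤ d)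
    (hm : (d * s + 1) * (m + 1 + (d * s + 1)) ≤ Nat.choose (s + d) d)
    (z : Fin m → ChartIdx d s → K)
    (hz : AlgebraicIndependent ℂ fun x : Fin m × ChartIdx d s => z x.1 x.2)
    (w : ChartIdx d s → K) (a : Fin m → K) (h : chartForm w = ∑ i, a i • chartForm (z i))
    (i i' : Fin m) (hi : a i ≠ 0) (hi' : a i' ≠ 0) : i = i' := by
  classical
  by_contra hne
  have hli := linearIndependent_tangents hs hd hm z hz
  choose D hD using fun x : Fin m × ChartIdx d s => hz.exists_derivation (Pi.single x 1)
  let I := {i : Fin m // a i ≠ 0} × (Fin d × Fin s)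
  let f : I → MvPolynomial (Fin (s + 1)) K := fun x => (D (x.1, some x.2)).coeffwise (chartForm w)
  have hf : ∀ x : I, f x = a x.1 • chartTangent (z x.1) (some x.2) +
      ∑ k, D (x.1, some x.2) (a k) • chartForm (z k) := by
    intro x
    have h1 : ∀ k, (D (x.1, some x.2)).coeffwise (chartForm (z k)) =
        if k = x.1 then chartTangent (z x.1) (some x.2) else 0 := by
      intro k
      rw [Derivation.coeffwise_chartForm]
      have h2 : ∀ l, D (x.1, some x.2) (z k l) =
          (Pi.single ((x.1 : Fin m), some x.2) 1 : Fin m × ChartIdx d s → K) (k, l) :=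
        fun l => hD _ (k, l)
      simp only [h2]
      split_ifs with hk
      · subst hk
        rw [Finset.sum_eq_single (some x.2) _ (by simp)]
        · simp
        · intro l _ hl
          rw [Pi.single_eq_of_ne (by simpa using hl), zero_smul]
      · refine Finset.sum_eq_zero fun l _ => ?_
        rw [Pi.single_eq_of_ne (fun h => hk (Prod.mk.inj h).1), zero_smul]
    simp only [f, h, map_sum, Derivation.coeffwise_smul, Finset.sum_add_distrib, h1, smul_ite,
      smul_zero, Finset.sum_ite_eq', Finset.mem_univ, if_true]
  have hind : LinearIndependent K f := by
    rw [Fintype.linearIndependent_iff]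
    intro c hc x
    let φ := (Module.Basis.sumExtend hli).coord (Sum.inl ((x.1 : Fin m), some x.2))
    have hφ : ∀ k l, φ (chartTangent (z k) l) = if k = x.1 ∧ l = some x.2 then 1 else 0 := by
      intro k l
      have h1 : chartTangent (z k) l = Module.Basis.sumExtend hli (Sum.inl (k, l)) := by
        simp [Module.Basis.sumExtend]
        rfl
      rw [h1]
      simp [φ, Module.Basis.coord_apply, Finsupp.single_apply, Prod.ext_iff]
    have hφ0 : ∀ k, φ (chartForm (z k)) = 0 := by
      intro k
      rw [show chartForm (z k) = z k none • chartTangent (z k) none from rfl, map_smul, hφ]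
      simp
    have h2 := congrArg φ hc
    rw [map_sum, map_zero, Finset.sum_eq_single x _ (by simp)] at h2
    · rw [map_smul, hf, map_add, map_smul, hφ, map_sum] at h2
      simpa [hφ0, x.1.2] using h2
    · intro y _ hy
      rw [map_smul, hf, map_add, map_smul, hφ, map_sum, if_neg]
      · simp [hφ0]
      · rintro ⟨h3, h4⟩
        exact hy (Prod.ext (Subtype.ext h3) (Option.some.inj h4))
  have hmem : Submodule.span K (Set.range f) ≤ chartTangentSpace w := by
    refine Submodule.span_le.2 ?_
    rintro _ ⟨x, rfl⟩
    simp only [f, Derivation.coeffwise_chartForm]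
    exact Submodule.sum_mem _ fun l _ => Submodule.smul_mem _ _ (Submodule.subset_span ⟨l, rfl⟩)
  have h1 := Submodule.finrank_mono hmem
  rw [finrank_span_eq_card hind] at h1
  have h2 : Module.finrank K (chartTangentSpace w) ≤ d * s + 1 :=
    (finrank_range_le_card _).trans (card_chartIdx d s).le
  have h3 : 2 ≤ Fintype.card {i : Fin m // a i ≠ 0} :=
    Fintype.one_lt_card_iff.2 ⟨⟨i, hi⟩, ⟨i', hi'⟩, fun h => hne (Subtype.ext_iff.1 h)⟩
  rw [Fintype.card_prod, Fintype.card_prod, Fintype.card_fin, Fintype.card_fin] at h1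
  have h4 : 3 * 2 ≤ d * s := Nat.mul_le_mul hd hs
  have h5 := Nat.mul_le_mul_right (d * s) h3
  omega

/-- A sum of products of linear forms at an algebraically independent point has a unique
decomposition. -/
theorem exists_perm_of_sum_eq (hs : 2 ≤ s) (hd : 3 ≤ d)
    (hm : (d * s + 1) * (m + 1 + (d * s + 1)) ≤ Nat.choose (s + d) d)
    (z : Fin m → ChartIdx d s → K)
    (hz : AlgebraicIndependent ℂ fun x : Fin m × ChartIdx d s => z x.1 x.2)
    (ℓ : Fin m → Fin d → Fin (s + 1) → K)
    (h : ∑ j, ∏ i, linForm (ℓ j i) = ∑ j, chartForm (z j)) :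
    ∃ e : Equiv.Perm (Fin m), ∀ j, ∏ i, linForm (ℓ j i) = chartForm (z (e j)) := by
  obtain ⟨w, hw⟩ := exists_chartForm_of_sum_eq hs hd hm z hz ℓ h
  simp only [fun j => (hw j).2] at h ⊢
  obtain ⟨-, hwi⟩ := tangentSum_eq_of_sum_eq hs hd hm z w hz h
  have hliz := linearIndependent_chartForm hs hd hm z hz
  have hliw := linearIndependent_chartForm hs hd hm w hwi
  have hspan : Submodule.span K (Set.range fun j => chartForm (z j)) =
      Submodule.span K (Set.range fun j => chartForm (w j)) := by
    have : FiniteDimensional K (Submodule.span K (Set.range fun j => chartForm (w j))) :=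
      FiniteDimensional.span_of_finite K (Set.finite_range _)
    refine Submodule.eq_of_le_of_finrank_le (Submodule.span_le.2 ?_) ?_
    · rintro _ ⟨k, rfl⟩
      exact chartForm_mem_span_of_sum_eq hs hd hm z w hz h k
    · rw [finrank_span_eq_card hliz, finrank_span_eq_card hliw]
  have hprop : ∀ j, ∃ (i : Fin m) (c : K), chartForm (w j) = c • chartForm (z i) := by
    intro j
    have hj : chartForm (w j) ∈ Submodule.span K (Set.range fun j => chartForm (z j)) := by
      rw [hspan]
      exact Submodule.subset_span ⟨j, rfl⟩
    obtain ⟨a, ha⟩ := (Submodule.mem_span_range_iff_exists_fun K).1 hj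
    obtain ⟨i, hi⟩ : ∃ i, a i ≠ 0 := by
      by_contra! h0
      refine hliw.ne_zero j ?_
      simp [← ha, h0]
    refine ⟨i, a i, ?_⟩
    rw [← ha, Finset.sum_eq_single i _ (by simp)]
    intro k _ hk
    have : a k = 0 := by
      by_contra hak
      exact hk (eq_of_coefficients_ne_zero hs hd hm z hz (w j) a ha.symm k i hak hi)
    rw [this, zero_smul]
  choose e c hec using hprop
  have hinj : Function.Injective e := by
    intro j j' hjj
    by_contra hne
    have hc : c j' ≠ 0 := fun h0 => hliw.ne_zero j' (by simp [hec j', h0])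
    have h0 := linearIndependent_iff'.1 hliw {j, j'} (fun k => if k = j then c j' else -c j) (by
      rw [Finset.sum_pair hne, if_pos rfl, if_neg (Ne.symm hne), hec j, hec j', hjj, neg_smul,
        smul_smul, smul_smul, mul_comm, add_neg_cancel]) j (by simp)
    exact hc (by simpa using h0)
  let E : Equiv.Perm (Fin m) := Equiv.ofBijective e (Finite.injective_iff_bijective.1 hinj)
  refine ⟨E, fun j => ?_⟩
  have hsum : ∑ j, (c j - 1) • chartForm (z (e j)) = 0 := by
    simp only [sub_smul, one_smul, Finset.sum_sub_distrib, ← hec]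
    rw [h, sub_eq_zero]
    exact (Equiv.sum_comp E fun j => chartForm (z j)).symm
  have := Fintype.linearIndependent_iff.1 (hliz.comp e hinj) _ hsum j
  rw [hec j, sub_eq_zero.1 this, one_smul]
  rfl

end GenericUniqueness

/-! ### Coordinates and the Zariski topology -/

section Coordinates
variable {R : Type*} [CommRing R] {n d : ℕ}

/-- The exponents of total degree `d`. -/
abbrev DegIdx (n d : ℕ) : Type := {α : Fin n →₀ ℕ // α.degree = d}

instance : Finite (DegIdx n d) :=
  Finsupp.finite_of_degree_eq d

/-- The coefficients in degree `d`. -/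
def coords (d : ℕ) (f : MvPolynomial (Fin n) R) (α : DegIdx n d) : R := coeff α.1 f

theorem coords_apply (f : MvPolynomial (Fin n) R) (α : DegIdx n d) : coords d f α = coeff α.1 f :=
  rfl

theorem map_coords {R' : Type*} [CommRing R'] (φ : R →+* R') (f : MvPolynomial (Fin n) R) :
    coords d (MvPolynomial.map φ f) = fun α => φ (coords d f α) := by
  ext α
  simp [coords, coeff_map]

theorem MvPolynomial.IsHomogeneous.ext_coords {f g : MvPolynomial (Fin n) R}
    (hf : f.IsHomogeneous d) (hg : g.IsHomogeneous d) (h : coords d f = coords d g) : f = g := by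
  ext α
  by_cases hα : α.degree = d
  · exact congrFun h ⟨α, hα⟩
  · rw [hf.coeff_eq_zero hα, hg.coeff_eq_zero hα]

theorem MvPolynomial.IsHomogeneous.sum_monomial_coords [Fintype (DegIdx n d)]
    {f : MvPolynomial (Fin n) R} (hf : f.IsHomogeneous d) :
    f = ∑ α : DegIdx n d, monomial α.1 (coords d f α) := by
  classical
  refine hf.ext_coords (IsHomogeneous.sum _ _ _ fun α _ => isHomogeneous_monomial _ α.2) ?_
  ext β
  rw [coords_apply, coords_apply, coeff_sum]
  simp only [coeff_monomial, coords_apply]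
  rw [Finset.sum_eq_single β]
  · simp
  · intro γ _ h
    exact if_neg fun h' => h (Subtype.ext h')
  · simp

end Coordinates

section Zariski
variable {n d : ℕ}

theorem zIsOpenV_eval_ne_zero (g : MvPolynomial (DegIdx n d) ℂ) :
    zIsOpenV {x : homogeneousSubmodule (Fin n) ℂ d |
      eval (coords d (x : MvPolynomial (Fin n) ℂ)) g ≠ 0} := by
  obtain ⟨k, f, -, q, rfl⟩ := exists_fin_rename g
  refine TopologicalSpace.GenerateOpen.basic _ ⟨k, q, fun i =>
    (lcoeff ℂ (f i).1).comp (Submodule.subtype _), ?_⟩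
  ext x
  simp only [eval_rename]
  rfl

theorem exists_eval_of_linear (L : homogeneousSubmodule (Fin n) ℂ d →ₗ[ℂ] ℂ) :
    ∃ g : MvPolynomial (DegIdx n d) ℂ, ∀ x : homogeneousSubmodule (Fin n) ℂ d,
      eval (coords d (x : MvPolynomial (Fin n) ℂ)) g = L x := by
  have : Fintype (DegIdx n d) := Fintype.ofFinite _
  obtain ⟨L', hL'⟩ := L.exists_extend
  refine ⟨∑ α : DegIdx n d, C (L' (monomial α.1 1)) * X α, fun x => ?_⟩
  have hx : (x : MvPolynomial (Fin n) ℂ).IsHomogeneous d := x.2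
  rw [← hL', LinearMap.comp_apply, Submodule.subtype_apply]
  conv_rhs => rw [hx.sum_monomial_coords, map_sum]
  rw [map_sum]
  refine Finset.sum_congr rfl fun α _ => ?_
  rw [eval_mul, eval_C, eval_X, mul_comm, ← smul_eq_mul, ← map_smul, smul_monomial, smul_eq_mul,
    mul_one]

theorem exists_eval_ne_zero_of_mem {U : Set (homogeneousSubmodule (Fin n) ℂ d)}
    (hU : zIsOpenV U) {x : homogeneousSubmodule (Fin n) ℂ d} (hx : x ∈ U) :
    ∃ g : MvPolynomial (DegIdx n d) ℂ, eval (coords d (x : MvPolynomial (Fin n) ℂ)) g ≠ 0 ∧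
      ∀ y : homogeneousSubmodule (Fin n) ℂ d,
        eval (coords d (y : MvPolynomial (Fin n) ℂ)) g ≠ 0 → y ∈ U := by
  induction hU with
  | basic V hV =>
    obtain ⟨k, p, L, rfl⟩ := hV
    choose g hg using fun i => exists_eval_of_linear (L i)
    have key : ∀ y : homogeneousSubmodule (Fin n) ℂ d,
        eval (coords d (y : MvPolynomial (Fin n) ℂ)) (bind₁ g p) = eval (fun i => L i y) p := by
      intro y
      simp only [← hg]
      exact eval₂Hom_bind₁ _ _ _ _
    exact ⟨bind₁ g p, by rw [key]; exact hx, fun y hy => by rw [key] at hy; exact hy⟩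
  | univ => exact ⟨1, by simp, fun _ _ => trivial⟩
  | inter V W _ _ hV hW =>
    obtain ⟨g, hg, hg'⟩ := hV hx.1
    obtain ⟨h, hh, hh'⟩ := hW hx.2
    refine ⟨g * h, by rw [eval_mul]; exact mul_ne_zero hg hh, fun y hy => ?_⟩
    rw [eval_mul] at hy
    exact ⟨hg' y (left_ne_zero_of_mul hy), hh' y (right_ne_zero_of_mul hy)⟩
  | sUnion S _ hS =>
    obtain ⟨V, hV, hxV⟩ := hx
    obtain ⟨g, hg, hg'⟩ := hS V hV hxV
    exact ⟨g, hg, fun y hy => ⟨V, hV, hg' y hy⟩⟩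

theorem mem_zClosureV_iff {S : Set (homogeneousSubmodule (Fin n) ℂ d)}
    {x : homogeneousSubmodule (Fin n) ℂ d} :
    x ∈ zClosureV S ↔ ∀ g : MvPolynomial (DegIdx n d) ℂ,
      (∀ y ∈ S, eval (coords d (y : MvPolynomial (Fin n) ℂ)) g = 0) →
        eval (coords d (x : MvPolynomial (Fin n) ℂ)) g = 0 := by
  let _ := ztV (homogeneousSubmodule (Fin n) ℂ d)
  rw [zClosureV, mem_closure_iff]
  constructor
  · intro h g hg
    by_contra hx
    obtain ⟨y, hy, hyS⟩ := h _ (zIsOpenV_eval_ne_zero g) hx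
    exact hy (hg y hyS)
  · intro h U hU hx
    obtain ⟨g, hg, hg'⟩ := exists_eval_ne_zero_of_mem hU hx
    by_contra hne
    refine hg (h g fun y hy => ?_)
    by_contra hy'
    exact hne ⟨y, hg' y hy', hy⟩

end Zariski

/-! ### The set of products of linear forms is closed -/

section Closed

theorem exists_valuationSubring_of_ker_le {τ F : Type*} [Field F] (φ : MvPolynomial τ ℂ →+* F)
    (x : τ → ℂ) (h : ∀ g, φ g = 0 → eval x g = 0) :
    ∃ (V : ValuationSubring F) (ψ : MvPolynomial τ ℂ →+* V)
      (ι : ℂ →+* IsLocalRing.ResidueField V), (∀ g, (ψ g : F) = φ g) ∧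
      ∀ g, IsLocalRing.residue V (ψ g) = ι (eval x g) := by
  let I : Ideal φ.range := (RingHom.ker (eval x)).map φ.rangeRestrict
  have hI : I ≠ ⊤ := by
    rw [Ne, Ideal.eq_top_iff_one,
      Ideal.mem_map_iff_of_surjective _ φ.rangeRestrict_surjective]
    rintro ⟨g, hg, hg1⟩
    have h1 : φ (g - 1) = 0 := by
      rw [map_sub, map_one, sub_eq_zero]
      exact congrArg Subtype.val hg1
    have h2 := h _ h1
    rw [map_sub, map_one, (RingHom.mem_ker).1 hg] at h2
    simp at h2
  obtain ⟨V, hV, hVI⟩ := Ideal.image_subset_nonunits_valuationSubring I hI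
  let ψ : MvPolynomial τ ℂ →+* V := φ.codRestrict V.toSubring fun g => hV ⟨g, rfl⟩
  refine ⟨V, ψ, ((IsLocalRing.residue V).comp ψ).comp C, fun g => rfl, fun g => ?_⟩
  rw [RingHom.comp_apply, RingHom.comp_apply, ← sub_eq_zero, ← map_sub, ← map_sub,
    IsLocalRing.residue_eq_zero_iff]
  have hmem : φ (g - C (eval x g)) ∈ V.nonunits := by
    refine hVI ⟨φ.rangeRestrict (g - C (eval x g)), ?_, rfl⟩
    exact Ideal.mem_map_of_mem _ (by simp [RingHom.mem_ker])
  exact V.mem_nonunits_iff_exists_mem_maximalIdeal.1 hmem |>.2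

theorem exists_smul_eq_with_unit_coordinate {F : Type*} [Field F] (V : ValuationSubring F) {n : ℕ}
    (c : Fin n → F) (hc : c ≠ 0) :
    ∃ (b : F) (u : Fin n → V), b ≠ 0 ∧ (∀ a, c a = b * u a) ∧ ∃ a, u a = 1 := by
  obtain ⟨a₀, ha₀⟩ := Function.ne_iff.1 hc
  obtain ⟨a, -, ha⟩ := Finset.exists_max_image Finset.univ (fun a => V.valuation (c a))
    ⟨a₀, Finset.mem_univ _⟩
  have hca : c a ≠ 0 := by
    intro h0
    have h1 := ha a₀ (Finset.mem_univ _)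
    rw [h0, map_zero, le_zero_iff, map_eq_zero] at h1
    exact ha₀ h1
  refine ⟨c a, fun x => ⟨c x / c a, ?_⟩, hca, fun x => ?_, a, ?_⟩
  · rw [← V.valuation_le_one_iff, map_div₀]
    exact div_le_one_of_le₀ (ha x (Finset.mem_univ _)) zero_le
  · exact (mul_div_cancel₀ _ hca).symm
  · exact Subtype.ext (div_self hca)

variable {n d : ℕ}

/-- The generic product of linear forms. -/
def genericProd (n d : ℕ) : MvPolynomial (Fin n) (MvPolynomial (Fin d × Fin n) ℂ) :=
  ∏ i, linForm fun a => X (i, a)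

theorem map_genericProd {R : Type*} [CommRing R] (φ : MvPolynomial (Fin d × Fin n) ℂ →+* R) :
    MvPolynomial.map φ (genericProd n d) = ∏ i, linForm fun a => φ (X (i, a)) := by
  simp only [genericProd, map_prod, map_linForm]

/-- A product of linear forms over an extension field is a product of linear forms. -/
theorem exists_prod_linForm_of_extension {κ : Type*} [Field κ] (ι : ℂ →+* κ)
    {f : MvPolynomial (Fin n) ℂ} (ℓ : Fin d → Fin n → κ)
    (h : MvPolynomial.map ι f = ∏ i, linForm (ℓ i)) :
    ∃ c : Fin d → Fin n → ℂ, f = ∏ i, linForm (c i) := by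
  obtain ⟨y, hy⟩ := exists_common_zero_of_extension ι
    (Set.range fun α => coeff α (genericProd n d) - C (coeff α f)) (fun x => ℓ x.1 x.2) (by
      rintro _ ⟨α, rfl⟩
      have h1 := congrArg (coeff α)
        (map_genericProd (eval₂Hom ι fun x : Fin d × Fin n => ℓ x.1 x.2))
      simp only [coeff_map, coe_eval₂Hom, eval₂_X] at h1
      rw [eval₂_sub, eval₂_C, h1, ← coeff_map, h, sub_self])
  refine ⟨fun i a => y (i, a), ?_⟩
  have h2 := map_genericProd (n := n) (d := d) (eval y)
  simp only [eval_X] at h2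
  rw [← h2]
  ext α
  have h3 := hy _ ⟨α, rfl⟩
  rw [map_sub, eval_C, sub_eq_zero] at h3
  rw [coeff_map, h3]

theorem exists_prod_linForm_of_mem_closure [NeZero d] {f : MvPolynomial (Fin n) ℂ}
    (hf : f.IsHomogeneous d)
    (h : ∀ g : MvPolynomial (DegIdx n d) ℂ,
      (∀ c : Fin d → Fin n → ℂ, eval (coords d (∏ i, linForm (c i))) g = 0) →
        eval (coords d f) g = 0) :
    ∃ c : Fin d → Fin n → ℂ, f = ∏ i, linForm (c i) := by
  let F := FractionRing (MvPolynomial (Fin d × Fin n) ℂ)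
  let j : MvPolynomial (Fin d × Fin n) ℂ →+* F := algebraMap _ _
  have hj : Function.Injective j := IsFractionRing.injective _ _
  let φ₀ : MvPolynomial (DegIdx n d) ℂ →+* MvPolynomial (Fin d × Fin n) ℂ :=
    (aeval (coords d (genericProd n d))).toRingHom
  obtain ⟨V, ψ, ι, hψ, hι⟩ := exists_valuationSubring_of_ker_le (j.comp φ₀) (coords d f) (by
    intro g hg
    refine h g fun c => ?_
    have hg0 : φ₀ g = 0 := hj (by rw [map_zero]; exact hg)
    have h1 := congrArg (eval fun x : Fin d × Fin n => c x.1 x.2) hg0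
    rw [map_zero] at h1
    rw [← h1]
    have h2 := map_genericProd (n := n) (d := d) (eval fun x : Fin d × Fin n => c x.1 x.2)
    simp only [eval_X] at h2
    rw [← h2, map_coords]
    simp only [φ₀, AlgHom.toRingHom_eq_coe, RingHom.coe_coe, aeval_def, algebraMap_eq]
    rw [← coe_eval₂Hom, ← RingHom.comp_apply]
    refine (DFunLike.congr_fun (ringHom_ext (fun r => ?_) fun α => ?_ :
      ((eval fun x : Fin d × Fin n => c x.1 x.2).comp
        (eval₂Hom C (coords d (genericProd n d)))) = eval _) g).symm <;> simp)
  let κ := IsLocalRing.ResidueField V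
  let res : V →+* κ := IsLocalRing.residue V
  have hT : ∀ i : Fin d, (fun a : Fin n => j (X (i, a))) ≠ 0 ∨ n = 0 := by
    intro i
    rcases Nat.eq_zero_or_pos n with hn | hn
    · exact Or.inr hn
    · refine Or.inl fun h0 => ?_
      have h1 := congrFun h0 ⟨0, hn⟩
      exact X_ne_zero _ (hj (h1.trans (map_zero j).symm))
  rcases Nat.eq_zero_or_pos n with hn | hn
  · subst hn
    refine ⟨fun _ => 0, ?_⟩
    have h0 : ∏ i : Fin d, linForm ((fun _ => 0 : Fin d → Fin 0 → ℂ) i) = 0 :=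
      Finset.prod_eq_zero (Finset.mem_univ 0) (map_zero _)
    rw [h0]
    refine hf.ext_coords (isHomogeneous_zero _ _ _) ?_
    ext ⟨α, hα⟩
    exact absurd (by rw [← hα, Subsingleton.elim α 0]; simp) (NeZero.ne d)
  choose b u hb hu a ha using fun i =>
    exists_smul_eq_with_unit_coordinate V _ ((hT i).resolve_right hn.ne')
  let Q : MvPolynomial (Fin n) V := ∏ i, linForm (u i)
  have hQ : MvPolynomial.map res Q ≠ 0 := by
    simp only [Q, map_prod, map_linForm]
    refine Finset.prod_ne_zero_iff.2 fun i _ h0 => ?_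
    have h1 := congrFun (linForm_injective (h0.trans (map_zero linForm).symm)) (a i)
    rw [ha, map_one] at h1
    exact one_ne_zero h1
  let P : MvPolynomial (Fin n) V := MvPolynomial.map ψ
    (∑ᶠ α : DegIdx n d, monomial α.1 (X α))
  have hgen : (genericProd n d).IsHomogeneous d := by
    have h0 := prod_linForm_isHomogeneous Finset.univ
      (fun (i : Fin d) (a : Fin n) => (X (i, a) : MvPolynomial (Fin d × Fin n) ℂ))
    rwa [Finset.card_univ, Fintype.card_fin] at h0
  have : Fintype (DegIdx n d) := Fintype.ofFinite _
  have hPF : MvPolynomial.map V.subtype P = (∏ i, b i) • MvPolynomial.map V.subtype Q := by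
    have h1 : MvPolynomial.map V.subtype P = MvPolynomial.map j (genericProd n d) := by
      rw [hgen.sum_monomial_coords]
      simp only [P, finsum_eq_sum_of_fintype, map_sum, map_monomial]
      refine Finset.sum_congr rfl fun α _ => ?_
      congr 1
      refine (hψ (X α)).trans ?_
      simp [φ₀]
    rw [h1, map_genericProd, map_prod, ← Finset.prod_smul]
    refine Finset.prod_congr rfl fun i _ => ?_
    rw [map_linForm, ← map_smul]
    congr 1
    ext x
    exact hu i x
  have hPκ : MvPolynomial.map res P = MvPolynomial.map ι f := by
    conv_rhs => rw [hf.sum_monomial_coords]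
    simp only [P, finsum_eq_sum_of_fintype, map_sum, map_monomial]
    refine Finset.sum_congr rfl fun α _ => ?_
    rw [show res (ψ (X α)) = ι (eval (coords d f) (X α)) from hι (X α), eval_X]
  have hVinj : Function.Injective (MvPolynomial.map (σ := Fin n) V.subtype) :=
    map_injective _ Subtype.val_injective
  have hb0 : (∏ i, b i) ≠ 0 := Finset.prod_ne_zero_iff.2 fun i _ => hb i
  by_cases hbV : (∏ i, b i) ∈ V
  · have h1 : P = (⟨∏ i, b i, hbV⟩ : V) • Q := by
      apply hVinj
      rw [hPF, smul_eq_C_mul, smul_eq_C_mul, map_mul, map_C]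
      rfl
    have h2 : MvPolynomial.map ι f = res ⟨∏ i, b i, hbV⟩ • ∏ i, linForm fun a => res (u i a) := by
      rw [← hPκ, h1, smul_eq_C_mul, smul_eq_C_mul, map_mul, map_C]
      simp only [Q, map_prod, map_linForm]
    generalize res ⟨∏ i, b i, hbV⟩ = β at h2
    refine exists_prod_linForm_of_extension ι (Function.update (fun i a => res (u i a)) 0
      (β • fun a => res (u 0 a))) ?_
    rw [h2, ← Finset.mul_prod_erase _ _ (Finset.mem_univ (0 : Fin d)),
      ← Finset.mul_prod_erase _ _ (Finset.mem_univ (0 : Fin d)), Function.update_self, map_smul,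
      smul_mul_assoc]
    congr 2
    refine Finset.prod_congr rfl fun i hi => ?_
    rw [Function.update_of_ne (Finset.ne_of_mem_erase hi)]
  · exfalso
    have hinv : (∏ i, b i)⁻¹ ∈ V := (V.mem_or_inv_mem _).resolve_left hbV
    have h1 : Q = (⟨(∏ i, b i)⁻¹, hinv⟩ : V) • P := by
      apply hVinj
      rw [smul_eq_C_mul, map_mul, map_C, hPF, ← smul_eq_C_mul]
      exact (inv_smul_smul₀ hb0 _).symm
    have h2 : res ⟨(∏ i, b i)⁻¹, hinv⟩ = 0 := by
      rw [IsLocalRing.residue_eq_zero_iff, IsLocalRing.mem_maximalIdeal, mem_nonunits_iff]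
      intro hunit
      obtain ⟨v, hv⟩ := hunit.exists_right_inv
      have h3 : (∏ i, b i)⁻¹ * (v : F) = 1 := congrArg Subtype.val hv
      have h4 : (v : F) = ∏ i, b i := by
        rw [inv_mul_eq_iff_eq_mul₀ hb0, mul_one] at h3
        exact h3
      exact hbV (h4 ▸ v.2)
    refine hQ ?_
    rw [h1, smul_eq_C_mul, map_mul, map_C, h2, map_zero, zero_mul]

end Closed

/-! ### Amalgamation of fields and ultraproducts -/

section Ultraproduct

open TensorProduct in
theorem exists_compositum.{u, v, w} (k : Type w) {F : Type u} {K : Type v} [Field k]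
    [Field F] [Field K] [Algebra k F]
    [Algebra k K] : ∃ (K' : Type (max u v)) (_ : Field K') (i : F →+* K') (j : K →+* K'),
      ∀ x : k, i (algebraMap k F x) = j (algebraMap k K x) := by
  have : Nontrivial (F ⊗[k] K) :=
    (Algebra.TensorProduct.includeLeft_injective (S := k) (algebraMap k K).injective).nontrivial
  obtain ⟨M, hM⟩ := Ideal.exists_maximal (F ⊗[k] K)
  refine ⟨(F ⊗[k] K) ⧸ M, Ideal.Quotient.field M,
    (Ideal.Quotient.mk M).comp Algebra.TensorProduct.includeLeftRingHom,
    (Ideal.Quotient.mk M).comp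
      (Algebra.TensorProduct.includeRight : K →ₐ[k] F ⊗[k] K).toRingHom, fun x => ?_⟩
  refine congrArg (Ideal.Quotient.mk M) ?_
  refine Eq.trans ?_ (AlgHom.commutes Algebra.TensorProduct.includeRight _).symm
  exact (Algebra.TensorProduct.algebraMap_apply _).symm

theorem exists_field_amalgam.{u, v, w} {B : Type w} {F : Type u} {K : Type v} [CommRing B]
    [Field F] [Field K]
    (a : B →+* F) (b : B →+* K) (h : RingHom.ker a = RingHom.ker b) :
    ∃ (K' : Type (max u v)) (_ : Field K') (i : F →+* K') (j : K →+* K'), ∀ x, i (a x) = j (b x) := by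
  have hp : (RingHom.ker a).IsPrime := RingHom.ker_isPrime a
  let k := FractionRing (B ⧸ RingHom.ker a)
  let a' : (B ⧸ RingHom.ker a) →+* F := Ideal.Quotient.lift _ a fun x hx => hx
  let b' : (B ⧸ RingHom.ker a) →+* K := Ideal.Quotient.lift _ b fun x hx => by
    rw [h] at hx
    exact hx
  have ha' : Function.Injective a' := RingHom.lift_injective_of_ker_le_ideal _ _ le_rfl
  have hb' : Function.Injective b' := RingHom.lift_injective_of_ker_le_ideal _ _ h.ge
  let _ : Algebra k F := (IsFractionRing.lift ha').toAlgebra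
  let _ : Algebra k K := (IsFractionRing.lift hb').toAlgebra
  obtain ⟨K', _, i, j, hij⟩ := exists_compositum k (F := F) (K := K)
  refine ⟨K', inferInstance, i, j, fun x => ?_⟩
  have h1 : a x = algebraMap k F (algebraMap _ k (Ideal.Quotient.mk (RingHom.ker a) x)) :=
    (IsFractionRing.lift_algebraMap (K := k) ha' (Ideal.Quotient.mk _ x)).symm
  have h2 : b x = algebraMap k K (algebraMap _ k (Ideal.Quotient.mk (RingHom.ker a) x)) :=
    (IsFractionRing.lift_algebraMap (K := k) hb' (Ideal.Quotient.mk _ x)).symm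
  rw [h1, h2, hij]

variable {J : Type*} (𝒰 : Ultrafilter J)

theorem isAlgClosed_germ {k : Type*} [Field k] [IsAlgClosed k] :
    IsAlgClosed ((𝒰 : Filter J).Germ k) := by
  refine IsAlgClosed.of_exists_root _ fun p hp hirr => ?_
  choose c hc using fun i => Quotient.exists_rep (p.coeff i)
  have hN : p.natDegree ≠ 0 := hirr.natDegree_pos.ne'
  have hroot : ∀ h, ∃ r : k, r ^ p.natDegree +
      ∑ i ∈ Finset.range p.natDegree, c i h * r ^ i = 0 := by
    intro h
    let q : Polynomial k := ∑ i ∈ Finset.range p.natDegree, Polynomial.C (c i h) * Polynomial.X ^ i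
    have hq : q.degree < p.natDegree := by
      refine (Polynomial.degree_sum_le _ _).trans_lt ?_
      refine (Finset.sup_lt_iff (WithBot.bot_lt_coe _)).2 fun i hi => ?_
      exact (Polynomial.degree_C_mul_X_pow_le _ _).trans_lt
        (by exact_mod_cast Finset.mem_range.1 hi)
    obtain ⟨r, hr⟩ := IsAlgClosed.exists_root (Polynomial.X ^ p.natDegree + q) (by
      rw [Polynomial.degree_add_eq_left_of_degree_lt (by rwa [Polynomial.degree_X_pow]),
        Polynomial.degree_X_pow]
      exact_mod_cast hN)
    refine ⟨r, ?_⟩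
    simpa [q, Polynomial.eval_finsetSum] using hr
  choose r hr using hroot
  refine ⟨(r : (𝒰 : Filter J).Germ k), ?_⟩
  rw [hp.as_sum]
  simp only [Polynomial.eval_add, Polynomial.eval_pow, Polynomial.eval_X,
    Polynomial.eval_finsetSum, Polynomial.eval_mul, Polynomial.eval_C]
  have : Filter.Germ.coeRingHom (𝒰 : Filter J) (r ^ p.natDegree +
      ∑ i ∈ Finset.range p.natDegree, c i * r ^ i) = 0 := by
    rw [show (r ^ p.natDegree + ∑ i ∈ Finset.range p.natDegree, c i * r ^ i) = 0 by
      ext h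
      simpa using hr h, map_zero]
  rw [map_add, map_pow, map_sum] at this
  simp only [map_mul, map_pow] at this
  rw [← this]
  congr 1
  refine Finset.sum_congr rfl fun i _ => ?_
  rw [← hc]
  rfl

theorem MvPolynomial.map_eq_zero_iff_forall_mem_support {σ R S : Type*} [CommRing R] [CommRing S]
    (φ : R →+* S) (Q : MvPolynomial σ R) :
    MvPolynomial.map φ Q = 0 ↔ ∀ α ∈ Q.support, φ (coeff α Q) = 0 := by
  refine ⟨fun h α _ => by rw [← coeff_map, h, coeff_zero], fun h => ?_⟩
  ext α
  rw [coeff_map, coeff_zero]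
  by_cases hα : α ∈ Q.support
  · exact h α hα
  · rw [notMem_support_iff.1 hα, map_zero]

theorem map_germ_eq_zero_iff {σ k : Type*} [Field k] (Q : MvPolynomial σ (J → k)) :
    MvPolynomial.map (Filter.Germ.coeRingHom (𝒰 : Filter J)) Q = 0 ↔
      ∀ᶠ h in 𝒰, MvPolynomial.map (Pi.evalRingHom (fun _ : J => k) h) Q = 0 := by
  simp only [map_eq_zero_iff_forall_mem_support]
  rw [Filter.eventually_all_finset]
  exact forall₂_congr fun α _ => Filter.Germ.coe_eq

theorem map_germ_eq_iff {σ k : Type*} [Field k] (Q Q' : MvPolynomial σ (J → k)) :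
    MvPolynomial.map (Filter.Germ.coeRingHom (𝒰 : Filter J)) Q =
        MvPolynomial.map (Filter.Germ.coeRingHom (𝒰 : Filter J)) Q' ↔
      ∀ᶠ h in 𝒰, MvPolynomial.map (Pi.evalRingHom (fun _ : J => k) h) Q =
        MvPolynomial.map (Pi.evalRingHom (fun _ : J => k) h) Q' := by
  simp only [← sub_eq_zero (b := MvPolynomial.map _ Q'), ← map_sub]
  exact map_germ_eq_zero_iff 𝒰 _

end Ultraproduct

theorem exists_ultrafilter_of_prime.{u, v} {k : Type u} {ι : Type v} [Field k]
    (I : Ideal (MvPolynomial ι k))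
    [hI : I.IsPrime] (P : (ι → k) → Prop)
    (h : ∀ g ∉ I, ∃ p, P p ∧ (∀ q ∈ I, eval p q = 0) ∧ eval p g ≠ 0) :
    ∃ (J : Type (max u v)) (𝒰 : Ultrafilter J) (p : J → ι → k), (∀ h, P (p h)) ∧
      ∀ q, (∀ᶠ h in 𝒰, eval (p h) q = 0) ↔ q ∈ I := by
  let J := {g : MvPolynomial ι k // g ∉ I}
  choose p hP hp0 hp using fun g : J => h g.1 g.2
  let A : J → Set J := fun g => {f | g.1 ∣ f.1}
  have : Nonempty J := ⟨⟨1, fun h1 => hI.ne_top ((Ideal.eq_top_iff_one I).2 h1)⟩⟩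
  have : (⨅ g : J, Filter.principal (A g)).NeBot := by
    refine Filter.iInf_neBot_of_directed' (fun g g' => ?_) fun g =>
      Filter.principal_neBot_iff.2 ⟨g, dvd_rfl⟩
    refine ⟨⟨g.1 * g'.1, fun hm => (hI.mem_or_mem hm).elim g.2 g'.2⟩, ?_, ?_⟩
    · exact Filter.principal_mono.2 fun f hf => (Dvd.intro _ rfl).trans hf
    · exact Filter.principal_mono.2 fun f hf => (Dvd.intro_left _ rfl).trans hf
  refine ⟨J, Ultrafilter.of (⨅ g : J, Filter.principal (A g)), p, hP, fun q => ⟨fun hq => ?_,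
    fun hq => Filter.Eventually.of_forall fun f => hp0 f q hq⟩⟩
  by_contra hqI
  have h1 : A ⟨q, hqI⟩ ∈ (Ultrafilter.of (⨅ g : J, Filter.principal (A g)) : Filter J) :=
    Ultrafilter.of_le _ (Filter.mem_iInf_of_mem _ (Filter.mem_principal_self _))
  obtain ⟨f, hf0, hf⟩ := (hq.and h1).exists
  obtain ⟨r, hr⟩ : q ∣ f.1 := hf
  exact hp f (by rw [hr, eval_mul, hf0, zero_mul])

/-! ### Generic sums of products of linear forms -/

section ChartSum
variable {m d s : ℕ}

theorem sum_prod_linForm_isHomogeneous {R : Type*} [CommRing R] {n : ℕ}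
    (ℓ : Fin m → Fin d → Fin n → R) : (∑ j, ∏ i, linForm (ℓ j i)).IsHomogeneous d := by
  refine IsHomogeneous.sum _ _ _ fun j _ => ?_
  have h0 := prod_linForm_isHomogeneous Finset.univ (ℓ j)
  rwa [Finset.card_univ, Fintype.card_fin] at h0

theorem chartForm_isHomogeneous {R : Type*} [CommRing R] (z : ChartIdx d s → R) :
    (chartForm z).IsHomogeneous d := by
  have h0 := prod_linForm_isHomogeneous Finset.univ (chartVec z)
  rw [Finset.card_univ, Fintype.card_fin] at h0
  rw [chartForm, smul_eq_C_mul]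
  simpa using (isHomogeneous_C _ (z none)).mul h0

theorem sum_chartForm_isHomogeneous {R : Type*} [CommRing R] (z : Fin m → ChartIdx d s → R) :
    (∑ j, chartForm (z j)).IsHomogeneous d :=
  IsHomogeneous.sum _ _ _ fun j _ => chartForm_isHomogeneous (z j)

theorem exists_prod_linForm_eq_chartForm {R : Type*} [CommRing R] [NeZero d]
    (z : ChartIdx d s → R) : ∃ ℓ : Fin d → Fin (s + 1) → R,
      ∏ i, linForm (ℓ i) = chartForm z := by
  refine ⟨Function.update (chartVec z) 0 (z none • chartVec z 0), ?_⟩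
  rw [chartForm, ← Finset.mul_prod_erase _ _ (Finset.mem_univ (0 : Fin d)),
    ← Finset.mul_prod_erase _ _ (Finset.mem_univ (0 : Fin d)), Function.update_self, map_smul,
    smul_mul_assoc]
  congr 2
  refine Finset.prod_congr rfl fun i hi => ?_
  rw [Function.update_of_ne (Finset.ne_of_mem_erase hi)]

theorem aeval_coords_map {A A' : Type*} [CommRing A] [CommRing A'] [Algebra ℂ A] [Algebra ℂ A']
    {n : ℕ} (φ : A →ₐ[ℂ] A') (P : MvPolynomial (Fin n) A) (g : MvPolynomial (DegIdx n d) ℂ) :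
    aeval (coords d (MvPolynomial.map φ.toRingHom P)) g = φ (aeval (coords d P) g) := by
  rw [map_coords]
  exact (comp_aeval_apply (coords d P) φ g).symm

variable (m d s) in
/-- The sum of `m` forms in the chart with indeterminate parameters. -/
def chartSum : MvPolynomial (Fin (s + 1)) (MvPolynomial (Fin m × ChartIdx d s) ℂ) :=
  ∑ j, chartForm fun l => X (j, l)

theorem map_chartSum {A : Type*} [CommRing A] (φ : MvPolynomial (Fin m × ChartIdx d s) ℂ →+* A) :
    MvPolynomial.map φ (chartSum m d s) = ∑ j, chartForm fun l => φ (X (j, l)) := by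
  simp only [chartSum, map_sum, map_chartForm]

variable (m d s) in
/-- The comorphism of the parametrization by sums of `m` forms in the chart. -/
def chartSumHom : MvPolynomial (DegIdx (s + 1) d) ℂ →ₐ[ℂ] MvPolynomial (Fin m × ChartIdx d s) ℂ :=
  aeval (coords d (chartSum m d s))

theorem aeval_coords_sum_chartForm {A : Type*} [CommRing A] [Algebra ℂ A]
    (z : Fin m → ChartIdx d s → A) (g : MvPolynomial (DegIdx (s + 1) d) ℂ) :
    aeval (coords d (∑ j, chartForm (z j))) g =
      aeval (fun x : Fin m × ChartIdx d s => z x.1 x.2) (chartSumHom m d s g) := by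
  rw [chartSumHom, ← aeval_coords_map, map_chartSum]
  simp

theorem exists_field_embedding (σ : Type) : ∃ (F : Type) (_ : Field F) (_ : Algebra ℂ F)
    (φ : MvPolynomial σ ℂ →ₐ[ℂ] F), Function.Injective φ :=
  ⟨FractionRing (MvPolynomial σ ℂ), inferInstance, inferInstance, IsScalarTower.toAlgHom _ _ _,
    IsFractionRing.injective _ _⟩

theorem eval_eq_zero_of_chartSumHom_eq_zero {g : MvPolynomial (DegIdx (s + 1) d) ℂ}
    (hg : chartSumHom m d s g = 0) (ℓ : Fin m → Fin d → Fin (s + 1) → ℂ) :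
    eval (coords d (∑ j, ∏ i, linForm (ℓ j i))) g = 0 := by
  obtain ⟨F, _, _, φ, hφ⟩ := exists_field_embedding (Fin m × Fin d × Fin (s + 1))
  let P : MvPolynomial (Fin (s + 1)) (MvPolynomial (Fin m × Fin d × Fin (s + 1)) ℂ) :=
    ∑ j, ∏ i, linForm fun a => X (j, i, a)
  have hP : ∀ {A : Type} [CommRing A] (φ : MvPolynomial (Fin m × Fin d × Fin (s + 1)) ℂ →+* A),
      MvPolynomial.map φ P = ∑ j, ∏ i, linForm fun a => φ (X (j, i, a)) := by
    intro A _ φ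
    simp only [P, map_sum, map_prod, map_linForm]
  choose w _ hw using fun j => exists_chartForm_of_ne_zero
    (fun i a => φ (X (j, i, a))) fun i h0 => X_ne_zero _ (hφ (h0.trans (map_zero φ).symm))
  have h1 : aeval (coords d P) g = 0 := by
    apply hφ
    rw [map_zero, ← aeval_coords_map, hP]
    refine Eq.trans (congrArg (fun Q => aeval (coords d Q) g)
      (Finset.sum_congr rfl fun j _ => hw j)) ?_
    rw [aeval_coords_sum_chartForm, hg, map_zero]
  have h2 := aeval_coords_map (aeval fun x : Fin m × Fin d × Fin (s + 1) => ℓ x.1 x.2.1 x.2.2) P g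
  rw [h1, map_zero, hP] at h2
  simpa only [AlgHom.toRingHom_eq_coe, RingHom.coe_coe, aeval_X, aeval_eq_eval] using h2

end ChartSum

section GenericPoint
universe u
variable {m d s : ℕ} {J : Type u} (𝒰 : Ultrafilter J) (p : J → DegIdx (s + 1) d → ℂ)

theorem exists_extension_germ
    (hp : ∀ q, (∀ᶠ h in 𝒰, eval (p h) q = 0) ↔ chartSumHom m d s q = 0) :
    ∃ (K : Type u) (_ : Field K) (_ : Algebra ℂ K) (z : Fin m → ChartIdx d s → K)
      (φ : (𝒰 : Filter J).Germ ℂ →+* K),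
      AlgebraicIndependent ℂ (fun x : Fin m × ChartIdx d s => z x.1 x.2) ∧
      ∀ α, φ (Filter.Germ.coeRingHom (𝒰 : Filter J) fun h => p h α) =
        coords d (∑ j, chartForm (z j)) α := by
  obtain ⟨F, _, _, a, ha⟩ := exists_field_embedding (Fin m × ChartIdx d s)
  let θ : MvPolynomial (DegIdx (s + 1) d) ℂ →+* (𝒰 : Filter J).Germ ℂ :=
    (Filter.Germ.coeRingHom (𝒰 : Filter J)).comp (RingHom.pi fun h => eval (p h))
  obtain ⟨K, _, i, φ, hiφ⟩ := exists_field_amalgam (a.comp (chartSumHom m d s)).toRingHom θ (by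
    ext q
    rw [RingHom.mem_ker, RingHom.mem_ker]
    refine Iff.trans ?_ ((hp q).symm.trans Filter.Germ.coe_eq.symm)
    exact map_eq_zero_iff _ ha)
  let _ : Algebra ℂ K := (i.comp (algebraMap ℂ F)).toAlgebra
  let ψ : MvPolynomial (Fin m × ChartIdx d s) ℂ →ₐ[ℂ] K :=
    { i.comp a.toRingHom with commutes' := fun r => congrArg i (a.commutes r) }
  have hψ : Function.Injective ψ := i.injective.comp ha
  refine ⟨K, inferInstance, inferInstance, fun j l => ψ (X (j, l)), φ, ?_, fun α => ?_⟩
  · have : aeval (fun x => ψ (X x)) = ψ := (aeval_unique ψ).symm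
    exact (congrArg (fun f : _ →ₐ[ℂ] K => Function.Injective f) this).mpr hψ
  · have h1 := hiφ (X α)
    have h2 := congrFun (map_coords (d := d) ψ.toRingHom (chartSum m d s)) α
    rw [map_chartSum] at h2
    refine Eq.trans ?_ (h1.symm.trans ?_)
    · exact congrArg (fun f => φ (Filter.Germ.coeRingHom (𝒰 : Filter J) f))
        (funext fun h => (eval_X _).symm)
    · refine Eq.trans ?_ h2.symm
      simp [chartSumHom]
      rfl

end GenericPoint

section GenericUniqueness
variable {m d s : ℕ} {J : Type*} (𝒰 : Ultrafilter J) (p : J → DegIdx (s + 1) d → ℂ)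

theorem eventually_exists_eq_coords_sum_chartForm
    (hp : ∀ q, (∀ᶠ h in 𝒰, eval (p h) q = 0) ↔ chartSumHom m d s q = 0) :
    ∀ᶠ h in 𝒰, ∃ z : Fin m → ChartIdx d s → ℂ, p h = coords d (∑ j, chartForm (z j)) := by
  obtain ⟨K, _, _, z, φ, -, hz⟩ := exists_extension_germ 𝒰 p hp
  have := isAlgClosed_germ (k := ℂ) 𝒰
  let G : MvPolynomial (Fin (s + 1)) (MvPolynomial (Fin m × ChartIdx d s) ((𝒰 : Filter J).Germ ℂ)) :=
    ∑ j, chartForm fun l => X (j, l)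
  let π : DegIdx (s + 1) d → (𝒰 : Filter J).Germ ℂ := fun α =>
    Filter.Germ.coeRingHom (𝒰 : Filter J) fun h => p h α
  have hG : ∀ {A : Type _} [CommRing A]
      (χ : MvPolynomial (Fin m × ChartIdx d s) ((𝒰 : Filter J).Germ ℂ) →+* A) (α),
      χ (coords d G α) = coords d (∑ j, chartForm fun l => χ (X (j, l))) α := by
    intro A _ χ α
    rw [← congrFun (map_coords χ G) α]
    simp only [G, map_sum, map_chartForm]
  obtain ⟨y, hy⟩ := exists_common_zero_of_extension φ
    (Set.range fun α => coords d G α - C (π α)) (fun x => z x.1 x.2) (by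
      rintro _ ⟨α, rfl⟩
      rw [eval₂_sub, eval₂_C, sub_eq_zero, ← coe_eval₂Hom, hG, hz]
      simp)
  choose Y hY using fun x => Quotient.exists_rep (y x)
  let Q : MvPolynomial (Fin (s + 1)) (J → ℂ) := ∑ j, chartForm fun l => Y (j, l)
  have h1 : ∀ α, ∀ᶠ h in 𝒰, coords d Q α h = p h α := by
    intro α
    refine Filter.Germ.coe_eq.1 ?_
    have h2 := hy _ ⟨α, rfl⟩
    rw [eval_sub, eval_C, sub_eq_zero, hG] at h2
    refine Eq.trans ?_ h2
    refine (congrFun (map_coords (Filter.Germ.coeRingHom (𝒰 : Filter J)) Q) α).symm.trans ?_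
    congr 1
    simp only [Q, map_sum, map_chartForm, eval_X]
    refine Finset.sum_congr rfl fun j _ => congrArg chartForm (funext fun l => hY _)
  filter_upwards [Filter.eventually_all.2 h1] with h hh
  refine ⟨fun j l => Y (j, l) h, funext fun α => ?_⟩
  rw [← hh α]
  refine (congrFun (map_coords (Pi.evalRingHom (fun _ : J => ℂ) h) Q) α).symm.trans ?_
  congr 1
  simp only [Q, map_sum, map_chartForm]
  rfl

theorem eventually_exists_perm (hs : 2 ≤ s) (hd : 3 ≤ d)
    (hm : (d * s + 1) * (m + 1 + (d * s + 1)) ≤ Nat.choose (s + d) d)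
    (hp : ∀ q, (∀ᶠ h in 𝒰, eval (p h) q = 0) ↔ chartSumHom m d s q = 0)
    (ℓ ℓ' : J → Fin m → Fin d → Fin (s + 1) → ℂ)
    (hℓ : ∀ᶠ h in 𝒰, p h = coords d (∑ j, ∏ i, linForm (ℓ h j i)))
    (hℓ' : ∀ᶠ h in 𝒰, p h = coords d (∑ j, ∏ i, linForm (ℓ' h j i))) :
    ∀ᶠ h in 𝒰, ∃ e : Equiv.Perm (Fin m),
      ∀ j, ∏ i, linForm (ℓ' h j i) = ∏ i, linForm (ℓ h (e j) i) := by
  obtain ⟨K, _, _, z, φ, hind, hz⟩ := exists_extension_germ 𝒰 p hp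
  let coe : (J → ℂ) →+* (𝒰 : Filter J).Germ ℂ := Filter.Germ.coeRingHom (𝒰 : Filter J)
  let Q : (J → Fin m → Fin d → Fin (s + 1) → ℂ) → Fin m → MvPolynomial (Fin (s + 1)) (J → ℂ) :=
    fun L j => ∏ i, linForm fun a h => L h j i a
  have hQ : ∀ L j h, MvPolynomial.map (Pi.evalRingHom (fun _ : J => ℂ) h) (Q L j) =
      ∏ i, linForm (L h j i) := by
    intro L j h
    simp only [Q, map_prod, map_linForm]
    rfl
  have key : ∀ L : J → Fin m → Fin d → Fin (s + 1) → ℂ,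
      (∀ᶠ h in 𝒰, p h = coords d (∑ j, ∏ i, linForm (L h j i))) →
      ∃ e : Equiv.Perm (Fin m), ∀ j,
        MvPolynomial.map φ (MvPolynomial.map coe (Q L j)) = chartForm (z (e j)) := by
    intro L hL
    have hQK : ∀ j, MvPolynomial.map φ (MvPolynomial.map coe (Q L j)) =
        ∏ i, linForm fun a => φ (coe fun h => L h j i a) := by
      intro j
      simp only [Q, map_prod, map_linForm]
    obtain ⟨e, he⟩ := exists_perm_of_sum_eq hs hd hm z hind
      (fun j i a => φ (coe fun h => L h j i a)) (by
        refine (sum_prod_linForm_isHomogeneous _).ext_coords (sum_chartForm_isHomogeneous _) ?_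
        ext α
        rw [← hz, ← Finset.sum_congr rfl fun j _ => hQK j, ← map_sum, ← map_sum, map_coords,
          map_coords]
        refine congrArg φ (Filter.Germ.coe_eq.2 ?_)
        filter_upwards [hL] with h hh
        rw [hh]
        refine (congrFun (map_coords
          (Pi.evalRingHom (fun _ : J => ℂ) h) (∑ j, Q L j)) α).symm.trans ?_
        simp only [map_sum, hQ])
    exact ⟨e, fun j => (hQK j).trans (he j)⟩
  obtain ⟨e, he⟩ := key ℓ hℓ
  obtain ⟨e', he'⟩ := key ℓ' hℓ'
  have h1 : ∀ j, ∀ᶠ h in 𝒰, ∏ i, linForm (ℓ' h j i) = ∏ i, linForm (ℓ h (e.symm (e' j)) i) := by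
    intro j
    have h2 := map_injective φ φ.injective ((he' j).trans
      ((congrArg (fun t => chartForm (z t)) (e.apply_symm_apply (e' j)).symm).trans
        (he (e.symm (e' j))).symm))
    simpa only [hQ] using (map_germ_eq_iff 𝒰 _ _).1 h2
  filter_upwards [Filter.eventually_all.2 h1] with h hh
  exact ⟨e'.trans e.symm, hh⟩

/-- A nonempty open condition guaranteeing existence and uniqueness of the decomposition. -/
theorem exists_generic_unique_decomposition (hs : 2 ≤ s) (hd : 3 ≤ d)
    (hm : (d * s + 1) * (m + 1 + (d * s + 1)) ≤ Nat.choose (s + d) d) :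
    ∃ g : MvPolynomial (DegIdx (s + 1) d) ℂ, chartSumHom m d s g ≠ 0 ∧
      ∀ p : DegIdx (s + 1) d → ℂ, (∀ q, chartSumHom m d s q = 0 → eval p q = 0) →
        eval p g ≠ 0 →
        (∃ ℓ : Fin m → Fin d → Fin (s + 1) → ℂ, p = coords d (∑ j, ∏ i, linForm (ℓ j i))) ∧
        ∀ ℓ ℓ' : Fin m → Fin d → Fin (s + 1) → ℂ, p = coords d (∑ j, ∏ i, linForm (ℓ j i)) →
          p = coords d (∑ j, ∏ i, linForm (ℓ' j i)) →
          ∃ e : Equiv.Perm (Fin m), ∀ j, ∏ i, linForm (ℓ' j i) = ∏ i, linForm (ℓ (e j) i) := by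
  have : NeZero d := ⟨by omega⟩
  by_contra hcon
  push Not at hcon
  have hprime : (RingHom.ker (chartSumHom m d s)).IsPrime := RingHom.ker_isPrime _
  obtain ⟨J, 𝒰, p, hP, hp⟩ := exists_ultrafilter_of_prime (RingHom.ker (chartSumHom m d s))
    (fun p => (∃ ℓ : Fin m → Fin d → Fin (s + 1) → ℂ,
        p = coords d (∑ j, ∏ i, linForm (ℓ j i))) →
      ∃ ℓ ℓ' : Fin m → Fin d → Fin (s + 1) → ℂ, p = coords d (∑ j, ∏ i, linForm (ℓ j i)) ∧
        p = coords d (∑ j, ∏ i, linForm (ℓ' j i)) ∧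
        ∀ e : Equiv.Perm (Fin m), ∃ j, ∏ i, linForm (ℓ' j i) ≠ ∏ i, linForm (ℓ (e j) i))
    (fun g hg => by
      obtain ⟨p, h1, h2, h3⟩ := hcon g hg
      exact ⟨p, h3, h1, h2⟩)
  have hex : ∀ᶠ h in 𝒰, ∃ ℓ : Fin m → Fin d → Fin (s + 1) → ℂ,
      p h = coords d (∑ j, ∏ i, linForm (ℓ j i)) := by
    filter_upwards [eventually_exists_eq_coords_sum_chartForm 𝒰 p hp] with h ⟨z, hz⟩
    choose ℓ hℓ using fun j => exists_prod_linForm_eq_chartForm (z j)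
    exact ⟨ℓ, by simp only [hz, hℓ]⟩
  have hbad := hex.mono fun h => hP h
  obtain ⟨ℓ, hℓ⟩ := Filter.skolem.1 hbad
  obtain ⟨ℓ', hℓ'⟩ := Filter.skolem.1 hℓ
  obtain ⟨h, ⟨e, he⟩, -, -, hne⟩ := ((eventually_exists_perm 𝒰 p hs hd hm hp ℓ ℓ'
    (hℓ'.mono fun _ t => t.1) (hℓ'.mono fun _ t => t.2.1)).and hℓ').exists
  obtain ⟨j, hj⟩ := hne e
  exact hj (he j)

end GenericUniqueness

/-! ### Identifiability -/

section Identifiability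
variable {m n d s : ℕ}

theorem mem_zClosureV_of_mem {S : Set (homogeneousSubmodule (Fin n) ℂ d)}
    {x : homogeneousSubmodule (Fin n) ℂ d} (hx : x ∈ S) : x ∈ zClosureV S :=
  mem_zClosureV_iff.2 fun _ h => h x hx

theorem mem_chowVariety_iff [NeZero d] (f : homogeneousSubmodule (Fin n) ℂ d) :
    f ∈ ChowVariety n d ↔
      ∃ c : Fin d → Fin n → ℂ, (f : MvPolynomial (Fin n) ℂ) = ∏ i, linForm (c i) := by
  constructor
  · intro hf
    refine exists_prod_linForm_of_mem_closure f.2 fun g hg => ?_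
    refine mem_zClosureV_iff.1 hf g ?_
    rintro y ⟨ℓ, hℓ, hy⟩
    choose c hc using fun i => exists_linForm_of_isHomogeneous (hℓ i)
    rw [hy, Finset.prod_congr rfl fun i _ => hc i]
    exact hg c
  · rintro ⟨c, hc⟩
    exact mem_zClosureV_of_mem ⟨fun i => linForm (c i), fun i => linForm_isHomogeneous _, hc⟩

theorem exists_eq_sum_chow_iff [NeZero d] (p : homogeneousSubmodule (Fin n) ℂ d) :
    (∃ x : Fin m → homogeneousSubmodule (Fin n) ℂ d, (∀ i, x i ∈ ChowVariety n d) ∧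
      p = ∑ i, x i) ↔
    ∃ ℓ : Fin m → Fin d → Fin n → ℂ, (p : MvPolynomial (Fin n) ℂ) = ∑ j, ∏ i, linForm (ℓ j i) := by
  constructor
  · rintro ⟨x, hx, rfl⟩
    choose ℓ hℓ using fun j => (mem_chowVariety_iff _).1 (hx j)
    refine ⟨ℓ, ?_⟩
    rw [AddSubmonoidClass.coe_finsetSum]
    exact Finset.sum_congr rfl fun j _ => hℓ j
  · rintro ⟨ℓ, hℓ⟩
    refine ⟨fun j => ⟨∏ i, linForm (ℓ j i), ?_⟩, fun j => (mem_chowVariety_iff _).2 ⟨ℓ j, rfl⟩, ?_⟩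
    · have h0 := prod_linForm_isHomogeneous Finset.univ (ℓ j)
      rwa [Finset.card_univ, Fintype.card_fin] at h0
    · apply Subtype.ext
      rw [AddSubmonoidClass.coe_finsetSum]
      exact hℓ

theorem isIdentifiableV_chowVariety (hs : 2 ≤ s) (hd : 3 ≤ d)
    (hm : (d * s + 1) * (m + 1 + (d * s + 1)) ≤ Nat.choose (s + d) d) :
    IsIdentifiableV m (ChowVariety (s + 1) d) := by
  have : NeZero d := ⟨by omega⟩
  obtain ⟨g, hg0, hg⟩ := exists_generic_unique_decomposition hs hd hm
  have hvan : ∀ p ∈ secantV m (ChowVariety (s + 1) d), ∀ q, chartSumHom m d s q = 0 →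
      eval (coords d (p : MvPolynomial (Fin (s + 1)) ℂ)) q = 0 := by
    intro p hp q hq
    refine mem_zClosureV_iff.1 hp q fun y hy => ?_
    obtain ⟨ℓ, hℓ⟩ := (exists_eq_sum_chow_iff y).1 hy
    rw [hℓ]
    exact eval_eq_zero_of_chartSumHom_eq_zero hq ℓ
  refine ⟨{p | eval (coords d (p : MvPolynomial (Fin (s + 1)) ℂ)) g ≠ 0} ∩
    secantV m (ChowVariety (s + 1) d), Set.inter_subset_right,
    ⟨_, zIsOpenV_eval_ne_zero g, rfl⟩, fun x hx => mem_zClosureV_iff.2 fun q hq => ?_, ?_⟩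
  · refine hvan x hx q ?_
    by_contra hq0
    have hne : chartSumHom m d s (q * g) ≠ 0 := by
      rw [map_mul]
      exact mul_ne_zero hq0 hg0
    obtain ⟨t, ht⟩ : ∃ t, eval t (chartSumHom m d s (q * g)) ≠ 0 := by
      by_contra hall
      push Not at hall
      exact hne (MvPolynomial.funext fun t => by rw [hall t, map_zero])
    have h1 := aeval_coords_sum_chartForm (fun j l => t (j, l)) (q * g)
    simp only [aeval_eq_eval] at h1
    rw [← h1, map_mul] at ht
    choose ℓ hℓ using fun j => exists_prod_linForm_eq_chartForm fun l => t (j, l)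
    let y : homogeneousSubmodule (Fin (s + 1)) ℂ d :=
      ⟨∑ j : Fin m, chartForm fun l => t (j, l), sum_chartForm_isHomogeneous _⟩
    refine ht (mul_eq_zero_of_left (hq y ⟨right_ne_zero_of_mul ht, mem_zClosureV_of_mem ?_⟩) _)
    exact (exists_eq_sum_chow_iff y).2 ⟨ℓ, by simp only [y, hℓ]⟩
  · rintro p ⟨hpg, hp⟩
    obtain ⟨⟨ℓ, hℓ⟩, huniq⟩ := hg _ (hvan p hp) hpg
    refine ⟨(exists_eq_sum_chow_iff p).2 ⟨ℓ, IsHomogeneous.ext_coords p.2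
      (sum_prod_linForm_isHomogeneous _) hℓ⟩, fun x y hx hy hpx hpy => ?_⟩
    choose a ha using fun j => (mem_chowVariety_iff _).1 (hx j)
    choose b hb using fun j => (mem_chowVariety_iff _).1 (hy j)
    have hsum : ∀ (w : Fin m → homogeneousSubmodule (Fin (s + 1)) ℂ d)
        (c : Fin m → Fin d → Fin (s + 1) → ℂ),
        (∀ j, (w j : MvPolynomial (Fin (s + 1)) ℂ) = ∏ i, linForm (c j i)) → p = ∑ j, w j →
        coords d (p : MvPolynomial (Fin (s + 1)) ℂ) = coords d (∑ j, ∏ i, linForm (c j i)) := by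
      intro w c hw hpw
      rw [hpw, AddSubmonoidClass.coe_finsetSum, Finset.sum_congr rfl fun j _ => hw j]
    obtain ⟨e, he⟩ := huniq a b (hsum x a ha hpx) (hsum y b hb hpy)
    exact ⟨e, fun j => Subtype.ext (by rw [ha, hb, he])⟩

end Identifiability

theorem stmt_12 (n d : ℕ) (hn : 2 ≤ n) (hd : 3 ≤ d)
    (N : ℕ) (hN : N = d * (n - 1) + 1)
    (m : ℕ) (hm : 1 ≤ m)
    (hbound : N * (m + 1 + N) ≤ Nat.choose (n + d - 1) d) :
    IsIdentifiableV m (ChowVariety n d) := by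
  obtain ⟨s, rfl⟩ : ∃ s, n = s + 1 := ⟨n - 1, by omega⟩
  rw [Nat.add_sub_cancel] at hN
  rw [show s + 1 + d - 1 = s + d by omega] at hbound
  subst hN
  rcases (show s = 1 ∨ 2 ≤ s by omega) with rfl | hs
  · rw [Nat.add_comm 1 d, Nat.choose_succ_self_right] at hbound
    nlinarith
  · exact isIdentifiableV_chowVariety hs hd hbound
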